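/- Let F be an infinite field with char(F) = 3 and let d ≥ 1. Then the maximal degree D_max of elements of a minimal homogeneous system of generators of the algebra of O(3)-invariants of d generic 3×3 matrices satisfies 2d + 4 ≤ D_max ≤ 2d + 7. -/

import Mathlib

open Matrix MvPolynomial

/-- The polynomial ring `R = F[x_{ij}(k)]`, `1 ≤ i,j ≤ 3`, `1 ≤ k ≤ d`. -/
abbrev Rpoly (F : Type) [Field F] (d : ℕ) := MvPolynomial (Fin 3 × Fin 3 × Fin d) F

variable (F : Type) [Field F] (d : ℕ)

/-- The `k`-th generic 3×3 matrix `X_k`. -/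
noncomputable def genMat (k : Fin d) : Matrix (Fin 3) (Fin 3) (Rpoly F d) :=
  Matrix.of fun i j => MvPolynomial.X (i, j, k)

/-- The action of `g` on `R` by simultaneous conjugation: entries of `X_k` are replaced
by the entries of `gᵀ X_k g`. -/
noncomputable def actHom (g : Matrix (Fin 3) (Fin 3) F) : Rpoly F d →ₐ[F] Rpoly F d :=
  MvPolynomial.aeval fun p : Fin 3 × Fin 3 × Fin d =>
    ((g.map (algebraMap F (Rpoly F d)))ᵀ * genMat F d p.2.2 *
      g.map (algebraMap F (Rpoly F d))) p.1 p.2.1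

/-- The algebra `R^{O(3)}` of invariants of the orthogonal group. -/
noncomputable def invAlg : Subalgebra F (Rpoly F d) where
  carrier := {f | ∀ g : Matrix (Fin 3) (Fin 3) F, gᵀ * g = 1 → actHom F d g f = f}
  mul_mem' := by
    intro a b ha hb g hg
    rw [_root_.map_mul, ha g hg, hb g hg]
  add_mem' := by
    intro a b ha hb g hg
    rw [_root_.map_add, ha g hg, hb g hg]
  one_mem' := by
    intro g hg
    exact map_one _
  algebraMap_mem' := by
    intro r g hg
    exact (actHom F d g).commutes r

/-- The ideal of `R^{O(3)}` generated by all homogeneous invariants of positive degree. -/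
noncomputable def plusIdeal : Ideal (invAlg F d) :=
  Ideal.span {f | ∃ n : ℕ, 0 < n ∧ MvPolynomial.IsHomogeneous (f : Rpoly F d) n}

/-- The set of decomposable invariants: elements of `R^{O(3)}` lying in the square of the
ideal generated by all homogeneous invariants of positive degree. -/
noncomputable def decompSet : Set (Rpoly F d) :=
  Subtype.val '' ((plusIdeal F d ^ 2 : Ideal (invAlg F d)) : Set (invAlg F d))

open Matrix MvPolynomial
namespace O3

section tools
variable {K : Type} [Field K]

/-- pullback of functions -/
def pb {Ω Ω' : Type} (θ : Ω → Ω') : (Ω' → K) →ₐ[K] (Ω → K) where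
  toFun f := fun ω => f (θ ω)
  map_one' := rfl
  map_mul' _ _ := rfl
  map_zero' := rfl
  map_add' _ _ := rfl
  commutes' _ := rfl

@[simp] lemma pb_apply {Ω Ω' : Type} (θ : Ω → Ω') (f : Ω' → K) (ω : Ω) : pb θ f ω = f (θ ω) := rfl

noncomputable def evH (K I : Type) [Field K] : MvPolynomial I K →ₐ[K] ((I → K) → K) :=
  aeval (fun i ρ => ρ i)

@[simp] lemma evH_apply {I : Type} (P : MvPolynomial I K) (ρ : I → K) :
    evH K I P ρ = eval ρ P := by
  induction P using MvPolynomial.induction_on with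
  | C a => simp [evH]
  | add p q hp hq => simp [hp, hq]
  | mul_X p i hp => simp [hp]; simp [evH]

lemma evH_inj {I : Type} [Infinite K] : Function.Injective (evH K I) := by
  intro P Q h
  apply MvPolynomial.funext
  intro ρ
  simpa using congrFun h ρ

noncomputable def Pol (K I : Type) [Field K] : Subalgebra K ((I → K) → K) := (evH K I).range

lemma Pol.coord {I : Type} (i : I) : (fun ρ : I → K => ρ i) ∈ Pol K I :=
  ⟨X i, by ext ρ; simp⟩

lemma Pol.const {I : Type} (c : K) : (fun _ : I → K => c) ∈ Pol K I :=
  ⟨C c, by ext ρ; simp⟩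

lemma Pol.mul {I : Type} {f g : (I → K) → K} (hf : f ∈ Pol K I) (hg : g ∈ Pol K I) :
    (fun ρ => f ρ * g ρ) ∈ Pol K I := mul_mem hf hg
lemma Pol.add {I : Type} {f g : (I → K) → K} (hf : f ∈ Pol K I) (hg : g ∈ Pol K I) :
    (fun ρ => f ρ + g ρ) ∈ Pol K I := add_mem hf hg
lemma Pol.sub {I : Type} {f g : (I → K) → K} (hf : f ∈ Pol K I) (hg : g ∈ Pol K I) :
    (fun ρ => f ρ - g ρ) ∈ Pol K I := sub_mem hf hg
lemma Pol.neg {I : Type} {f : (I → K) → K} (hf : f ∈ Pol K I) :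
    (fun ρ => - f ρ) ∈ Pol K I := neg_mem hf
lemma Pol.pow {I : Type} {f : (I → K) → K} (hf : f ∈ Pol K I) (n : ℕ) :
    (fun ρ => f ρ ^ n) ∈ Pol K I := pow_mem hf n
lemma Pol.sum {I α : Type} (s : Finset α) {f : α → (I → K) → K} (hf : ∀ a, f a ∈ Pol K I) :
    (fun ρ => ∑ a ∈ s, f a ρ) ∈ Pol K I := by
  have := sum_mem (t := s) (fun a _ => hf a)
  convert this using 1
  ext ρ; simp

lemma Pol.comp {I J : Type} {θ : (J → K) → (I → K)} (hθ : ∀ i, (fun ρ => θ ρ i) ∈ Pol K J)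
    {f : (I → K) → K} (hf : f ∈ Pol K I) : pb θ f ∈ Pol K J := by
  obtain ⟨P, rfl⟩ := hf
  induction P using MvPolynomial.induction_on with
  | C a => exact ⟨C a, by ext ρ; simp⟩
  | add p q hp hq => rw [_root_.map_add, _root_.map_add]; exact add_mem hp hq
  | mul_X p i hp =>
    rw [_root_.map_mul, _root_.map_mul]; refine mul_mem hp ?_
    convert hθ i using 1
    ext ρ; simp

lemma Pol.curve {I : Type} {f : (I → K) → K} (hf : f ∈ Pol K I) (c : I → Polynomial K) :
    ∃ p : Polynomial K, ∀ t, f (fun i => (c i).eval t) = p.eval t := by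
  obtain ⟨P, rfl⟩ := hf
  refine ⟨aeval c P, fun t => ?_⟩
  change evH K I P _ = _
  rw [evH_apply]
  induction P using MvPolynomial.induction_on with
  | C a => simp
  | add p q hp hq => simp [hp, hq]
  | mul_X p i hp => simp [hp]

lemma poly_zero_of_ne [Infinite K] (p : Polynomial K) (h : ∀ t, t ≠ 0 → p.eval t = 0) : p = 0 := by
  apply Polynomial.eq_zero_of_infinite_isRoot
  refine ((Set.infinite_univ (α := K)).sdiff (Set.finite_singleton (0:K))).mono ?_
  intro t ht
  exact h t (by simpa using ht)

/-- scaling -/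
def scal {I : Type} (w : I → ℕ) (t : K) (ρ : I → K) : I → K := fun i => t ^ w i * ρ i

lemma Pol.scal {I : Type} (w : I → ℕ) (t : K) (i : I) : (fun ρ => scal w t ρ i) ∈ Pol K I :=
  Pol.mul (Pol.const _) (Pol.coord i)

def Wt (K : Type) [Field K] {I : Type} (w : I → ℕ) (n : ℕ) : Submodule K ((I → K) → K) where
  carrier := {f | ∀ t, t ≠ 0 → ∀ ρ, f (scal w t ρ) = t ^ n * f ρ}
  zero_mem' := by intro t _ ρ; simp
  add_mem' := by
    intro f g hf hg t ht ρ
    simp only [Pi.add_apply]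
    rw [hf t ht ρ, hg t ht ρ, mul_add]
  smul_mem' := by
    intro c f hf t ht ρ
    simp only [Pi.smul_apply, smul_eq_mul]
    rw [hf t ht ρ]; ring

lemma Wt.mul {I : Type} {w : I → ℕ} {n m : ℕ} {f g : (I → K) → K} (hf : f ∈ Wt K w n)
    (hg : g ∈ Wt K w m) : f * g ∈ Wt K w (n + m) := by
  intro t ht ρ
  simp only [Pi.mul_apply]
  rw [hf t ht ρ, hg t ht ρ]; ring

lemma comp_exists [Infinite K] {I : Type} (w : I → ℕ) {f : (I → K) → K} (hf : f ∈ Pol K I) :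
    ∃ (N : ℕ) (G : ℕ → (I → K) → K), (∀ t ρ, f (scal w t ρ) = ∑ n ∈ Finset.range N, t ^ n * G n ρ) ∧
      (∀ n, G n ∈ Wt K w n) ∧
      (∀ M : Submodule K ((I → K) → K), (∀ t, t ≠ 0 → ∀ h ∈ M, pb (scal w t) h ∈ M) → f ∈ M →
        ∀ n, G n ∈ M) := by
  classical
  obtain ⟨P, rfl⟩ := hf
  let Q : Polynomial (MvPolynomial I K) :=
    aeval (fun i => Polynomial.C (X i) * Polynomial.X ^ w i) P
  have hQ : ∀ t ρ, eval (scal w t ρ) P = (Q.map (eval ρ)).eval t := by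
    intro t ρ
    simp only [Q]
    induction P using MvPolynomial.induction_on with
    | C a =>
      rw [aeval_C, IsScalarTower.algebraMap_apply K (MvPolynomial I K) (Polynomial (MvPolynomial I K))]
      simp
    | add p q hp hq => simp [hp, hq]
    | mul_X p i hp =>
      have hp' : (eval (scal w t ρ)) p = _ := hp
      simp only [_root_.map_mul, hp', Polynomial.map_mul, Polynomial.eval_mul, aeval_X, eval_X]
      simp [scal]; left; ring
  have hdeg : ∀ ρ, (Q.map (eval ρ)).degree < ((Q.natDegree + 1 : ℕ) : WithBot ℕ) := by
    intro ρ
    refine lt_of_le_of_lt (Polynomial.degree_map_le) ?_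
    exact lt_of_le_of_lt Polynomial.degree_le_natDegree (by exact_mod_cast Nat.lt_succ_self _)
  have hwt : ∀ n, (fun ρ => eval ρ (Q.coeff n)) ∈ Wt K w n := by
    intro n u hu ρ
    have key : Q.map (eval (scal w u ρ)) = (Q.map (eval ρ)).comp (Polynomial.C u * Polynomial.X) := by
      rw [← sub_eq_zero]
      apply poly_zero_of_ne
      intro t _
      rw [Polynomial.eval_sub, Polynomial.eval_comp, ← hQ, Polynomial.eval_mul, Polynomial.eval_C,
        Polynomial.eval_X, ← hQ, sub_eq_zero]
      congr 2
      ext i; simp [scal]; ring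
    have := congrArg (fun p => Polynomial.coeff p n) key
    simp only [Polynomial.coeff_map, Polynomial.comp_C_mul_X_coeff] at this
    change (eval (scal w u ρ)) (Q.coeff n) = u ^ n * (eval ρ) (Q.coeff n)
    rw [this]; ring
  refine ⟨Q.natDegree + 1, fun n ρ => eval ρ (Q.coeff n), ?_, hwt, ?_⟩
  · intro t ρ
    change evH K I P _ = _
    rw [evH_apply, hQ, Polynomial.eval_eq_sum_range' (n := Q.natDegree + 1)]
    · simp [mul_comm]
    · exact lt_of_le_of_lt Polynomial.natDegree_map_le (Nat.lt_succ_self _)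
  · intro M hM hfM n
    obtain ⟨s, hs⟩ := (((Set.infinite_univ (α := K)).sdiff (Set.finite_singleton (0:K)))).exists_subset_card_eq (Q.natDegree + 1)
    have hco : (fun ρ => eval ρ (Q.coeff n)) =
        ∑ t ∈ s, (Lagrange.basis s id t).coeff n • pb (scal w t) (evH K I P) := by
      ext ρ
      have h1 : Q.map (eval ρ) = Lagrange.interpolate s id (fun t => (Q.map (eval ρ)).eval t) := by
        apply Lagrange.eq_interpolate (by simp)
        rw [hs.2]; exact hdeg ρ
      have h2 := congrArg (fun p => Polynomial.coeff p n) h1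
      rw [Lagrange.interpolate_apply] at h2
      simp only [Polynomial.coeff_map, Polynomial.finsetSum_coeff, Polynomial.coeff_C_mul] at h2
      rw [h2]
      simp only [Finset.sum_apply, Pi.smul_apply, pb_apply, evH_apply, hQ, smul_eq_mul]
      exact Finset.sum_congr rfl fun _ _ => mul_comm _ _
    change (fun ρ => (eval ρ) (Q.coeff n)) ∈ M
    rw [hco]
    refine sum_mem fun t ht => M.smul_mem _ (hM t ?_ _ hfM)
    have := hs.1 ht
    simpa using this

/-- decomposing membership: to show `f ∈ A` one can show it for weight components. -/
lemma mem_of_comps [Infinite K] {I : Type} (w : I → ℕ) {f : (I → K) → K}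
    (A : Submodule K ((I → K) → K)) (M : Submodule K ((I → K) → K)) (hMP : M ≤ (Pol K I).toSubmodule)
    (hM : ∀ t, t ≠ 0 → ∀ h ∈ M, pb (scal w t) h ∈ M) (hf : f ∈ M)
    (h : ∀ n g, g ∈ M → g ∈ Wt K w n → g ∈ A) : f ∈ A := by
  obtain ⟨N, G, h1, h2, h3⟩ := comp_exists w (hMP hf)
  have : f = ∑ n ∈ Finset.range N, G n := by
    ext ρ
    have h4 := h1 1 ρ
    have h5 : scal w 1 ρ = ρ := by ext i; simp [scal]
    rw [h5] at h4
    simpa using h4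
  rw [this]
  exact sum_mem fun n _ => h n _ (h3 M hM hf n) (h2 n)

/-- right component -/
lemma right_comp [Infinite K] {I J : Type} (w : I → ℕ) {g : (I → K) → K} (hg : g ∈ Pol K I)
    (w' : J → ℕ) (θ : (J → K) → (I → K)) (hθ : ∀ t, t ≠ 0 → ∀ ρ, θ (scal w' t ρ) = scal w t (θ ρ)) (m : ℕ)
    (hf : pb θ g ∈ Wt K w' m) :
    ∃ g', g' ∈ Wt K w m ∧ pb θ g' = pb θ g ∧
      (∀ M : Submodule K ((I → K) → K), (∀ t, t ≠ 0 → ∀ h ∈ M, pb (scal w t) h ∈ M) → g ∈ M → g' ∈ M) := by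
  obtain ⟨N, G, h1, h2, h3⟩ := comp_exists w hg
  have key : ∀ ρ, ∑ n ∈ Finset.range N, Polynomial.C (G n (θ ρ)) * Polynomial.X ^ n =
      Polynomial.C (g (θ ρ)) * Polynomial.X ^ m := by
    intro ρ
    rw [← sub_eq_zero]
    apply poly_zero_of_ne
    intro t ht
    have e1 := hf t ht ρ
    simp only [pb_apply] at e1
    rw [hθ t ht, h1] at e1
    simp only [Polynomial.eval_sub, Polynomial.eval_finsetSum, Polynomial.eval_mul,
      Polynomial.eval_C, Polynomial.eval_pow, Polynomial.eval_X]
    rw [sub_eq_zero, mul_comm (g _), ← e1]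
    exact Finset.sum_congr rfl fun _ _ => mul_comm _ _
  have key2 : ∀ ρ, (if m < N then G m (θ ρ) else 0) = g (θ ρ) := by
    intro ρ
    have := congrArg (fun p => Polynomial.coeff p m) (key ρ)
    simp only [Polynomial.finsetSum_coeff, Polynomial.coeff_C_mul_X_pow] at this
    simpa using this
  refine ⟨if m < N then G m else 0, ?_, ?_, ?_⟩
  · split_ifs
    · exact h2 m
    · exact zero_mem _
  · ext ρ
    simp only [pb_apply, ← key2 ρ]
    split_ifs <;> rfl
  · intro M hM hgM
    split_ifs
    · exact h3 M hM hgM m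
    · exact zero_mem _

/-- weight part of a span of weight vectors. -/
lemma span_wt [Infinite K] {I : Type} (w : I → ℕ) {X : Type} (v : X → (I → K) → K) (wt : X → ℕ)
    (hv : ∀ x, v x ∈ Wt K w (wt x)) (S : Set X) {f : (I → K) → K} (hf : f ∈ Submodule.span K (v '' S))
    {n : ℕ} (hfn : f ∈ Wt K w n) : f ∈ Submodule.span K (v '' {x ∈ S | wt x = n}) := by
  classical
  rw [Finsupp.mem_span_image_iff_linearCombination] at hf
  obtain ⟨l, hl, rfl⟩ := hf
  rw [Finsupp.linearCombination_apply, Finsupp.sum] at *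
  have key : ∀ ρ, ∑ x ∈ l.support, Polynomial.C (l x * v x ρ) * Polynomial.X ^ (wt x) =
      Polynomial.C (∑ x ∈ l.support, l x * v x ρ) * Polynomial.X ^ n := by
    intro ρ
    rw [← sub_eq_zero]
    apply poly_zero_of_ne
    intro t ht
    have e1 := hfn t ht ρ
    simp only [Finset.sum_apply, Pi.smul_apply, smul_eq_mul] at e1
    simp only [Polynomial.eval_sub, Polynomial.eval_finsetSum, Polynomial.eval_mul,
      Polynomial.eval_C, Polynomial.eval_pow, Polynomial.eval_X]
    rw [sub_eq_zero, mul_comm (∑ x ∈ l.support, l x * v x ρ), ← e1]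
    refine Finset.sum_congr rfl fun x _ => ?_
    rw [hv x t ht]; ring
  have : ∑ x ∈ l.support, l x • v x = ∑ x ∈ l.support with wt x = n, l x • v x := by
    ext ρ
    have := congrArg (fun p => Polynomial.coeff p n) (key ρ)
    simp only [Polynomial.finsetSum_coeff, Polynomial.coeff_C_mul_X_pow, if_true] at this
    simp only [Finset.sum_apply, Pi.smul_apply, smul_eq_mul]
    rw [← this, Finset.sum_filter]
    exact Finset.sum_congr rfl fun x _ => by simp [eq_comm]
  rw [this]
  refine sum_mem fun x hx => Submodule.smul_mem _ _ (Submodule.subset_span ⟨x, ⟨?_, ?_⟩, rfl⟩)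
  · exact hl (Finset.mem_filter.1 hx).1
  · exact (Finset.mem_filter.1 hx).2

lemma Pol.cancel [Infinite K] {I : Type} {q h : (I → K) → K} (hq : q ∈ Pol K I) (hh : h ∈ Pol K I)
    (hq0 : q ≠ 0) (H : ∀ ρ, q ρ * h ρ = 0) : h = 0 := by
  obtain ⟨Q, rfl⟩ := hq
  obtain ⟨P, rfl⟩ := hh
  have : evH K I (Q * P) = 0 := by
    ext ρ
    have := H ρ
    simpa using this
  have h2 : Q * P = 0 := evH_inj (by simpa using this)
  rcases mul_eq_zero.1 h2 with h | h
  · exact absurd (by simp [h]) hq0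
  · simp [h]

lemma quot_inv [Infinite K] {I : Type} {q h f : (I → K) → K} (hq : q ∈ Pol K I) (hh : h ∈ Pol K I)
    (hq0 : q ≠ 0) (H : ∀ ρ, f ρ = q ρ * h ρ) (θ : (I → K) → (I → K))
    (hθ : ∀ i, (fun ρ => θ ρ i) ∈ Pol K I) (hf : ∀ ρ, f (θ ρ) = f ρ) (hqi : ∀ ρ, q (θ ρ) = q ρ) :
    ∀ ρ, h (θ ρ) = h ρ := by
  have : pb θ h - h = 0 := by
    apply Pol.cancel hq (sub_mem (Pol.comp hθ hh) hh) hq0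
    intro ρ
    have := hf ρ
    rw [H, H, hqi] at this
    simp only [Pi.sub_apply, pb_apply, mul_sub, this, sub_self]
  intro ρ
  have := congrFun this ρ
  simpa [sub_eq_zero] using this

lemma quot_wt [Infinite K] {I : Type} {q h f : (I → K) → K} (hq : q ∈ Pol K I) (hh : h ∈ Pol K I)
    (hq0 : q ≠ 0) (H : ∀ ρ, f ρ = q ρ * h ρ) {w : I → ℕ} {m c : ℕ} (hf : f ∈ Wt K w m)
    (hqw : q ∈ Wt K w c) : f = 0 ∨ (c ≤ m ∧ h ∈ Wt K w (m - c)) := by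
  have key : ∀ t, t ≠ 0 → ∀ ρ, t ^ c * h (scal w t ρ) = t ^ m * h ρ := by
    intro t ht
    have : t ^ c • pb (scal w t) h - t ^ m • h = 0 := by
      apply Pol.cancel hq (sub_mem (Subalgebra.smul_mem _ (Pol.comp (Pol.scal w t) hh) _)
        (Subalgebra.smul_mem _ hh _)) hq0
      intro ρ
      have := hf t ht ρ
      rw [H, H, hqw t ht] at this
      simp only [Pi.sub_apply, Pi.smul_apply, pb_apply, smul_eq_mul]
      linear_combination this
    intro ρ
    have := congrFun this ρ
    simpa [sub_eq_zero] using this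
  by_cases hcm : c ≤ m
  · right
    refine ⟨hcm, fun t ht ρ => ?_⟩
    have h1 := key t ht ρ
    have h2 : t ^ m = t ^ c * t ^ (m - c) := by rw [← pow_add]; congr 1; omega
    rw [h2, mul_assoc] at h1
    exact mul_left_cancel₀ (pow_ne_zero _ ht) h1
  · left
    have h0 : h = 0 := by
      ext ρ
      obtain ⟨p, hp⟩ := Pol.curve hh (fun i => Polynomial.X ^ w i * Polynomial.C (ρ i))
      have hp' : ∀ t, h (scal w t ρ) = p.eval t := by
        intro t; rw [← hp]; congr 1; ext i; simp only [scal, Polynomial.eval_mul, Polynomial.eval_pow, Polynomial.eval_X, Polynomial.eval_C]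
      have : Polynomial.X ^ (c - m) * p - Polynomial.C (h ρ) = 0 := by
        apply poly_zero_of_ne
        intro t ht
        have h1 := key t ht ρ
        have h2 : t ^ c = t ^ m * t ^ (c - m) := by rw [← pow_add]; congr 1; omega
        rw [h2, mul_assoc] at h1
        have h3 := mul_left_cancel₀ (pow_ne_zero _ ht) h1
        rw [hp'] at h3
        simp [h3]
      have := congrArg (Polynomial.eval 0) this
      simp only [Polynomial.eval_sub, Polynomial.eval_mul, Polynomial.eval_pow, Polynomial.eval_X,
        Polynomial.eval_C, Polynomial.eval_zero] at this
      rw [zero_pow (by omega)] at this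
      simpa using this
    ext ρ; rw [H, h0]; simp
end tools
end O3

open Matrix MvPolynomial
namespace O3

section division
variable {K : Type} [Field K] {I : Type}

lemma eval_supp {z : I} {P : MvPolynomial I K} (hP : P ∈ supported K ({z}ᶜ : Set I)) {ρ ρ' : I → K}
    (h : ∀ i, i ≠ z → ρ i = ρ' i) : eval ρ P = eval ρ' P := by
  rw [mem_supported] at hP
  apply MvPolynomial.hom_congr_vars
  · ext; simp
  · intro i hi _
    have : i ≠ z := by simpa using hP hi
    simpa using h i this
  · rfl

lemma X_supp {z i : I} (h : i ≠ z) : (X i : MvPolynomial I K) ∈ supported K ({z}ᶜ : Set I) :=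
  X_mem_supported.2 (by simpa using h)

lemma C_supp {z : I} (a : K) : (C a : MvPolynomial I K) ∈ supported K ({z}ᶜ : Set I) :=
  Subalgebra.algebraMap_mem _ a

lemma elim_lin (z : I) {b c : MvPolynomial I K} (hb : b ∈ supported K ({z}ᶜ : Set I))
    (hc : c ∈ supported K ({z}ᶜ : Set I)) (P : MvPolynomial I K) :
    ∃ n : ℕ, ∃ R ∈ supported K ({z}ᶜ : Set I), (b * X z - c) ∣ b ^ n * P - R := by
  induction P using MvPolynomial.induction_on with
  | C a => exact ⟨0, C a, C_supp a, by simp⟩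
  | add p q hp hq =>
    obtain ⟨n, R, hR, A, hA⟩ := hp
    obtain ⟨m, R', hR', A', hA'⟩ := hq
    refine ⟨n + m, b ^ m * R + b ^ n * R', add_mem (mul_mem (pow_mem hb _) hR) (mul_mem (pow_mem hb _) hR'),
      b ^ m * A + b ^ n * A', ?_⟩
    linear_combination b ^ m * hA + b ^ n * hA'
  | mul_X p i hp =>
    obtain ⟨n, R, hR, A, hA⟩ := hp
    by_cases hi : i = z
    · subst hi
      refine ⟨n + 1, R * c, mul_mem hR hc, b * X i * A + R, ?_⟩
      linear_combination b * X i * hA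
    · refine ⟨n, R * X i, mul_mem hR (X_supp hi), A * X i, ?_⟩
      linear_combination X i * hA

lemma elim_quad (z : I) {c : MvPolynomial I K}
    (hc : c ∈ supported K ({z}ᶜ : Set I)) (P : MvPolynomial I K) :
    ∃ B ∈ supported K ({z}ᶜ : Set I), ∃ B' ∈ supported K ({z}ᶜ : Set I),
      (X z ^ 2 - c) ∣ P - (B + B' * X z) := by
  induction P using MvPolynomial.induction_on with
  | C a => exact ⟨C a, C_supp a, 0, zero_mem _, by simp⟩
  | add p q hp hq =>
    obtain ⟨B, hB, B', hB', A, hA⟩ := hp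
    obtain ⟨D, hD, D', hD', A', hA'⟩ := hq
    refine ⟨B + D, add_mem hB hD, B' + D', add_mem hB' hD', A + A', ?_⟩
    linear_combination hA + hA'
  | mul_X p i hp =>
    obtain ⟨B, hB, B', hB', A, hA⟩ := hp
    by_cases hi : i = z
    · subst hi
      refine ⟨B' * c, mul_mem hB' hc, B, hB, A * X i + B', ?_⟩
      linear_combination X i * hA
    · refine ⟨B * X i, mul_mem hB (X_supp hi), B' * X i, mul_mem hB' (X_supp hi), A * X i, ?_⟩
      linear_combination X i * hA

variable [Infinite K]

lemma zero_of_mul_vanish {P Q : MvPolynomial I K} (hQ : Q ≠ 0) (h : ∀ ρ, eval ρ Q ≠ 0 → eval ρ P = 0) :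
    P = 0 := by
  have : Q * P = 0 := by
    apply MvPolynomial.funext
    intro ρ
    by_cases h0 : eval ρ Q = 0
    · simp [h0]
    · simp [h ρ h0]
  exact (mul_eq_zero.1 this).resolve_left hQ

open Classical in
lemma vanish_line {P : MvPolynomial I K} (i : I) (ρ : I → K) (t0 : K)
    (h : ∀ t, t ≠ t0 → eval (Function.update ρ i t) P = 0) : eval ρ P = 0 := by
  obtain ⟨p, hp⟩ := Pol.curve (f := evH K I P) ⟨P, rfl⟩
    (fun j => Function.update (fun j => Polynomial.C (ρ j)) i (Polynomial.X + Polynomial.C t0) j)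
  have hp' : ∀ t, p.eval t = eval (Function.update ρ i (t + t0)) P := by
    intro t
    rw [← hp, evH_apply]
    congr 2
    ext j
    by_cases hj : j = i
    · subst hj; simp
    · simp [hj]
  have h0 : p = 0 := by
    apply poly_zero_of_ne
    intro t ht
    rw [hp', h]
    simpa using ht
  have := hp' (ρ i - t0)
  simpa [h0] using this.symm

open Classical in
lemma div_bracket {p q p' q' : I} (h1 : p ≠ q') (h2 : q ≠ q') (h3 : p' ≠ q') (h4 : p ≠ q) (h5 : p ≠ p')
    {P : MvPolynomial I K} (hP : ∀ (ρ : I → K) t, t ≠ 0 → ρ p' = t * ρ p → ρ q' = t * ρ q → eval ρ P = 0) :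
    (X p * X q' - X q * X p') ∣ P := by
  obtain ⟨n, R, hR, A, hA⟩ := elim_lin (K := K) q' (X_supp h1) (mul_mem (X_supp h2) (X_supp h3)) P
  have hR0 : R = 0 := by
    apply zero_of_mul_vanish (Q := X p * X p') (mul_ne_zero (X_ne_zero p) (X_ne_zero p'))
    intro ρ hρ
    simp only [eval_X, _root_.map_mul] at hρ
    have hρ' := right_ne_zero_of_mul hρ
    have hρ := left_ne_zero_of_mul hρ
    let ρ' := Function.update ρ q' (ρ p' / ρ p * ρ q)
    have e : ∀ i, i ≠ q' → ρ' i = ρ i := fun i hi => by simp [ρ', hi]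
    rw [eval_supp hR (fun i hi => (e i hi).symm)]
    have hq' : ρ' q' = ρ p' / ρ p * ρ q := by simp [ρ']
    have v := hP ρ' (ρ p' / ρ p) (div_ne_zero hρ' hρ) (by rw [e _ h1, e _ h3]; field_simp) (by rw [hq', e _ h2])
    have := congrArg (eval ρ') hA
    simp only [_root_.map_sub, _root_.map_mul, v, eval_X, hq', e _ h1, e _ h2, e _ h3] at this
    have z : ρ p * (ρ p' / ρ p * ρ q) - ρ q * ρ p' = 0 := by field_simp; ring
    rw [z] at this
    simpa using this
  rw [hR0, sub_zero] at hA
  have hpr : Prime (X p : MvPolynomial I K) := X_prime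
  have hnd : ¬ (X p : MvPolynomial I K) ∣ X p * X q' - X q * X p' := by
    rintro ⟨B, hB⟩
    have := congrArg (eval (Function.update (fun _ => (1:K)) p 0)) hB
    simp [h1.symm, h4.symm, h5.symm] at this
  have := hpr.pow_dvd_of_dvd_mul_left n hnd (Dvd.intro _ hA)
  obtain ⟨B, rfl⟩ := this
  refine ⟨B, ?_⟩
  apply mul_left_cancel₀ (pow_ne_zero n (X_ne_zero (R := K) p))
  rw [hA]; ring

open Classical in
lemma div_quad {i0 i1 i2 : I} (h01 : i0 ≠ i1) (h21 : i2 ≠ i1) (h02 : i0 ≠ i2) (ε : K) (hε : ε * ε = 1)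
    (h2 : (2:K) ≠ 0)
    {P : MvPolynomial I K} (hP : ∀ (ρ : I → K) p q, p ≠ 0 → q ≠ 0 → ρ i0 = p ^ 2 → ρ i1 = p * q →
      ρ i2 = ε * q ^ 2 → eval ρ P = 0) :
    (X i1 ^ 2 - C ε * X i0 * X i2) ∣ P := by
  obtain ⟨B, hB, B', hB', A, hA⟩ := elim_quad (K := K) i1
    (mul_mem (mul_mem (C_supp ε) (X_supp h01)) (X_supp h21)) P
  have key : ∀ (ρ : I → K) p q, p ≠ 0 → q ≠ 0 → ρ i0 = p ^ 2 → ρ i2 = ε * q ^ 2 →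
      eval ρ B + eval ρ B' * (p * q) = 0 := by
    intro ρ p q hp hq e0 e2
    let ρ' := Function.update ρ i1 (p * q)
    have e : ∀ i, i ≠ i1 → ρ' i = ρ i := fun i hi => by simp [ρ', hi]
    have e1 : ρ' i1 = p * q := by simp [ρ']
    rw [eval_supp hB (fun i hi => (e i hi).symm), eval_supp hB' (fun i hi => (e i hi).symm)]
    have v := hP ρ' p q hp hq (by rw [e _ h01, e0]) e1 (by rw [e _ h21, e2])
    have := congrArg (eval ρ') hA
    simp only [_root_.map_sub, _root_.map_add, _root_.map_mul, _root_.map_pow, v, eval_X, eval_C, e1, e _ h01, e _ h21, e0, e2] at this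
    have z : (p * q) ^ 2 - ε * p ^ 2 * (ε * q ^ 2) = 0 := by linear_combination -p^2*q^2*hε
    rw [z] at this
    linear_combination -this
  have key2 : ∀ (ρ : I → K) p q, p ≠ 0 → q ≠ 0 → ρ i0 = p ^ 2 → ρ i2 = ε * q ^ 2 →
      eval ρ B = 0 ∧ eval ρ B' = 0 := by
    intro ρ p q hp hq e0 e2
    have k1 := key ρ p q hp hq e0 e2
    have k2 := key ρ (-p) q (neg_ne_zero.2 hp) hq (by rw [e0]; ring) e2
    constructor
    · apply mul_left_cancel₀ h2; linear_combination k1 + k2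
    · apply mul_left_cancel₀ (mul_ne_zero h2 (mul_ne_zero hp hq)); linear_combination k1 - k2
  have hε0 : ε ≠ 0 := by rintro rfl; simp at hε
  have hinf : (Set.range (fun p : {p : K // p ≠ 0} => (p : K) ^ 2)).Infinite := by
    intro hfin
    have : ((fun p : K => p ^ 2) ⁻¹' (Set.range (fun p : {p : K // p ≠ 0} => (p : K) ^ 2))).Finite := by
      apply hfin.preimage' 
      intro b _
      have : ((Polynomial.X ^ 2 - Polynomial.C b : Polynomial K).roots.toFinset : Set K).Finite := Finset.finite_toSet _
      refine this.subset ?_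
      intro p hp
      have hp : p ^ 2 = b := hp
      have hne : (Polynomial.X ^ 2 - Polynomial.C b : Polynomial K) ≠ 0 :=
        Polynomial.X_pow_sub_C_ne_zero (by norm_num) b
      simp [hne, hp]
    refine ((Set.infinite_univ (α := K)).sdiff (Set.finite_singleton (0:K))) (this.subset ?_)
    intro p hp
    exact ⟨⟨p, by simpa using hp⟩, rfl⟩
  let s : I → Set K := fun i => if i = i0 then Set.range (fun p : {p : K // p ≠ 0} => (p : K) ^ 2)
    else if i = i2 then (fun x => ε * x) '' Set.range (fun p : {p : K // p ≠ 0} => (p : K) ^ 2) else Set.univ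
  have hs : ∀ i, (s i).Infinite := by
    intro i
    simp only [s]
    split_ifs
    · exact hinf
    · exact hinf.image (mul_right_injective₀ hε0).injOn
    · exact Set.infinite_univ
  have fin : ∀ D : MvPolynomial I K, (∀ (ρ : I → K) p q, p ≠ 0 → q ≠ 0 → ρ i0 = p ^ 2 → ρ i2 = ε * q ^ 2 →
      eval ρ D = 0) → D = 0 := by
    intro D hD
    apply MvPolynomial.funext_set s hs
    intro ρ hρ
    have r0 := hρ i0 (Set.mem_univ _)
    have r2 := hρ i2 (Set.mem_univ _)
    simp only [s, if_true, h02.symm, if_false] at r0 r2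
    obtain ⟨p, hp⟩ := r0
    obtain ⟨_, ⟨q, rfl⟩, hq⟩ := r2
    rw [hD ρ p q p.2 q.2 hp.symm hq.symm]; simp
  have b0 := fin B fun ρ p q hp hq e0 e2 => (key2 ρ p q hp hq e0 e2).1
  have b1 := fin B' fun ρ p q hp hq e0 e2 => (key2 ρ p q hp hq e0 e2).2
  rw [b0, b1] at hA
  exact ⟨A, by simpa using hA⟩

open Classical in
lemma div_det {a b c e f g : I} (hnd : [a, b, c, e, f, g].Nodup) (h2 : (2:K) ≠ 0)
    {P : MvPolynomial I K} (hP : ∀ (ρ : I → K) y1 y2 y3 z1 z2 z3,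
      ρ a = y1 * z1 → 2 * ρ b = y1 * z2 + y2 * z1 → 2 * ρ c = y1 * z3 + y3 * z1 →
      ρ e = y2 * z2 → 2 * ρ f = y2 * z3 + y3 * z2 → ρ g = y3 * z3 → eval ρ P = 0) :
    ((X e * X g - X f ^ 2) * X a - (X b ^ 2 * X g - 2 * X b * X c * X f + X c ^ 2 * X e)) ∣ P := by
  simp only [List.nodup_cons, List.mem_cons, not_or, List.not_mem_nil, not_false_eq_true, and_true, List.nodup_nil] at hnd
  obtain ⟨⟨hab, hac, hae, haf, hag⟩, ⟨hbc, hbe, hbf, hbg⟩, ⟨hce, hcf, hcg⟩, ⟨hef, heg⟩, hfg⟩ := hnd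
  set m : MvPolynomial I K := X e * X g - X f ^ 2 with hm
  have h2C : (2 : MvPolynomial I K) = C 2 := (map_ofNat C 2).symm
  obtain ⟨n, R, hR, hdiv⟩ := elim_lin (K := K) a (b := m)
    (c := X b ^ 2 * X g - 2 * X b * X c * X f + X c ^ 2 * X e)
    (by rw [hm]; exact sub_mem (mul_mem (X_supp (Ne.symm hae)) (X_supp (Ne.symm hag))) (pow_mem (X_supp (Ne.symm haf)) _))
    (by
      rw [h2C]
      refine add_mem (sub_mem (mul_mem (pow_mem (X_supp (Ne.symm hab)) _) (X_supp (Ne.symm hag))) ?_) ?_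
      · exact mul_mem (mul_mem (mul_mem (C_supp 2) (X_supp (Ne.symm hab))) (X_supp (Ne.symm hac))) (X_supp (Ne.symm haf))
      · exact mul_mem (pow_mem (X_supp (Ne.symm hac)) _) (X_supp (Ne.symm hae))) P
  have hR0 : R = 0 := by
    apply zero_of_mul_vanish (Q := X e) (X_ne_zero e)
    intro ρ hw
    simp only [eval_X] at hw
    -- first: points with s33 = 2rz - z^2 w
    have s1 : ∀ z, z ≠ ρ f / ρ e → eval (Function.update ρ g (2 * ρ f * z - z ^ 2 * ρ e)) R = 0 := by
      intro z hz
      have hz' : ρ f - z * ρ e ≠ 0 := by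
        intro h; apply hz; field_simp; linear_combination -h
      let y1 := (ρ c - ρ b * z) / (ρ f - z * ρ e)
      have hy1 : y1 * (ρ f - z * ρ e) = ρ c - ρ b * z := by simp only [y1]; field_simp
      let ρ' := Function.update (Function.update ρ g (2 * ρ f * z - z ^ 2 * ρ e)) a (y1 * (2 * ρ b - y1 * ρ e))
      have ea : ρ' a = y1 * (2 * ρ b - y1 * ρ e) := by simp [ρ']
      have eb : ρ' b = ρ b := by simp [ρ', hbg, Ne.symm hab]
      have ec : ρ' c = ρ c := by simp [ρ', hcg, Ne.symm hac]
      have ee : ρ' e = ρ e := by simp [ρ', heg, Ne.symm hae]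
      have ef : ρ' f = ρ f := by simp [ρ', hfg, Ne.symm haf]
      have eg : ρ' g = 2 * ρ f * z - z ^ 2 * ρ e := by simp [ρ', Ne.symm hag]
      rw [eval_supp hR (ρ' := ρ') (fun i hi => by simp [ρ', hi])]
      have v := hP ρ' y1 1 z (2 * ρ b - y1 * ρ e) (ρ e) (2 * ρ f - z * ρ e) ea
        (by rw [eb]; ring) (by rw [ec]; linear_combination (-2) * hy1) (by rw [ee]; ring) (by rw [ef]; ring)
        (by rw [eg]; ring)
      obtain ⟨A, hA⟩ := hdiv
      have := congrArg (eval ρ') hA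
      simp only [_root_.map_sub, _root_.map_add, _root_.map_mul, _root_.map_pow, v, eval_X, hm, h2C, eval_C, ea, eb, ec, ee, ef, eg] at this
      have z0 : (ρ e * (2 * ρ f * z - z ^ 2 * ρ e) - ρ f ^ 2) * (y1 * (2 * ρ b - y1 * ρ e)) -
        (ρ b ^ 2 * (2 * ρ f * z - z ^ 2 * ρ e) - 2 * ρ b * ρ c * ρ f + ρ c ^ 2 * ρ e) = 0 := by
        have : ρ c = y1 * (ρ f - z * ρ e) + ρ b * z := by linear_combination -hy1
        rw [this]; ring
      rw [z0] at this
      linear_combination -this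
    obtain ⟨p, hp⟩ := Pol.curve (f := evH K I R) ⟨R, rfl⟩
      (fun j => Function.update (fun j => Polynomial.C (ρ j)) g Polynomial.X j)
    have hp' : ∀ t, p.eval t = eval (Function.update ρ g t) R := by
      intro t
      rw [← hp, evH_apply]
      congr 2
      ext j
      by_cases hj : j = g
      · subst hj; simp
      · simp [hj]
    let l : Polynomial K := Polynomial.C (2 * ρ f) * Polynomial.X - Polynomial.X ^ 2 * Polynomial.C (ρ e)
    have hcomp : p.comp l = 0 := by
      apply Polynomial.eq_zero_of_infinite_isRoot
      refine ((Set.infinite_univ (α := K)).sdiff (Set.finite_singleton (ρ f / ρ e))).mono ?_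
      intro z hz
      simp only [Set.mem_ofPred_eq, Polynomial.IsRoot, Polynomial.eval_comp]
      rw [hp']
      have s2 := s1 z (by simpa using hz)
      rw [mul_comm (z ^ 2)] at s2
      simpa [l] using s2
    have hp0 : p = 0 := by
      rcases Polynomial.comp_eq_zero_iff.1 hcomp with h | ⟨_, h⟩
      · exact h
      · exfalso
        have := congrArg (fun q => Polynomial.coeff q 2) h
        simp [l, Polynomial.coeff_X, Polynomial.coeff_C] at this
        exact hw this
    have := hp' (ρ g)
    rw [hp0] at this
    simpa using this.symm
  rw [hR0, sub_zero] at hdiv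
  clear hR0 hR hP
  have hm0 : m ≠ 0 := by
    intro h
    have := congrArg (eval (Function.update (fun _ => (1:K)) f 0)) h
    simp [hm, hef, Ne.symm hfg] at this
  induction n with
  | zero => simpa using hdiv
  | succ n ih =>
    apply ih
    obtain ⟨A, hA⟩ := hdiv
    have hmA : m ∣ A := by
      have := div_quad (K := K) (i0 := e) (i1 := f) (i2 := g) hef (Ne.symm hfg) heg 1 (by simp) h2 (P := A) ?_
      · obtain ⟨B, hB⟩ := this
        refine ⟨-B, ?_⟩
        rw [hB, hm]; simp; ring
      · intro ρ p q hp hq e0 e1 e2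
        apply vanish_line b ρ (p * ρ c / q)
        intro t ht
        have := congrArg (eval (Function.update ρ b t)) hA
        simp only [_root_.map_sub, _root_.map_add, _root_.map_mul, _root_.map_pow, eval_X, hm, h2C, eval_C, Function.update_self,
          Function.update_of_ne hab, Function.update_of_ne (Ne.symm hbc), Function.update_of_ne (Ne.symm hbe),
          Function.update_of_ne (Ne.symm hbf), Function.update_of_ne (Ne.symm hbg), e0, e1, e2] at this
        have hne : q * t - p * ρ c ≠ 0 := by
          intro h; apply ht; field_simp; linear_combination h
        apply mul_left_cancel₀ (pow_ne_zero 2 hne)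
        rw [pow_succ] at this
        linear_combination this
    obtain ⟨A', rfl⟩ := hmA
    refine ⟨A', ?_⟩
    apply mul_left_cancel₀ hm0
    linear_combination hA

/-- function version -/
lemma fun_div {q f : (I → K) → K} (Q : MvPolynomial I K) (hQ : ∀ ρ, eval ρ Q = q ρ)
    (hf : f ∈ Pol K I) (h : ∀ P, (∀ ρ, eval ρ P = f ρ) → Q ∣ P) :
    ∃ h ∈ Pol K I, ∀ ρ, f ρ = q ρ * h ρ := by
  obtain ⟨P, rfl⟩ := hf
  obtain ⟨A, hA⟩ := h P (fun ρ => (evH_apply P ρ).symm)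
  refine ⟨evH K I A, ⟨A, rfl⟩, fun ρ => ?_⟩
  change evH K I P ρ = _
  rw [evH_apply, evH_apply, hA, _root_.map_mul, hQ]
end division
end O3

open Matrix MvPolynomial
namespace O3

section fft2
variable {K : Type} [Field K]

abbrev Idx2 (ι ν : Type) := (ι × Fin 3) ⊕ (ν × Fin 2)

variable {ι ν ι' ν' : Type}

def mV (ρ : Idx2 ι ν → K) (i : ι) : Matrix (Fin 2) (Fin 2) K :=
  !![ρ (.inl (i, 1)), ρ (.inl (i, 0)); ρ (.inl (i, 2)), -ρ (.inl (i, 1))]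

def eV (ρ : Idx2 ι ν → K) (a : ν) : Fin 2 → K := fun c => ρ (.inr (a, c))

def br (U : Matrix (Fin 2) (Fin 2) K) (x y : Fin 2 → K) : K :=
  x 0 * (U 1 0 * y 0 + U 1 1 * y 1) - x 1 * (U 0 0 * y 0 + U 0 1 * y 1)

def WV (K : Type) [Field K] (ι ν : Type) : Subalgebra K ((Idx2 ι ν → K) → Matrix (Fin 2) (Fin 2) K) :=
  Algebra.adjoin K (Set.range fun i ρ => mV ρ i)

def genG2 (K : Type) [Field K] (ι ν : Type) : Set ((Idx2 ι ν → K) → K) :=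
  {f | (∃ U ∈ WV K ι ν, f = fun ρ => (U ρ).trace) ∨
    ∃ U ∈ WV K ι ν, ∃ a b, f = fun ρ => br (U ρ) (eV ρ a) (eV ρ b)}

def G2 (K : Type) [Field K] (ι ν : Type) : Subalgebra K ((Idx2 ι ν → K) → K) :=
  Algebra.adjoin K (genG2 K ι ν)

/-- action of a 2x2 matrix (of determinant one) -/
def act2 (h : Matrix (Fin 2) (Fin 2) K) (ρ : Idx2 ι ν → K) : Idx2 ι ν → K :=
  Sum.elim (fun p => ![(h * mV ρ p.1 * h.adjugate) 0 1, (h * mV ρ p.1 * h.adjugate) 0 0,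
    (h * mV ρ p.1 * h.adjugate) 1 0] p.2) (fun p => (h *ᵥ eV ρ p.1) p.2)

lemma mV_act2 (h : Matrix (Fin 2) (Fin 2) K) (ρ : Idx2 ι ν → K) (i : ι) :
    mV (act2 h ρ) i = h * mV ρ i * h.adjugate := by
  ext a b
  fin_cases a <;> fin_cases b <;>
  simp [mV, act2, Matrix.adjugate_fin_two, Matrix.mul_apply, Fin.sum_univ_two]
  ring

lemma eV_act2 (h : Matrix (Fin 2) (Fin 2) K) (ρ : Idx2 ι ν → K) (a : ν) :
    eV (act2 h ρ) a = h *ᵥ eV ρ a := rfl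

def Inv2 (K : Type) [Field K] (ι ν : Type) : Submodule K ((Idx2 ι ν → K) → K) where
  carrier := {f | ∀ h : Matrix (Fin 2) (Fin 2) K, h.det = 1 → ∀ ρ, f (act2 h ρ) = f ρ}
  zero_mem' := by intro h _ ρ; rfl
  add_mem' := by
    intro f g hf hg h hh ρ
    simp only [Pi.add_apply]
    rw [hf h hh, hg h hh]
  smul_mem' := by
    intro c f hf h hh ρ
    simp only [Pi.smul_apply]
    rw [hf h hh]

lemma env2_ext {ρ ρ' : Idx2 ι ν → K} (h1 : ∀ i, mV ρ i = mV ρ' i) (h2 : ∀ a, eV ρ a = eV ρ' a) :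
    ρ = ρ' := by
  ext x
  rcases x with ⟨i, c⟩ | ⟨a, c⟩
  · have := h1 i
    have e00 := congrFun (congrFun this 0) 0
    have e01 := congrFun (congrFun this 0) 1
    have e10 := congrFun (congrFun this 1) 0
    simp [mV] at e00 e01 e10
    fin_cases c
    · exact e01
    · exact e00
    · exact e10
  · exact congrFun (h2 a) c

lemma WV_gen (i : ι) : (fun ρ => mV ρ i) ∈ WV K ι ν := Algebra.subset_adjoin ⟨i, rfl⟩
lemma G2_tr {U} (hU : U ∈ WV K ι ν) : (fun ρ => (U ρ).trace) ∈ G2 K ι ν :=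
  Algebra.subset_adjoin (Or.inl ⟨U, hU, rfl⟩)
lemma G2_br {U} (hU : U ∈ WV K ι ν) (a b) : (fun ρ => br (U ρ) (eV ρ a) (eV ρ b)) ∈ G2 K ι ν :=
  Algebra.subset_adjoin (Or.inr ⟨U, hU, a, b, rfl⟩)

/-- pullback of matrix-valued functions -/
def pbM {Ω Ω' : Type} {n : Type} [Fintype n] [DecidableEq n] (θ : Ω → Ω') :
    (Ω' → Matrix n n K) →ₐ[K] (Ω → Matrix n n K) where
  toFun f := fun ω => f (θ ω)
  map_one' := rfl
  map_mul' _ _ := rfl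
  map_zero' := rfl
  map_add' _ _ := rfl
  commutes' _ := rfl

lemma WV_pull {θ : (Idx2 ι' ν' → K) → (Idx2 ι ν → K)} (c : ι → K) (r : ι → ι')
    (h : ∀ ρ i, mV (θ ρ) i = c i • mV ρ (r i)) {U} (hU : U ∈ WV K ι ν) :
    (fun ρ => U (θ ρ)) ∈ WV K ι' ν' := by
  have : WV K ι ν ≤ (WV K ι' ν').comap (pbM θ) := by
    apply Algebra.adjoin_le
    rintro _ ⟨i, rfl⟩
    have : (pbM θ fun ρ => mV ρ i) = c i • (fun ρ => mV ρ (r i)) := by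
      ext1 ρ
      exact h ρ i
    change (pbM θ fun ρ => mV ρ i) ∈ WV K ι' ν'
    rw [this]
    exact Subalgebra.smul_mem _ (WV_gen _) _
  exact this hU

lemma br_smul (U : Matrix (Fin 2) (Fin 2) K) (x y : Fin 2 → K) (c d : K) :
    br U (c • x) (d • y) = (c * d) * br U x y := by
  simp [br]; ring

lemma G2_pull {θ : (Idx2 ι' ν' → K) → (Idx2 ι ν → K)} (c : ι → K) (r : ι → ι')
    (h : ∀ ρ i, mV (θ ρ) i = c i • mV ρ (r i)) (c' : ν → K) (r' : ν → ν')
    (h' : ∀ ρ i, eV (θ ρ) i = c' i • eV ρ (r' i)) {f} (hf : f ∈ G2 K ι ν) :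
    pb θ f ∈ G2 K ι' ν' := by
  have : G2 K ι ν ≤ (G2 K ι' ν').comap (pb θ) := by
    apply Algebra.adjoin_le
    rintro _ (⟨U, hU, rfl⟩ | ⟨U, hU, a, b, rfl⟩)
    · exact G2_tr (WV_pull c r h hU)
    · have : (pb θ fun ρ => br (U ρ) (eV ρ a) (eV ρ b)) =
          (c' a * c' b) • fun ρ => br (U (θ ρ)) (eV ρ (r' a)) (eV ρ (r' b)) := by
        ext ρ
        simp only [pb_apply, h', br_smul, Pi.smul_apply, smul_eq_mul]
      change (pb θ fun ρ => br (U ρ) (eV ρ a) (eV ρ b)) ∈ G2 K ι' ν'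
      rw [this]
      exact Subalgebra.smul_mem _ (G2_br (WV_pull c r h hU) _ _) _
  exact this hf

/-- slotwise weights -/
def sw (wi : ι → ℕ) (we : ν → ℕ) : Idx2 ι ν → ℕ := Sum.elim (fun p => wi p.1) (fun p => we p.1)

lemma mV_sw (wi : ι → ℕ) (we : ν → ℕ) (t : K) (ρ : Idx2 ι ν → K) (i : ι) :
    mV (scal (sw wi we) t ρ) i = t ^ wi i • mV ρ i := by
  ext a b
  fin_cases a <;> fin_cases b <;> simp [mV, scal, sw]

lemma eV_sw (wi : ι → ℕ) (we : ν → ℕ) (t : K) (ρ : Idx2 ι ν → K) (a : ν) :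
    eV (scal (sw wi we) t ρ) a = t ^ we a • eV ρ a := by
  ext c
  simp [eV, scal, sw]

lemma G2_scal (wi : ι → ℕ) (we : ν → ℕ) (t : K) {f} (hf : f ∈ G2 K ι ν) :
    pb (scal (sw wi we) t) f ∈ G2 K ι ν :=
  G2_pull _ _ (fun ρ i => mV_sw wi we t ρ i) _ _ (fun ρ i => eV_sw wi we t ρ i) hf

lemma act2_scal (wi : ι → ℕ) (we : ν → ℕ) (t : K) (h) (ρ : Idx2 ι ν → K) :
    act2 h (scal (sw wi we) t ρ) = scal (sw wi we) t (act2 h ρ) := by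
  apply env2_ext
  · intro i; simp [mV_act2, mV_sw]
  · intro a; simp [eV_act2, eV_sw, Matrix.mulVec_smul]

lemma Inv2_scal (wi : ι → ℕ) (we : ν → ℕ) (t : K) {f} (hf : f ∈ Inv2 K ι ν) :
    pb (scal (sw wi we) t) f ∈ Inv2 K ι ν := by
  intro h hh ρ
  simp only [pb_apply]
  rw [← act2_scal, hf h hh]

lemma br_act (h U : Matrix (Fin 2) (Fin 2) K) (hh : h.det = 1) (x y : Fin 2 → K) :
    br (h * U * h.adjugate) (h *ᵥ x) (h *ᵥ y) = br U x y := by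
  rw [Matrix.det_fin_two] at hh
  have : br (h * U * h.adjugate) (h *ᵥ x) (h *ᵥ y) =
      (h 0 0 * h 1 1 - h 0 1 * h 1 0) ^ 2 * br U x y := by
    simp [br, Matrix.adjugate_fin_two, Matrix.mul_apply, Fin.sum_univ_two, Matrix.mulVec, dotProduct]
    ring
  rw [this, hh]; ring

lemma WV_act {U} (hU : U ∈ WV K ι ν) (h : Matrix (Fin 2) (Fin 2) K) (hh : h.det = 1) (ρ) :
    U (act2 h ρ) = h * U ρ * h.adjugate := by
  have e1 : h * h.adjugate = 1 := by rw [Matrix.mul_adjugate, hh, one_smul]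
  have e2 : h.adjugate * h = 1 := by rw [Matrix.adjugate_mul, hh, one_smul]
  induction hU using Algebra.adjoin_induction with
  | mem x hx => obtain ⟨i, rfl⟩ := hx; exact mV_act2 h ρ i
  | algebraMap r =>
    simp only [Pi.algebraMap_apply, Algebra.algebraMap_eq_smul_one]
    simp [e1]
  | add x y _ _ hx hy => simp only [Pi.add_apply, hx, hy]; noncomm_ring
  | mul x y _ _ hx hy =>
    simp only [Pi.mul_apply, hx, hy]
    calc h * x ρ * h.adjugate * (h * y ρ * h.adjugate) = h * x ρ * (h.adjugate * h) * y ρ * h.adjugate := by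
          noncomm_ring
      _ = _ := by rw [e2]; noncomm_ring

lemma G2_inv {f} (hf : f ∈ G2 K ι ν) : f ∈ Inv2 K ι ν := by
  intro h hh
  have e2 : h.adjugate * h = 1 := by rw [Matrix.adjugate_mul, hh, one_smul]
  induction hf using Algebra.adjoin_induction with
  | mem x hx =>
    intro ρ
    rcases hx with ⟨U, hU, rfl⟩ | ⟨U, hU, a, b, rfl⟩
    · simp only [WV_act hU h hh, Matrix.trace_mul_comm, ← Matrix.mul_assoc, e2, Matrix.one_mul]
    · simp only [WV_act hU h hh, eV_act2, br_act _ _ hh]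
  | algebraMap r => intro ρ; rfl
  | add x y _ _ hx hy => intro ρ; simp only [Pi.add_apply, hx, hy]
  | mul x y _ _ hx hy => intro ρ; simp only [Pi.mul_apply, hx, hy]

lemma WV_pol {U} (hU : U ∈ WV K ι ν) (a b) : (fun ρ => U ρ a b) ∈ Pol K (Idx2 ι ν) := by
  induction hU using Algebra.adjoin_induction generalizing a b with
  | mem x hx =>
    obtain ⟨i, rfl⟩ := hx
    fin_cases a <;> fin_cases b
    · exact Pol.coord _
    · exact Pol.coord _
    · exact Pol.coord _
    · exact Pol.neg (Pol.coord _)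
  | algebraMap r => exact Pol.const _
  | add x y _ _ hx hy => exact Pol.add (hx a b) (hy a b)
  | mul x y _ _ hx hy =>
    simp only [Pi.mul_apply, Matrix.mul_apply]
    exact Pol.sum _ fun c => Pol.mul (hx a c) (hy c b)

lemma G2_pol {f} (hf : f ∈ G2 K ι ν) : f ∈ Pol K (Idx2 ι ν) := by
  have : G2 K ι ν ≤ Pol K (Idx2 ι ν) := by
    apply Algebra.adjoin_le
    rintro _ (⟨U, hU, rfl⟩ | ⟨U, hU, a, b, rfl⟩)
    · exact Pol.sum _ fun c => WV_pol hU c c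
    · refine Pol.sub (Pol.mul (Pol.coord _) (Pol.add ?_ ?_)) (Pol.mul (Pol.coord _) (Pol.add ?_ ?_)) <;>
      exact Pol.mul (WV_pol hU _ _) (Pol.coord _)
  exact this hf

lemma act2_pol (h : Matrix (Fin 2) (Fin 2) K) (x : Idx2 ι ν) :
    (fun ρ => act2 h ρ x) ∈ Pol K (Idx2 ι ν) := by
  rcases x with ⟨i, c⟩ | ⟨a, c⟩
  · have key : ∀ x y, (fun ρ : Idx2 ι ν → K => (h * mV ρ i * h.adjugate) x y) ∈ Pol K (Idx2 ι ν) := by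
      intro x y
      simp only [Matrix.mul_apply]
      refine Pol.sum _ fun a => Pol.mul (Pol.sum _ fun b => Pol.mul (Pol.const _) ?_) (Pol.const _)
      exact WV_pol (WV_gen i) _ _
    fin_cases c
    · exact key 0 1
    · exact key 0 0
    · exact key 1 0
  · have e : (fun ρ : Idx2 ι ν → K => act2 h ρ (.inr (a, c))) =
        fun ρ => ∑ b : Fin 2, h c b * ρ (.inr (a, b)) := rfl
    rw [e]
    exact Pol.sum _ fun b => Pol.mul (Pol.const _) (Pol.coord _)

lemma quot_inv2 [Infinite K] {q h f : (Idx2 ι ν → K) → K} (hq : q ∈ Pol K (Idx2 ι ν)) (hh : h ∈ Pol K (Idx2 ι ν))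
    (hq0 : q ≠ 0) (H : ∀ ρ, f ρ = q ρ * h ρ) (hf : f ∈ Inv2 K ι ν) (hqi : q ∈ Inv2 K ι ν) : h ∈ Inv2 K ι ν :=
  fun g hg => quot_inv hq hh hq0 H (act2 g) (act2_pol g) (hf g hg) (hqi g hg)

end fft2
end O3

open Matrix MvPolynomial
namespace O3

section fftE
variable {K : Type} [Field K]
variable {ι ν ι' ν' : Type}

def br0 (a b : ν) (ρ : Idx2 ι ν → K) : K := br 1 (eV ρ a) (eV ρ b)

def GE (K : Type) [Field K] (ι ν : Type) : Subalgebra K ((Idx2 ι ν → K) → K) :=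
  Algebra.adjoin K {f | ∃ a b, f = br0 a b}

lemma GE_br (a b : ν) : br0 a b ∈ GE K ι ν := Algebra.subset_adjoin ⟨a, b, rfl⟩

lemma GE_le : GE K ι ν ≤ G2 K ι ν := by
  apply Algebra.adjoin_le
  rintro _ ⟨a, b, rfl⟩
  exact G2_br (U := 1) (one_mem _) a b

lemma br0_wt (we : ν → ℕ) (a b : ν) : (br0 a b : (Idx2 ι ν → K) → K) ∈ Wt K (sw (fun _ => 0) we) (we a + we b) := by
  intro t _ ρ
  simp only [br0, eV_sw, br_smul, pow_add]

/-- put `e_none := e_{n0}` -/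
def collapse (n0 : ν) (ρ : Idx2 ι ν → K) : Idx2 ι (Option ν) → K :=
  Sum.elim (fun p => ρ (.inl p)) (fun p => ρ (.inr (p.1.getD n0, p.2)))

lemma collapse_pol (n0 : ν) (x) : (fun ρ : Idx2 ι ν → K => collapse n0 ρ x) ∈ Pol K (Idx2 ι ν) := by
  rcases x with x | x
  · exact Pol.coord _
  · exact Pol.coord _

lemma collapse_act (n0 : ν) (h) (ρ : Idx2 ι ν → K) :
    act2 h (collapse n0 ρ) = collapse n0 (act2 h ρ) := rfl

lemma br0_collapse (n0 : ν) (a b : Option ν) :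
    pb (collapse n0) (br0 a b : (Idx2 ι (Option ν) → K) → K) = br0 (a.getD n0) (b.getD n0) := rfl

open Classical in
/-- weight of slot n0 -/
noncomputable def wn (n0 : ν) : Idx2 ι ν → ℕ := sw (fun _ => 0) (fun a => if a = n0 then 1 else 0)

open Classical in
lemma br0_wn (n0 a b : ν) : (br0 a b : (Idx2 ι ν → K) → K) ∈
    Wt K (wn n0) ((if a = n0 then 1 else 0) + (if b = n0 then 1 else 0)) := br0_wt _ a b

def PE (n0 : ν) (c : ℕ) (x : (Idx2 ι ν → K) → K) : Prop :=
  x ∈ Wt K (wn n0) c ∧ ∀ j ≤ c, ∃ g ∈ GE K ι (Option ν), g ∈ Wt K (wn none) j ∧ pb (collapse n0) g = x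

lemma PE_mul {n0 : ν} {c c' : ℕ} {x x' : (Idx2 ι ν → K) → K} (h : PE n0 c x) (h' : PE n0 c' x') :
    PE n0 (c + c') (x * x') := by
  refine ⟨Wt.mul h.1 h'.1, fun j hj => ?_⟩
  obtain ⟨g, h1, h2, h3⟩ := h.2 (min j c) (min_le_right _ _)
  obtain ⟨g', h1', h2', h3'⟩ := h'.2 (j - min j c) (by omega)
  refine ⟨g * g', mul_mem h1 h1', ?_, by rw [_root_.map_mul, h3, h3']⟩
  have := Wt.mul h2 h2'
  rwa [show min j c + (j - min j c) = j by omega] at this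

lemma PE_br (n0 a b : ν) : ∃ c, PE n0 c (br0 a b : (Idx2 ι ν → K) → K) := by
  by_cases ha : a = n0
  · by_cases hb : b = n0
    · rw [ha, hb]
      have : (br0 n0 n0 : (Idx2 ι ν → K) → K) = 0 := by ext ρ; simp [br0, br]; try ring
      rw [this]
      exact ⟨0, zero_mem _, fun j _ => ⟨0, zero_mem _, zero_mem _, by simp⟩⟩
    · refine ⟨1, ?_, fun j hj => ?_⟩
      · simpa [ha, hb] using br0_wn (K := K) (ι := ι) n0 a b
      · interval_cases j
        · exact ⟨br0 (some a) (some b), GE_br _ _, by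
            simpa using br0_wn (K := K) (ι := ι) none (some a) (some b), rfl⟩
        · exact ⟨br0 none (some b), GE_br _ _, by
            simpa using br0_wn (K := K) (ι := ι) none none (some b),
            by rw [br0_collapse, ha]; rfl⟩
  · by_cases hb : b = n0
    · refine ⟨1, ?_, fun j hj => ?_⟩
      · simpa [ha, hb] using br0_wn (K := K) (ι := ι) n0 a b
      · interval_cases j
        · exact ⟨br0 (some a) (some b), GE_br _ _, by
            simpa using br0_wn (K := K) (ι := ι) none (some a) (some b), rfl⟩
        · exact ⟨br0 (some a) none, GE_br _ _, by
            simpa using br0_wn (K := K) (ι := ι) none (some a) none,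
            by rw [br0_collapse, hb]; rfl⟩
    · refine ⟨0, ?_, fun j hj => ?_⟩
      · simpa [ha, hb] using br0_wn (K := K) (ι := ι) n0 a b
      · obtain rfl : j = 0 := by omega
        exact ⟨br0 (some a) (some b), GE_br _ _, by
            simpa using br0_wn (K := K) (ι := ι) none (some a) (some b), rfl⟩

lemma PE_lift [Infinite K] (n0 : ν) {f : (Idx2 ι ν → K) → K} (hf : f ∈ GE K ι ν) {c : ℕ} (hc : f ∈ Wt K (wn n0) c)
    {j : ℕ} (hj : j ≤ c) : ∃ g ∈ GE K ι (Option ν), g ∈ Wt K (wn none) j ∧ pb (collapse n0) g = f := by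
  let X := {p : ((Idx2 ι ν → K) → K) × ℕ // PE n0 p.2 p.1}
  have h1 : f ∈ Submodule.span K ((fun x : X => x.1.1) '' Set.univ) := by
    have : f ∈ (GE K ι ν).toSubmodule := hf
    rw [GE, Algebra.adjoin_eq_span] at this
    refine Submodule.span_mono ?_ this
    intro x hx
    suffices ∃ c, PE n0 c x by
      obtain ⟨c, hc⟩ := this
      exact ⟨⟨(x, c), hc⟩, trivial, rfl⟩
    induction hx using Submonoid.closure_induction with
    | mem x hx => obtain ⟨a, b, rfl⟩ := hx; exact PE_br n0 a b
    | one =>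
      refine ⟨0, by intro t _ ρ; simp, fun j hj => ⟨1, one_mem _, ?_, rfl⟩⟩
      obtain rfl : j = 0 := by omega
      intro t _ ρ; simp
    | mul x y _ _ hx hy =>
      obtain ⟨c, hc⟩ := hx
      obtain ⟨c', hc'⟩ := hy
      exact ⟨_, PE_mul hc hc'⟩
  have h2 := span_wt (wn n0) (fun x : X => x.1.1) (fun x => x.1.2) (fun x => x.2.1) Set.univ h1 hc
  clear hc h1 hf
  induction h2 using Submodule.span_induction with
  | mem x hx =>
    obtain ⟨y, ⟨_, hy⟩, rfl⟩ := hx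
    exact y.2.2 j (by rw [hy]; exact hj)
  | zero => exact ⟨0, zero_mem _, zero_mem _, by simp⟩
  | add x y _ _ hx hy =>
    obtain ⟨g, a1, a2, a3⟩ := hx
    obtain ⟨g', b1, b2, b3⟩ := hy
    exact ⟨g + g', add_mem a1 b1, add_mem a2 b2, by rw [_root_.map_add, a3, b3]⟩
  | smul r x _ hx =>
    obtain ⟨g, a1, a2, a3⟩ := hx
    exact ⟨r • g, Subalgebra.smul_mem _ a1 r, Submodule.smul_mem _ r a2, by rw [_root_.map_smul, a3]⟩

/-- bundled good functions -/
noncomputable def Good2 (K : Type) [Field K] (ι ν : Type) : Submodule K ((Idx2 ι ν → K) → K) :=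
  (Pol K (Idx2 ι ν)).toSubmodule ⊓ Inv2 K ι ν

lemma Good2_scal (wi : ι → ℕ) (we : ν → ℕ) (t : K) {f} (hf : f ∈ Good2 K ι ν) :
    pb (scal (sw wi we) t) f ∈ Good2 K ι ν :=
  ⟨Pol.comp (Pol.scal _ t) hf.1, Inv2_scal _ _ _ hf.2⟩

lemma G2_good {f} (hf : f ∈ G2 K ι ν) : f ∈ Good2 K ι ν := ⟨G2_pol hf, G2_inv hf⟩

lemma scal_comm {I : Type} (w w' : I → ℕ) (t t' : K) (ρ : I → K) :
    scal w t (scal w' t' ρ) = scal w' t' (scal w t ρ) := by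
  ext i; simp [scal]; ring

lemma Wt_scal {I : Type} (w w' : I → ℕ) (t : K) (n : ℕ) {f} (hf : f ∈ Wt K w n) :
    pb (scal w' t) f ∈ Wt K w n := by
  intro u hu ρ
  simp only [pb_apply]
  rw [scal_comm, hf u hu]

lemma fftE_step [Infinite K] (n0 : ν) (ih : ∀ f ∈ Good2 K ι ν, f ∈ GE K ι ν) :
    ∀ f ∈ Good2 K ι (Option ν), f ∈ GE K ι (Option ν) := by
  have main : ∀ j, ∀ f ∈ Good2 K ι (Option ν), f ∈ Wt K (wn none) j → f ∈ GE K ι (Option ν) := by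
    intro j
    induction j using Nat.strong_induction_on with | _ j ihj
    intro f hf hfj
    apply mem_of_comps (wn (some n0)) (GE K ι (Option ν)).toSubmodule
      (Good2 K ι (Option ν) ⊓ Wt K (wn none) j) (fun _ h => h.1.1) ?_ ⟨hf, hfj⟩
    swap
    · intro t _ h hh
      exact ⟨Good2_scal _ _ t hh.1, Wt_scal _ _ t _ hh.2⟩
    clear hf hfj f
    rintro k f ⟨hf, hfj⟩ hfk
    have hbar : pb (collapse n0) f ∈ Good2 K ι ν :=
      ⟨Pol.comp (collapse_pol n0) hf.1, fun h hh ρ => by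
        simp only [pb_apply]; rw [← collapse_act]; exact hf.2 h hh _⟩
    have hw : pb (collapse n0) f ∈ Wt K (wn n0) (j + k) := by
      intro t ht ρ
      simp only [pb_apply]
      have : collapse n0 (scal (wn n0) t ρ) = scal (wn none) t (scal (wn (some n0)) t (collapse n0 ρ)) := by
        ext x
        rcases x with x | ⟨x, c⟩
        · simp [collapse, scal, wn, sw]
        · rcases x with _ | x
          · simp [collapse, scal, wn, sw]
          · by_cases hx : x = n0 <;> simp [collapse, scal, wn, sw, hx]
      rw [this, hfj t ht, hfk t ht, pow_add, mul_assoc]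
    obtain ⟨g, g1, g2, g3⟩ := PE_lift n0 (ih _ hbar) hw (Nat.le_add_right _ k)
    have hfg : f - g ∈ Good2 K ι (Option ν) := sub_mem hf (G2_good (GE_le g1))
    have hfgw := sub_mem hfj g2
    obtain ⟨h, h1, h2⟩ := fun_div (q := br0 (some n0) none) (X (.inr (some n0, 0)) * X (.inr (none, 1)) -
      X (.inr (some n0, 1)) * X (.inr (none, 0))) (by intro ρ; simp [br0, br, eV]) hfg.1 (by
        intro P hP
        apply div_bracket (by simp) (by simp) (by simp) (by simp) (by simp)
        intro ρ t ht e1 e2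
        let ρ0 : Idx2 ι ν → K := Sum.elim (fun p => ρ (.inl p)) (fun p => ρ (.inr (some p.1, p.2)))
        have : ρ = scal (wn none) t (collapse n0 ρ0) := by
          ext x
          rcases x with x | ⟨x, c⟩
          · simp [collapse, scal, wn, sw, ρ0]
          · rcases x with _ | x
            · fin_cases c
              · simp [collapse, scal, wn, sw, ρ0, e1]
              · simp [collapse, scal, wn, sw, ρ0, e2]
            · simp [collapse, scal, wn, sw, ρ0]
        rw [hP, this, hfgw t ht]
        have := congrFun g3 ρ0
        simp only [pb_apply] at this
        simp [this])
    have hbg : br0 (some n0) none ∈ Good2 K ι (Option ν) := G2_good (GE_le (GE_br _ _))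
    have hq0 : (br0 (some n0) none : (Idx2 ι (Option ν) → K) → K) ≠ 0 := by
      intro h
      have := congrFun h (Sum.elim 0 (fun p => p.1.elim (if p.2 = 1 then 1 else 0) (fun _ => if p.2 = 0 then 1 else 0)))
      simp [br0, br, eV] at this
    have hbw : (br0 (some n0) none : (Idx2 ι (Option ν) → K) → K) ∈ Wt K (wn none) 1 := by
      simpa using br0_wn (K := K) (ι := ι) none (some n0) none
    have hinv := quot_inv2 hbg.1 h1 hq0 h2 hfg.2 hbg.2
    have hfin := quot_wt hbg.1 h1 hq0 h2 hfgw hbw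
    have key : f - g ∈ GE K ι (Option ν) → f ∈ (GE K ι (Option ν)).toSubmodule := by
      intro h
      have := add_mem h g1
      simpa using this
    apply key
    rcases hfin with h0 | ⟨hle, hw'⟩
    · rw [h0]; exact zero_mem _
    · have e : f - g = br0 (some n0) none * h := by ext ρ; exact h2 ρ
      rw [e]
      exact mul_mem (GE_br _ _) (ihj (j - 1) (by omega) h ⟨h1, hinv⟩ hw')
  intro f hf
  exact mem_of_comps (wn none) (GE K ι (Option ν)).toSubmodule (Good2 K ι (Option ν)) (fun _ h => h.1)
    (fun t _ h hh => Good2_scal _ _ t hh) hf (fun n g hg hgn => main n g hg hgn)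

lemma fftE_one [Infinite K] [IsEmpty ι] [IsEmpty ν] : ∀ f ∈ Good2 K ι (Option ν), f ∈ GE K ι (Option ν) := by
  intro f hf
  let ρ1 : Idx2 ι (Option ν) → K := Sum.elim 0 (fun p => if p.2 = 0 then 1 else 0)
  have : f - (fun _ => f ρ1) = 0 := by
    apply Pol.cancel (q := fun ρ => ρ (.inr (none, 0))) (Pol.coord _) (sub_mem hf.1 (Pol.const _))
    · intro h
      have := congrFun h (fun _ => 1)
      simp at this
    · intro ρ
      by_cases h0 : ρ (.inr (none, 0)) = 0
      · simp [h0]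
      · have h3 := hf.2 !![ρ (.inr (none, 0)), 0; ρ (.inr (none, 1)), (ρ (.inr (none, 0)))⁻¹]
          (by simp [Matrix.det_fin_two, h0]) ρ1
        have : act2 !![ρ (.inr (none, 0)), 0; ρ (.inr (none, 1)), (ρ (.inr (none, 0)))⁻¹] ρ1 = ρ := by
          ext x
          rcases x with ⟨x, _⟩ | ⟨x, c⟩
          · exact isEmptyElim x
          · rcases x with _ | x
            · fin_cases c <;> simp [act2, eV, ρ1, Matrix.mulVec, dotProduct, Fin.sum_univ_two]
            · exact isEmptyElim x
        rw [this] at h3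
        simp [h3]
  rw [sub_eq_zero] at this
  rw [this]
  exact Subalgebra.algebraMap_mem _ (f ρ1)

lemma fftE [Infinite K] [IsEmpty ι] (ν : Type) [Finite ν] : ∀ f ∈ Good2 K ι ν, f ∈ GE K ι ν := by
  apply Finite.induction_empty_option (P := fun ν : Type => ∀ f ∈ Good2 K ι ν, f ∈ GE K ι ν)
  · intro α β e ih f hf
    let θ : (Idx2 ι α → K) → (Idx2 ι β → K) := fun ρ => Sum.elim (fun p => ρ (.inl p)) (fun p => ρ (.inr (e.symm p.1, p.2)))
    let θ' : (Idx2 ι β → K) → (Idx2 ι α → K) := fun ρ => Sum.elim (fun p => ρ (.inl p)) (fun p => ρ (.inr (e p.1, p.2)))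
    have h1 : pb θ f ∈ Good2 K ι α := by
      refine ⟨Pol.comp ?_ hf.1, fun h hh ρ => hf.2 h hh (θ ρ)⟩
      rintro (x | x) <;> exact Pol.coord _
    have h2 := ih _ h1
    have h3 : f = pb θ' (pb θ f) := by
      ext ρ
      simp only [pb_apply]
      congr 1
      ext x
      rcases x with x | x <;> simp [θ, θ']
    rw [h3]
    have : GE K ι α ≤ (GE K ι β).comap (pb θ') := by
      apply Algebra.adjoin_le
      rintro _ ⟨a, b, rfl⟩
      exact GE_br (e a) (e b)
    exact this h2
  · intro f hf
    have : f = fun _ => f 0 := by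
      ext ρ; congr 1; ext x
      rcases x with ⟨x, _⟩ | ⟨x, _⟩
      · exact isEmptyElim x
      · exact x.elim
    rw [this]
    exact Subalgebra.algebraMap_mem _ (f 0)
  · intro α _ ih
    rcases isEmpty_or_nonempty α with h | ⟨⟨n0⟩⟩
    · exact fftE_one
    · exact fftE_step n0 ih
end fftE
end O3

open Matrix MvPolynomial
namespace O3

section fftV
variable {K : Type} [Field K]
variable {ι ν ι' ν' : Type}

def thV (ρ : Idx2 ι (Option ν) → K) : Idx2 (Option ι) ν → K :=
  Sum.elim (fun p => p.1.elim (![(ρ (.inr (none, 0))) ^ 2, -(ρ (.inr (none, 0)) * ρ (.inr (none, 1))),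
      -(ρ (.inr (none, 1))) ^ 2] p.2) (fun i => ρ (.inl (i, p.2)))) (fun p => ρ (.inr (some p.1, p.2)))

lemma mV_thV_some (ρ : Idx2 ι (Option ν) → K) (i : ι) : mV (thV ρ) (some i) = mV ρ i := rfl
lemma eV_thV (ρ : Idx2 ι (Option ν) → K) (i : ν) : eV (thV ρ) i = eV ρ (some i) := rfl

def mE (x : Fin 2 → K) : Matrix (Fin 2) (Fin 2) K := !![-(x 0 * x 1), x 0 ^ 2; -(x 1) ^ 2, -(-(x 0 * x 1))]

lemma mV_thV_none (ρ : Idx2 ι (Option ν) → K) : mV (thV ρ) none = mE (eV ρ none) := rfl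

lemma mE_act (h : Matrix (Fin 2) (Fin 2) K) (x : Fin 2 → K) :
    mE (h *ᵥ x) = h * mE x * h.adjugate := by
  ext a b
  fin_cases a <;> fin_cases b <;>
  simp [mE, Matrix.adjugate_fin_two, Matrix.mul_apply, Fin.sum_univ_two, Matrix.mulVec, dotProduct] <;> ring

lemma thV_act (h : Matrix (Fin 2) (Fin 2) K) (ρ : Idx2 ι (Option ν) → K) :
    thV (act2 h ρ) = act2 h (thV ρ) := by
  apply env2_ext
  · rintro (_ | i)
    · rw [mV_thV_none, mV_act2, mV_thV_none, eV_act2, mE_act]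
    · rw [mV_thV_some, mV_act2, mV_act2, mV_thV_some]
  · intro a; rfl

lemma thV_pol (x) : (fun ρ : Idx2 ι (Option ν) → K => thV ρ x) ∈ Pol K (Idx2 ι (Option ν)) := by
  rcases x with ⟨_ | i, c⟩ | x
  · fin_cases c
    · exact Pol.pow (Pol.coord _) 2
    · exact Pol.neg (Pol.mul (Pol.coord _) (Pol.coord _))
    · exact Pol.neg (Pol.pow (Pol.coord _) 2)
  · exact Pol.coord _
  · exact Pol.coord _

/-- weights -/
def w2 : Idx2 (Option ι) ν → ℕ := sw (fun i => i.elim 2 (fun _ => 0)) (fun _ => 0)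
def w1 : Idx2 ι (Option ν) → ℕ := sw (fun _ => 0) (fun i => i.elim 1 (fun _ => 0))

lemma thV_scal (t : K) (ρ : Idx2 ι (Option ν) → K) : thV (scal w1 t ρ) = scal w2 t (thV ρ) := by
  apply env2_ext
  · rintro (_ | i)
    · rw [mV_thV_none, w1, eV_sw, w2, mV_sw, mV_thV_none]
      ext a b
      fin_cases a <;> fin_cases b <;> simp [mE] <;> ring
    · rw [mV_thV_some, w1, mV_sw, w2, mV_sw, mV_thV_some]; rfl
  · intro a
    rw [eV_thV, w1, eV_sw, w2, eV_sw, eV_thV]; rfl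

lemma WV_adj {U} (hU : U ∈ WV K ι ν) : (fun ρ => (U ρ).adjugate) ∈ WV K ι ν := by
  induction hU using Algebra.adjoin_induction with
  | mem x hx =>
    obtain ⟨i, rfl⟩ := hx
    have : (fun ρ : Idx2 ι ν → K => (mV ρ i).adjugate) = (-1 : K) • fun ρ => mV ρ i := by
      ext ρ a b
      fin_cases a <;> fin_cases b <;> simp [mV, Matrix.adjugate_fin_two]
    simp only
    rw [this]
    exact Subalgebra.smul_mem _ (WV_gen i) _
  | algebraMap r =>
    have : (fun ρ : Idx2 ι ν → K => ((algebraMap K ((Idx2 ι ν → K) → Matrix (Fin 2) (Fin 2) K) r) ρ).adjugate) =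
      algebraMap K ((Idx2 ι ν → K) → Matrix (Fin 2) (Fin 2) K) r := by
      ext ρ a b
      fin_cases a <;> fin_cases b <;> simp [Matrix.adjugate_fin_two, Algebra.algebraMap_eq_smul_one]
    rw [this]
    exact Subalgebra.algebraMap_mem _ r
  | add x y _ _ hx hy =>
    have : (fun ρ => ((x + y) ρ).adjugate) = (fun ρ => (x ρ).adjugate) + fun ρ => (y ρ).adjugate := by
      ext ρ a b
      fin_cases a <;> fin_cases b <;> simp [Matrix.adjugate_fin_two]
      ring
      ring
    rw [this]
    exact add_mem hx hy
  | mul x y _ _ hx hy =>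
    have : (fun ρ => ((x * y) ρ).adjugate) = (fun ρ => (y ρ).adjugate) * fun ρ => (x ρ).adjugate := by
      ext1 ρ
      simp only [Pi.mul_apply]
      exact Matrix.adjugate_mul_distrib _ _
    rw [this]
    exact mul_mem hy hx

lemma br_swap (U : Matrix (Fin 2) (Fin 2) K) (x y : Fin 2 → K) : br U x y = - br U.adjugate y x := by
  simp [br, Matrix.adjugate_fin_two]; ring

lemma br_self (U : Matrix (Fin 2) (Fin 2) K) (x : Fin 2 → K) : br U x x = (U * mE x).trace := by
  simp [br, mE, Matrix.trace_fin_two, Matrix.mul_apply, Fin.sum_univ_two]; ring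

lemma br_br (U U' : Matrix (Fin 2) (Fin 2) K) (x y z : Fin 2 → K) :
    br U x y * br U' x z = - br (U.adjugate * mE x * U') y z := by
  simp [br, mE, Matrix.adjugate_fin_two, Matrix.mul_apply, Fin.sum_univ_two]; ring

lemma WV_lift {U} (hU : U ∈ WV K ι (Option ν)) : ∃ U' ∈ WV K (Option ι) ν, U = fun ρ => U' (thV ρ) := by
  induction hU using Algebra.adjoin_induction with
  | mem x hx =>
    obtain ⟨i, rfl⟩ := hx
    exact ⟨_, WV_gen (some i), rfl⟩
  | algebraMap r => exact ⟨_, Subalgebra.algebraMap_mem _ r, rfl⟩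
  | add x y _ _ hx hy =>
    obtain ⟨U, h, rfl⟩ := hx
    obtain ⟨V, h', rfl⟩ := hy
    exact ⟨_, add_mem h h', rfl⟩
  | mul x y _ _ hx hy =>
    obtain ⟨U, h, rfl⟩ := hx
    obtain ⟨V, h', rfl⟩ := hy
    exact ⟨_, mul_mem h h', rfl⟩

def L0 (K : Type) [Field K] (ι ν : Type) : Subalgebra K ((Idx2 ι (Option ν) → K) → K) := (G2 K (Option ι) ν).map (pb thV)

def brN (U : (Idx2 (Option ι) ν → K) → Matrix (Fin 2) (Fin 2) K) (b : ν) (ρ : Idx2 ι (Option ν) → K) : K :=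
  br (U (thV ρ)) (eV ρ none) (eV ρ (some b))

def L1 (K : Type) [Field K] (ι ν : Type) : Submodule K ((Idx2 ι (Option ν) → K) → K) :=
  Submodule.span K {f | ∃ g ∈ L0 K ι ν, ∃ U ∈ WV K (Option ι) ν, ∃ b, f = g * brN U b}

lemma L0_L1 {g f} (hg : g ∈ L0 K ι ν) (hf : f ∈ L1 K ι ν) : g * f ∈ L1 K ι ν := by
  induction hf using Submodule.span_induction with
  | mem x hx =>
    obtain ⟨g', hg', U, hU, b, rfl⟩ := hx
    rw [← mul_assoc]
    exact Submodule.subset_span ⟨_, mul_mem hg hg', U, hU, b, rfl⟩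
  | zero => rw [mul_zero]; exact zero_mem _
  | add x y _ _ hx hy => rw [mul_add]; exact add_mem hx hy
  | smul r x _ hx => rw [mul_smul_comm]; exact Submodule.smul_mem _ _ hx

lemma brN_mul {U U'} (hU : U ∈ WV K (Option ι) ν) (hU' : U' ∈ WV K (Option ι) ν) (b b' : ν) :
    brN U b * brN U' b' ∈ L0 K ι ν := by
  have : brN U b * brN U' b' = pb thV (-(fun ρ => br ((U ρ).adjugate * mV ρ none * U' ρ) (eV ρ b) (eV ρ b'))) := by
    ext ρ
    simp only [Pi.mul_apply, brN, br_br, pb_apply, Pi.neg_apply, mV_thV_none, eV_thV]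
  rw [this]
  have h := G2_br (mul_mem (mul_mem (WV_adj hU) (WV_gen none)) hU') b b'
  exact ⟨_, neg_mem (S := Subalgebra K _) h, rfl⟩

lemma L1_L1 {g f} (hg : g ∈ L1 K ι ν) (hf : f ∈ L1 K ι ν) : g * f ∈ L0 K ι ν := by
  change g * f ∈ (L0 K ι ν).toSubmodule
  induction hf using Submodule.span_induction with
  | mem x hx =>
    obtain ⟨g', hg', U, hU, b, rfl⟩ := hx
    induction hg using Submodule.span_induction with
    | mem x hx =>
      obtain ⟨g2, hg2, U2, hU2, b2, rfl⟩ := hx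
      rw [mul_mul_mul_comm]
      exact (L0 K ι ν).mul_mem ((L0 K ι ν).mul_mem hg2 hg') (brN_mul hU2 hU _ _)
    | zero => rw [zero_mul]; exact zero_mem _
    | add x y _ _ hx hy => rw [add_mul]; exact add_mem hx hy
    | smul r x _ hx => rw [smul_mul_assoc]; exact Submodule.smul_mem _ _ hx
  | zero => rw [mul_zero]; exact zero_mem _
  | add x y _ _ hx hy => rw [mul_add]; exact add_mem hx hy
  | smul r x _ hx => rw [mul_smul_comm]; exact Submodule.smul_mem _ _ hx

lemma L1_br {U} (hU : U ∈ WV K (Option ι) ν) (b : ν) : brN U b ∈ L1 K ι ν :=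
  Submodule.subset_span ⟨1, one_mem _, U, hU, b, (one_mul _).symm⟩

lemma G2_split {f} (hf : f ∈ G2 K ι (Option ν)) : ∃ g ∈ L0 K ι ν, ∃ r ∈ L1 K ι ν, f = g + r := by
  induction hf using Algebra.adjoin_induction with
  | mem x hx =>
    rcases hx with ⟨U, hU0, rfl⟩ | ⟨U, hU0, a, b, rfl⟩
    · obtain ⟨U, hU, rfl⟩ := WV_lift hU0
      exact ⟨_, ⟨_, G2_tr hU, rfl⟩, 0, zero_mem _, (add_zero _).symm⟩
    · obtain ⟨U, hU, rfl⟩ := WV_lift hU0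
      rcases a with _ | a
      · rcases b with _ | b
        · refine ⟨_, ⟨_, G2_tr (mul_mem hU (WV_gen none)), rfl⟩, 0, zero_mem _, ?_⟩
          ext ρ
          simp [br_self, mV_thV_none]
        · exact ⟨0, zero_mem _, _, L1_br hU b, (zero_add _).symm⟩
      · rcases b with _ | b
        · refine ⟨0, zero_mem _, _, neg_mem (L1_br (WV_adj hU) a), ?_⟩
          ext ρ
          simp only [brN, Pi.add_apply, Pi.zero_apply, zero_add, Pi.neg_apply]
          rw [br_swap]
        · exact ⟨_, ⟨_, G2_br hU a b, rfl⟩, 0, zero_mem _, (add_zero _).symm⟩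
  | algebraMap r => exact ⟨_, Subalgebra.algebraMap_mem _ r, 0, zero_mem _, (add_zero _).symm⟩
  | add x y _ _ hx hy =>
    obtain ⟨g, hg, r, hr, rfl⟩ := hx
    obtain ⟨g', hg', r', hr', rfl⟩ := hy
    exact ⟨_, add_mem hg hg', _, add_mem hr hr', by ring⟩
  | mul x y _ _ hx hy =>
    obtain ⟨g, hg, r, hr, rfl⟩ := hx
    obtain ⟨g', hg', r', hr', rfl⟩ := hy
    exact ⟨_, add_mem (mul_mem hg hg') (L1_L1 hr hr'), _, add_mem (L0_L1 hg hr') (L0_L1 hg' hr), by ring⟩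

lemma thV_neg (ρ : Idx2 ι (Option ν) → K) : thV (scal w1 (-1) ρ) = thV ρ := by
  rw [thV_scal]
  ext x
  rcases x with ⟨_ | i, c⟩ | x <;> simp [scal, w2, sw]

lemma L1_odd {r} (hr : r ∈ L1 K ι ν) (ρ) : r (scal w1 (-1) ρ) = - r ρ := by
  induction hr using Submodule.span_induction with
  | mem x hx =>
    obtain ⟨_, ⟨g, hg, rfl⟩, U, hU, b, rfl⟩ := hx
    have e1 : eV (scal w1 (-1) ρ) none = (-1 : K) • eV ρ none := by rw [w1, eV_sw]; simp
    have e2 : eV (scal w1 (-1) ρ) (some b) = (1 : K) • eV ρ (some b) := by rw [w1, eV_sw]; simp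
    simp only [Pi.mul_apply, brN, thV_neg, e1, e2, br_smul, RingHom.coe_coe, pb_apply]
    ring
  | zero => simp
  | add x y _ _ hx hy => simp only [Pi.add_apply, hx, hy]; ring
  | smul c x _ hx => simp only [Pi.smul_apply, hx, smul_neg]

lemma even_lift (h2 : (2:K) ≠ 0) {f : (Idx2 (Option ι) ν → K) → K} (hf : pb thV f ∈ G2 K ι (Option ν)) :
    ∃ g ∈ G2 K (Option ι) ν, pb thV g = pb thV f := by
  obtain ⟨_, ⟨g, hg, rfl⟩, r, hr, e⟩ := G2_split hf
  refine ⟨g, hg, ?_⟩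
  ext ρ
  have e1 := congrFun e ρ
  have e2 := congrFun e (scal w1 (-1) ρ)
  simp only [pb_apply, Pi.add_apply, RingHom.coe_coe, thV_neg, L1_odd hr] at e1 e2
  have : 2 * r ρ = 0 := by linear_combination e2 - e1
  have := (mul_eq_zero.1 this).resolve_left h2
  simp only [pb_apply, e1, this, add_zero]

def qV (ρ : Idx2 (Option ι) ν → K) : K := ρ (.inl (none, 1)) ^ 2 + ρ (.inl (none, 0)) * ρ (.inl (none, 2))

lemma qV_mem (h2 : (2:K) ≠ 0) : (qV : (Idx2 (Option ι) ν → K) → K) ∈ G2 K (Option ι) ν := by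
  have : (qV : (Idx2 (Option ι) ν → K) → K) = (2:K)⁻¹ • fun ρ => (((fun ρ => mV ρ none) * fun ρ => mV ρ none :
      (Idx2 (Option ι) ν → K) → Matrix (Fin 2) (Fin 2) K) ρ).trace := by
    ext ρ
    simp [qV, mV, Matrix.trace_fin_two, Matrix.mul_apply, Fin.sum_univ_two]
    field_simp
    ring
  rw [this]
  exact Subalgebra.smul_mem _ (G2_tr (mul_mem (WV_gen none) (WV_gen none))) _

lemma fftV_step [Infinite K] (h2 : (2:K) ≠ 0) (ih : ∀ f ∈ Good2 K ι (Option ν), f ∈ G2 K ι (Option ν)) :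
    ∀ f ∈ Good2 K (Option ι) ν, f ∈ G2 K (Option ι) ν := by
  have main : ∀ j, ∀ f ∈ Good2 K (Option ι) ν, f ∈ Wt K w2 j → f ∈ G2 K (Option ι) ν := by
    intro j
    induction j using Nat.strong_induction_on with | _ j ihj
    intro f hf hfj
    have hbar : pb thV f ∈ Good2 K ι (Option ν) :=
      ⟨Pol.comp thV_pol hf.1, fun h hh ρ => by
        simp only [pb_apply]; rw [thV_act]; exact hf.2 h hh _⟩
    obtain ⟨g0, hg0, e0⟩ := even_lift h2 (ih _ hbar)
    have hw : pb thV g0 ∈ Wt K w1 j := by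
      rw [e0]
      intro t ht ρ
      simp only [pb_apply]
      rw [thV_scal, hfj t ht]
    obtain ⟨g, g2, g3, g4⟩ := right_comp w2 (G2_pol hg0) w1 thV (fun t _ ρ => thV_scal t ρ) j hw
    have g1 : g ∈ G2 K (Option ι) ν := g4 (G2 K (Option ι) ν).toSubmodule (fun t _ h hh => G2_scal _ _ t hh) hg0
    have hfg : f - g ∈ Good2 K (Option ι) ν := sub_mem hf (G2_good g1)
    have hfgw := sub_mem hfj g2
    obtain ⟨h, h1, h3⟩ := fun_div (q := qV) (X (.inl (none, 1)) ^ 2 - C (-1) * X (.inl (none, 0)) *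
      X (.inl (none, 2))) (by intro ρ; simp [qV]) hfg.1 (by
        intro P hP
        apply div_quad (by simp) (by simp) (by simp) (-1) (by norm_num) h2
        intro ρ p q hp hq e1 e2 e3
        let ρ0 : Idx2 ι (Option ν) → K := Sum.elim (fun x => ρ (.inl (some x.1, x.2)))
          (fun x => x.1.elim (![p, -q] x.2) (fun a => ρ (.inr (a, x.2))))
        have : ρ = thV ρ0 := by
          ext x
          rcases x with ⟨_ | i, c⟩ | x
          · fin_cases c
            · simp [thV, ρ0, e1]
            · simp [thV, ρ0, e2]
            · simp [thV, ρ0, e3]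
          · rfl
          · rfl
        rw [hP, this]
        have := congrFun (g3.trans e0) ρ0
        simp only [pb_apply] at this
        simp [this])
    have hbg := G2_good (qV_mem (ι := ι) (ν := ν) h2)
    have hq0 : (qV : (Idx2 (Option ι) ν → K) → K) ≠ 0 := by
      intro h
      have := congrFun h (Sum.elim (fun p => if p.2 = 1 then 1 else 0) 0)
      simp [qV] at this
    have hbw : (qV : (Idx2 (Option ι) ν → K) → K) ∈ Wt K w2 4 := by
      intro t _ ρ
      simp [qV, scal, w2, sw]; ring
    have hinv := quot_inv2 hbg.1 h1 hq0 h3 hfg.2 hbg.2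
    have hfin := quot_wt hbg.1 h1 hq0 h3 hfgw hbw
    have key : f - g ∈ G2 K (Option ι) ν → f ∈ (G2 K (Option ι) ν).toSubmodule := by
      intro h
      have := add_mem h g1
      simpa using this
    apply key
    rcases hfin with h0 | ⟨hle, hw'⟩
    · rw [h0]; exact zero_mem _
    · have e : f - g = qV * h := by ext ρ; exact h3 ρ
      rw [e]
      exact mul_mem (qV_mem h2) (ihj (j - 4) (by omega) h ⟨h1, hinv⟩ hw')
  intro f hf
  exact mem_of_comps w2 (G2 K (Option ι) ν).toSubmodule (Good2 K (Option ι) ν) (fun _ h => h.1)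
    (fun t _ h hh => Good2_scal _ _ t hh) hf (fun n g hg hgn => main n g hg hgn)

lemma fftV [Infinite K] (h2 : (2:K) ≠ 0) (ι : Type) [Finite ι] :
    ∀ (ν : Type) [Finite ν], ∀ f ∈ Good2 K ι ν, f ∈ G2 K ι ν := by
  apply Finite.induction_empty_option (P := fun ι : Type => ∀ (ν : Type) [Finite ν], ∀ f ∈ Good2 K ι ν, f ∈ G2 K ι ν)
  · intro α β e ih ν _ f hf
    let θ : (Idx2 α ν → K) → (Idx2 β ν → K) := fun ρ => Sum.elim (fun p => ρ (.inl (e.symm p.1, p.2))) (fun p => ρ (.inr p))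
    let θ' : (Idx2 β ν → K) → (Idx2 α ν → K) := fun ρ => Sum.elim (fun p => ρ (.inl (e p.1, p.2))) (fun p => ρ (.inr p))
    have h1 : pb θ f ∈ Good2 K α ν := by
      refine ⟨Pol.comp ?_ hf.1, fun h hh ρ => hf.2 h hh (θ ρ)⟩
      rintro (x | x) <;> exact Pol.coord _
    have h2 := ih ν _ h1
    have h3 : f = pb θ' (pb θ f) := by
      ext ρ
      simp only [pb_apply]
      congr 1
      ext x
      rcases x with x | x <;> simp [θ, θ']
    rw [h3]
    exact G2_pull (θ := θ') (fun _ => 1) e (fun ρ i => (one_smul _ _).symm) (fun _ => 1) id (fun ρ i => (one_smul _ _).symm) h2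
  · intro ν _ f hf
    exact GE_le (fftE ν f hf)
  · intro α _ ih ν _
    exact fftV_step h2 (ih (Option ν))
end fftV
end O3

open Matrix MvPolynomial
namespace O3

section mono
variable {K : Type} [Field K] {Ω L N : Type} [AddCommMonoid N]

abbrev M3 (K : Type) := Matrix (Fin 3) (Fin 3) K

def mw (mat : L → Ω → M3 K) (w : List L) (ω : Ω) : M3 K := (w.map fun l => mat l ω).prod

def cw (cnt : L → N) (w : List L) : N := (w.map cnt).sum

lemma mw_append (mat : L → Ω → M3 K) (w w' : List L) (ω : Ω) : mw mat (w ++ w') ω = mw mat w ω * mw mat w' ω := by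
  simp [mw]
lemma mw_cons (mat : L → Ω → M3 K) (l) (w' : List L) (ω : Ω) : mw mat (l :: w') ω = mat l ω * mw mat w' ω := by
  simp [mw]
lemma mw_nil (mat : L → Ω → M3 K) (ω : Ω) : mw mat [] ω = 1 := by
  simp [mw]
lemma cw_append (cnt : L → N) (w w' : List L) : cw cnt (w ++ w') = cw cnt w + cw cnt w' := by simp [cw]
lemma cw_cons (cnt : L → N) (l) (w' : List L) : cw cnt (l :: w') = cnt l + cw cnt w' := by simp [cw]
lemma cw_nil (cnt : L → N) : cw cnt [] = 0 := by simp [cw]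

inductive Mono (mat : L → Ω → M3 K) (cnt : L → N) (D : Submonoid (Ω → K)) : N → (Ω → K) → Prop
  | base (d : Ω → K) (hd : d ∈ D) : Mono mat cnt D 0 d
  | cons (n : N) (f : Ω → K) (w : List L) (h : Mono mat cnt D n f) :
      Mono mat cnt D (n + cw cnt w) (fun ω => f ω * (mw mat w ω).trace)

variable {mat : L → Ω → M3 K} {cnt : L → N} {D : Submonoid (Ω → K)}

lemma Mono.mul {n m : N} {f g : Ω → K} (hf : Mono mat cnt D n f) (hg : Mono mat cnt D m g) :
    Mono mat cnt D (n + m) (f * g) := by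
  induction hg with
  | base d hd =>
    rw [add_zero]
    induction hf with
    | base d' hd' => exact .base _ (mul_mem hd' hd)
    | cons n f w h ih =>
      convert Mono.cons n _ w ih using 1
      ext ω; simp only [Pi.mul_apply]; ring
  | cons m g w h ih =>
    rw [← add_assoc]
    convert Mono.cons _ _ w ih using 1
    ext ω; simp only [Pi.mul_apply]; ring

lemma Mono.one : Mono mat cnt D 0 1 := .base 1 (one_mem _)

lemma Mono.tr (w : List L) : Mono mat cnt D (cw cnt w) (fun ω => (mw mat w ω).trace) := by
  have := Mono.cons 0 1 w (Mono.one (mat := mat) (cnt := cnt) (D := D))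
  simpa using this

def GG (mat : L → Ω → M3 K) (cnt : L → N) (D : Submonoid (Ω → K)) (n : N) : Submodule K (Ω → K) :=
  Submodule.span K {f | Mono mat cnt D n f}

def TM (mat : L → Ω → M3 K) (cnt : L → N) (D : Submonoid (Ω → K)) (n : N) : Submodule K (Ω → M3 K) :=
  Submodule.span K {U | ∃ p g w, Mono mat cnt D p g ∧ p + cw cnt w = n ∧ U = fun ω => g ω • mw mat w ω}

lemma span_bil {A B C : Type} [AddCommMonoid A] [Module K A] [AddCommMonoid B] [Module K B] [AddCommMonoid C] [Module K C]
    (φ : A →ₗ[K] B →ₗ[K] C) {S : Set A} {T : Set B} {M : Submodule K C} (h : ∀ x ∈ S, ∀ y ∈ T, φ x y ∈ M)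
    {x y} (hx : x ∈ Submodule.span K S) (hy : y ∈ Submodule.span K T) : φ x y ∈ M := by
  have := Submodule.apply_mem_map₂ φ hx hy
  rw [Submodule.map₂_span_span] at this
  refine Submodule.span_le.2 ?_ this
  rintro _ ⟨x, hx, y, hy, rfl⟩
  exact h x hx y hy

lemma span_lin {A C : Type} [AddCommMonoid A] [Module K A] [AddCommMonoid C] [Module K C]
    (φ : A →ₗ[K] C) {S : Set A} {M : Submodule K C} (h : ∀ x ∈ S, φ x ∈ M)
    {x} (hx : x ∈ Submodule.span K S) : φ x ∈ M := by
  have : Submodule.span K S ≤ M.comap φ := Submodule.span_le.2 h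
  exact this hx

lemma GG_mul {n m : N} {f g} (hf : f ∈ GG mat cnt D n) (hg : g ∈ GG mat cnt D m) : f * g ∈ GG mat cnt D (n + m) :=
  span_bil (LinearMap.mul K (Ω → K)) (fun _ hx _ hy => Submodule.subset_span (Mono.mul hx hy)) hf hg

lemma TM_mul {n m : N} {f g} (hf : f ∈ TM mat cnt D n) (hg : g ∈ TM mat cnt D m) : f * g ∈ TM mat cnt D (n + m) := by
  refine span_bil (LinearMap.mul K (Ω → M3 K)) ?_ hf hg
  rintro _ ⟨p, g, w, h, e, rfl⟩ _ ⟨p', g', w', h', e', rfl⟩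
  refine Submodule.subset_span ⟨_, _, w ++ w', Mono.mul h h', ?_, ?_⟩
  · rw [← e, ← e', cw_append]; abel
  · ext1 ω
    simp [mw_append, smul_smul, mul_comm]

def trL : (Ω → M3 K) →ₗ[K] (Ω → K) where
  toFun U := fun ω => (U ω).trace
  map_add' _ _ := by ext ω; simp
  map_smul' _ _ := by ext ω; simp

def tpL : (Ω → M3 K) →ₗ[K] (Ω → M3 K) where
  toFun U := fun ω => (U ω)ᵀ
  map_add' _ _ := by ext ω; simp
  map_smul' _ _ := by ext ω; simp

def scL : (Ω → K) →ₗ[K] (Ω → M3 K) where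
  toFun g := fun ω => g ω • 1
  map_add' _ _ := by ext1 ω; simp [add_smul]
  map_smul' _ _ := by ext1 ω; simp [smul_smul]

lemma TM_tr {n : N} {U} (hU : U ∈ TM mat cnt D n) : trL U ∈ GG mat cnt D n := by
  refine span_lin trL ?_ hU
  rintro _ ⟨p, g, w, h, e, rfl⟩
  apply Submodule.subset_span
  have := Mono.cons p g w h
  rw [e] at this
  have e2 : trL (fun ω => g ω • mw mat w ω) = fun ω => g ω * (mw mat w ω).trace := by
    ext ω; simp [trL]
  rw [e2]; exact this

lemma TM_sc {n : N} {g} (hg : g ∈ GG mat cnt D n) : scL g ∈ TM mat cnt D n := by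
  refine span_lin scL ?_ hg
  intro g hg
  exact Submodule.subset_span ⟨n, g, [], hg, by simp [cw_nil], by ext1 ω; simp [scL, mw_nil]⟩

lemma TM_word (w : List L) : mw mat w ∈ TM mat cnt D (cw cnt w) :=
  Submodule.subset_span ⟨0, 1, w, Mono.one, by simp, by ext1 ω; simp⟩

lemma TM_one : (1 : Ω → M3 K) ∈ TM mat cnt D 0 := by
  have := TM_word (mat := mat) (cnt := cnt) (D := D) []
  rw [cw_nil] at this
  convert this using 1
  ext1 ω; rw [mw_nil]; rfl

lemma mw_tp (hT : ∀ l, ∃ ε : K, ∀ ω, (mat l ω)ᵀ = ε • mat l ω) (w : List L) :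
    ∃ ε : K, ∀ ω, (mw mat w ω)ᵀ = ε • mw mat w.reverse ω := by
  induction w with
  | nil => exact ⟨1, fun ω => by simp [mw_nil]⟩
  | cons l w ih =>
    obtain ⟨ε, h⟩ := ih
    obtain ⟨ε', h'⟩ := hT l
    refine ⟨ε * ε', fun ω => ?_⟩
    simp only [mw_cons, Matrix.transpose_mul, h, h', List.reverse_cons, mw_append, mw_nil, mul_one,
      smul_mul_assoc, mul_smul_comm, smul_smul, mul_comm ε ε']

lemma cw_reverse (w : List L) : cw cnt w.reverse = cw cnt w := by
  induction w with
  | nil => rfl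
  | cons l w ih => rw [List.reverse_cons, cw_append, cw_cons, cw_cons, cw_nil, ih, add_zero, add_comm]

lemma TM_tp (hT : ∀ l, ∃ ε : K, ∀ ω, (mat l ω)ᵀ = ε • mat l ω) {n : N} {U} (hU : U ∈ TM mat cnt D n) :
    tpL U ∈ TM mat cnt D n := by
  refine span_lin tpL ?_ hU
  rintro _ ⟨p, g, w, h, e, rfl⟩
  obtain ⟨ε, hε⟩ := mw_tp hT w
  have : tpL (fun ω => g ω • mw mat w ω) = ε • fun ω => g ω • mw mat w.reverse ω := by
    ext1 ω
    simp only [tpL, LinearMap.coe_mk, AddHom.coe_mk, Matrix.transpose_smul, hε, Pi.smul_apply]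
    rw [smul_comm]
  rw [this]
  exact Submodule.smul_mem _ _ (Submodule.subset_span ⟨p, g, _, h, by rw [cw_reverse, e], rfl⟩)

lemma Mono.extract {u : L} (pu : N →+ ℕ) (hpu : ∀ l, l ≠ u → pu (cnt l) = 0) {n : N} {f} (hf : Mono mat cnt D n f)
    (hn : pu n ≠ 0) : ∃ p g w, Mono mat cnt D p g ∧ p + cnt u + cw cnt w = n ∧
      f = fun ω => g ω * (mat u ω * mw mat w ω).trace := by
  induction hf with
  | base d hd => simp at hn
  | cons n f w h ih =>
    by_cases hw : u ∈ w
    · obtain ⟨a, b, rfl⟩ := List.append_of_mem hw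
      refine ⟨n, f, b ++ a, h, ?_, ?_⟩
      · rw [cw_append, cw_append, cw_cons]; abel
      · ext ω
        rw [mw_append, mw_cons, mw_append, Matrix.trace_mul_comm, Matrix.mul_assoc]
    · have h0 : pu (cw cnt w) = 0 := by
        clear ih hn h
        induction w with
        | nil => simp [cw_nil]
        | cons l w ih =>
          simp only [List.mem_cons, not_or] at hw
          rw [cw_cons, _root_.map_add, ih hw.2, hpu l (Ne.symm hw.1)]
      rw [_root_.map_add, h0, add_zero] at hn
      obtain ⟨p, g, w', h1, h2, h3⟩ := ih hn
      refine ⟨_, _, w', Mono.cons p g w h1, ?_, ?_⟩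
      · rw [← h2]; abel
      · subst h3
        ext ω; ring

lemma cw_ne {u : L} (pu : N →+ ℕ) (hpu : ∀ l, l ≠ u → pu (cnt l) = 0) (w : List L) (h : pu (cw cnt w) ≠ 0) : u ∈ w := by
  by_contra hw
  apply h
  clear h
  induction w with
  | nil => simp [cw_nil]
  | cons l w ih =>
    simp only [List.mem_cons, not_or] at hw
    rw [cw_cons, _root_.map_add, ih hw.2, hpu l (Ne.symm hw.1)]

/-- hat map -/
def hat (x : Fin 3 → K) : M3 K := !![0, -x 2, x 1; x 2, 0, -x 0; -x 1, x 0, 0]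

lemma hat_c1 (y y' : Fin 3 → K) (A B : M3 K) :
    (hat y * A * hat y' * B).trace = A.trace * (Matrix.vecMulVec y' y * B).trace
      - A.trace * B.trace * (Matrix.vecMulVec y' y).trace
      - (Aᵀ * Matrix.vecMulVec y' y * B).trace + (Aᵀ * B).trace * (Matrix.vecMulVec y' y).trace
      - (Matrix.vecMulVec y' y * Aᵀ * B).trace + B.trace * (Aᵀ * Matrix.vecMulVec y' y).trace := by
  have : hat y * A * hat y' = A.trace • (vecMulVec y' y) - (A.trace * (vecMulVec y' y).trace) • 1
      - Aᵀ * vecMulVec y' y + (vecMulVec y' y).trace • Aᵀ - vecMulVec y' y * Aᵀ + (Aᵀ * vecMulVec y' y).trace • 1 := by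
    ext i j
    fin_cases i <;> fin_cases j <;>
    simp [hat, Matrix.trace_fin_three, Matrix.mul_apply, Fin.sum_univ_three, vecMulVec_apply, Matrix.vecMul, dotProduct] <;> ring
  rw [this]
  simp only [Matrix.add_mul, Matrix.sub_mul, Matrix.trace_add, Matrix.trace_sub, Matrix.smul_mul, Matrix.trace_smul, smul_eq_mul,
    Matrix.one_mul]
  ring

lemma hat_tr (y : Fin 3 → K) (A : M3 K) : (hat y * A).trace =
    - (y ⬝ᵥ ![A 2 1 - A 1 2, A 0 2 - A 2 0, A 1 0 - A 0 1]) := by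
  simp [hat, Matrix.trace_fin_three, Matrix.mul_apply, Fin.sum_univ_three, dotProduct, Matrix.vecMul]; ring

lemma hat_ax (A : M3 K) : A - Aᵀ = hat ![A 2 1 - A 1 2, A 0 2 - A 2 0, A 1 0 - A 0 1] := by
  ext i j
  fin_cases i <;> fin_cases j <;> simp [hat]

lemma hat_c2 (y y' : Fin 3 → K) (A A' : M3 K) :
    2 * ((hat y * A).trace * (hat y' * A').trace) =
      2 * (Matrix.vecMulVec y' y * (A' - A'ᵀ) * (A - Aᵀ)).trace -
      ((A - Aᵀ) * (A' - A'ᵀ)).trace * (Matrix.vecMulVec y' y).trace := by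
  rw [hat_tr, hat_tr, hat_ax, hat_ax]
  generalize ![A 2 1 - A 1 2, A 0 2 - A 2 0, A 1 0 - A 0 1] = a
  generalize ![A' 2 1 - A' 1 2, A' 0 2 - A' 2 0, A' 1 0 - A' 0 1] = a'
  simp [hat, Matrix.trace_fin_three, Matrix.mul_apply, Fin.sum_univ_three, vecMulVec_apply, dotProduct]; ring
end mono

section contract
variable {K : Type} [Field K] {Ω L N : Type} [AddCancelCommMonoid N]
variable {mat : L → Ω → M3 K} {cnt : L → N} {D : Submonoid (Ω → K)}

lemma Mono.contract (h2 : (2:K) ≠ 0) (hT : ∀ l, ∃ ε : K, ∀ ω, (mat l ω)ᵀ = ε • mat l ω) {u u' : L} (pu pu' : N →+ ℕ)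
    (hpu : ∀ l, l ≠ u → pu (cnt l) = 0) (hpu' : ∀ l, l ≠ u' → pu' (cnt l) = 0)
    (y y' : Ω → Fin 3 → K) (hy : ∀ ω, mat u ω = hat (y ω)) (hy' : ∀ ω, mat u' ω = hat (y' ω))
    (hZ : (fun ω => Matrix.vecMulVec (y' ω) (y ω)) ∈ TM mat cnt D 0)
    {n : N} {f} (hf : Mono mat cnt D (n + cnt u + cnt u') f) (h1 : pu (n + cnt u + cnt u') ≠ 0) (h1' : pu' (n + cnt u') ≠ 0) :
    f ∈ GG mat cnt D n := by
  obtain ⟨p, g, w, hg, hp, rfl⟩ := hf.extract pu hpu h1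
  have hp1 : p + cw cnt w = n + cnt u' := by
    apply add_right_cancel (b := cnt u)
    rw [add_right_comm, hp]; abel
  set Z : Ω → M3 K := fun ω => Matrix.vecMulVec (y' ω) (y ω) with hZd
  by_cases hw : u' ∈ w
  · obtain ⟨a, b, rfl⟩ := List.append_of_mem hw
    have hn : n = p + (cw cnt a + cw cnt b) := by
      apply add_right_cancel (b := cnt u')
      rw [← hp1, cw_append, cw_cons]; abel
    let A := mw mat a
    let B := mw mat b
    have hA : A ∈ TM mat cnt D (cw cnt a) := TM_word a
    have hB : B ∈ TM mat cnt D (cw cnt b) := TM_word b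
    have hAt := TM_tp hT hA
    have key : trL A * trL (Z * B) - trL A * trL B * trL Z - trL (tpL A * Z * B) + trL (tpL A * B) * trL Z
        - trL (Z * tpL A * B) + trL B * trL (tpL A * Z) ∈ GG mat cnt D (cw cnt a + cw cnt b) := by
      refine add_mem (sub_mem (add_mem (sub_mem (sub_mem ?_ ?_) ?_) ?_) ?_) ?_
      · simpa using GG_mul (TM_tr hA) (TM_tr (TM_mul hZ hB))
      · simpa using GG_mul (GG_mul (TM_tr hA) (TM_tr hB)) (TM_tr hZ)
      · simpa using TM_tr (TM_mul (TM_mul hAt hZ) hB)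
      · simpa using GG_mul (TM_tr (TM_mul hAt hB)) (TM_tr hZ)
      · simpa using TM_tr (TM_mul (TM_mul hZ hAt) hB)
      · simpa [add_comm] using GG_mul (TM_tr hB) (TM_tr (TM_mul hAt hZ))
    rw [hn]
    convert GG_mul (Submodule.subset_span hg) key using 1
    ext ω
    simp only [Pi.mul_apply]
    congr 1
    rw [mw_append, mw_cons, hy, hy', ← Matrix.mul_assoc, ← Matrix.mul_assoc, hat_c1]
    rfl
  · have hp0 : pu' p ≠ 0 := by
      intro h0
      have h3 := congrArg pu' hp1
      rw [_root_.map_add, h0, zero_add] at h3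
      exact hw (cw_ne pu' hpu' w (by rw [h3]; exact h1'))
    obtain ⟨p', g', w', hg', hp', rfl⟩ := hg.extract pu' hpu' hp0
    have hn : n = p' + (cw cnt w' + cw cnt w) := by
      apply add_right_cancel (b := cnt u')
      rw [← hp1, ← hp']; abel
    let A := mw mat w
    let B := mw mat w'
    have hA : A ∈ TM mat cnt D (cw cnt w) := TM_word w
    have hB : B ∈ TM mat cnt D (cw cnt w') := TM_word w'
    have hA' := sub_mem hA (TM_tp hT hA)
    have hB' := sub_mem hB (TM_tp hT hB)
    have key : (2:K)⁻¹ • ((2:K) • trL (Z * (B - tpL B) * (A - tpL A)) - trL ((A - tpL A) * (B - tpL B)) * trL Z) ∈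
        GG mat cnt D (cw cnt w' + cw cnt w) := by
      refine Submodule.smul_mem _ _ (sub_mem (Submodule.smul_mem _ _ ?_) ?_)
      · simpa using TM_tr (TM_mul (TM_mul hZ hB') hA')
      · simpa [add_comm] using GG_mul (TM_tr (TM_mul hA' hB')) (TM_tr hZ)
    rw [hn]
    convert GG_mul (Submodule.subset_span hg') key using 1
    ext ω
    simp only [Pi.mul_apply, Pi.smul_apply, Pi.sub_apply, smul_eq_mul]
    rw [mul_assoc]
    congr 1
    rw [hy, hy', eq_inv_mul_iff_mul_eq₀ h2, mul_comm ((hat (y' ω) * _).trace), hat_c2]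
    rfl
end contract
end O3

open Matrix MvPolynomial
namespace O3

section envS
variable {K : Type} [Field K] {κ ι κ' ι' : Type}

abbrev IdxS (κ ι : Type) := (κ × Fin 6) ⊕ (ι × Fin 3)

def s6 (v : Fin 6 → K) : M3 K := !![v 0, v 1, v 2; v 1, v 3, v 4; v 2, v 4, v 5]
def sM (ρ : IdxS κ ι → K) (k : κ) : M3 K := s6 fun c => ρ (.inl (k, c))
def xV (ρ : IdxS κ ι → K) (i : ι) : Fin 3 → K := fun c => ρ (.inr (i, c))
def c6 (A : M3 K) : Fin 6 → K := ![A 0 0, A 0 1, A 0 2, A 1 1, A 1 2, A 2 2]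

lemma s6_c6 (A : M3 K) (h : Aᵀ = A) : s6 (c6 A) = A := by
  have h' : ∀ i j, A i j = A j i := fun i j => congrFun (congrFun h j) i
  ext i j
  fin_cases i <;> fin_cases j <;> simp [s6, c6, h' 1 0, h' 2 0, h' 2 1]

lemma c6_s6 (v : Fin 6 → K) : c6 (s6 v) = v := by
  ext i; fin_cases i <;> rfl

lemma s6_tp (v : Fin 6 → K) : (s6 v)ᵀ = s6 v := by
  ext i j; fin_cases i <;> fin_cases j <;> rfl

lemma hat_tp (v : Fin 3 → K) : (hat v)ᵀ = (-1 : K) • hat v := by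
  ext i j; fin_cases i <;> fin_cases j <;> simp [hat]

def mS : κ ⊕ ι → (IdxS κ ι → K) → M3 K
  | .inl k, ρ => sM ρ k
  | .inr i, ρ => hat (xV ρ i)

lemma mS_tp (l : κ ⊕ ι) : ∃ ε : K, ∀ ρ : IdxS κ ι → K, (mS l ρ)ᵀ = ε • mS l ρ := by
  rcases l with k | i
  · exact ⟨1, fun ρ => by rw [one_smul]; exact s6_tp fun c => ρ (.inl (k, c))⟩
  · exact ⟨-1, fun ρ => hat_tp (xV ρ i)⟩

def dS (k : κ) (ρ : IdxS κ ι → K) : K := (sM ρ k).det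

def GS (K : Type) [Field K] (κ ι : Type) : Subalgebra K ((IdxS κ ι → K) → K) :=
  Algebra.adjoin K ({f | ∃ w, f = fun ρ => (mw mS w ρ).trace} ∪ Set.range dS)

lemma GS_tr (w : List (κ ⊕ ι)) : (fun ρ => (mw mS w ρ).trace) ∈ GS K κ ι :=
  Algebra.subset_adjoin (Or.inl ⟨w, rfl⟩)
lemma GS_det (k : κ) : (dS k : (IdxS κ ι → K) → K) ∈ GS K κ ι := Algebra.subset_adjoin (Or.inr ⟨k, rfl⟩)

lemma envS_ext {ρ ρ' : IdxS κ ι → K} (h1 : ∀ i, sM ρ i = sM ρ' i) (h2 : ∀ a, xV ρ a = xV ρ' a) :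
    ρ = ρ' := by
  ext x
  rcases x with ⟨i, c⟩ | ⟨a, c⟩
  · have := congrArg c6 (h1 i)
    rw [sM, sM, c6_s6, c6_s6] at this
    exact congrFun this c
  · exact congrFun (h2 a) c

def actS (g : M3 K) (ρ : IdxS κ ι → K) : IdxS κ ι → K :=
  Sum.elim (fun p => c6 (g * sM ρ p.1 * gᵀ) p.2) (fun p => (g *ᵥ xV ρ p.1) p.2)

lemma sM_act (g : M3 K) (ρ : IdxS κ ι → K) (k : κ) : sM (actS g ρ) k = g * sM ρ k * gᵀ := by
  have : (g * sM ρ k * gᵀ)ᵀ = g * sM ρ k * gᵀ := by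
    rw [Matrix.transpose_mul, Matrix.transpose_mul, Matrix.transpose_transpose, sM, s6_tp, Matrix.mul_assoc]
  exact s6_c6 _ this

lemma xV_act (g : M3 K) (ρ : IdxS κ ι → K) (i : ι) : xV (actS g ρ) i = g *ᵥ xV ρ i := rfl

lemma adj_orth {g : M3 K} (hg : gᵀ * g = 1) (hd : g.det = 1) : g.adjugate = gᵀ := by
  have : gᵀ * (g * g.adjugate) = gᵀ := by rw [Matrix.mul_adjugate, hd, one_smul, Matrix.mul_one]
  rw [← this, ← Matrix.mul_assoc, hg, Matrix.one_mul]

lemma hat_adj (g : M3 K) (x : Fin 3 → K) : g * hat x * gᵀ = hat (g.adjugateᵀ *ᵥ x) := by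
  rw [Matrix.adjugate_fin_three]
  ext i j
  fin_cases i <;> fin_cases j <;>
  simp [hat, Matrix.mul_apply, Fin.sum_univ_three, Matrix.mulVec, Matrix.vecMul, dotProduct] <;> ring

lemma hat_act {g : M3 K} (hg : gᵀ * g = 1) (hd : g.det = 1) (x : Fin 3 → K) : hat (g *ᵥ x) = g * hat x * gᵀ := by
  rw [hat_adj, adj_orth hg hd, Matrix.transpose_transpose]

lemma mw_act {g : M3 K} (hg : gᵀ * g = 1) (hd : g.det = 1) (w : List (κ ⊕ ι)) (ρ : IdxS κ ι → K) :
    mw mS w (actS g ρ) = g * mw mS w ρ * gᵀ := by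
  have hg' : g * gᵀ = 1 := mul_eq_one_comm.1 hg
  induction w with
  | nil => simp [mw_nil, hg']
  | cons l w ih =>
    have : mS l (actS g ρ) = g * mS l ρ * gᵀ := by
      rcases l with k | i
      · exact sM_act g ρ k
      · exact hat_act hg hd _
    rw [mw_cons, mw_cons, ih, this]
    calc _ = g * mS l ρ * (gᵀ * g) * mw mS w ρ * gᵀ := by noncomm_ring
      _ = _ := by rw [hg]; noncomm_ring

def InvS (K : Type) [Field K] (κ ι : Type) : Submodule K ((IdxS κ ι → K) → K) where
  carrier := {f | ∀ g : M3 K, gᵀ * g = 1 → g.det = 1 → ∀ ρ, f (actS g ρ) = f ρ}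
  zero_mem' := by intro g _ _ ρ; rfl
  add_mem' := by
    intro f g hf hg h hh hd ρ
    simp only [Pi.add_apply]
    rw [hf h hh hd, hg h hh hd]
  smul_mem' := by
    intro c f hf h hh hd ρ
    simp only [Pi.smul_apply]
    rw [hf h hh hd]

lemma GS_inv {f} (hf : f ∈ GS K κ ι) : f ∈ InvS K κ ι := by
  intro g hg hd
  induction hf using Algebra.adjoin_induction with
  | mem x hx =>
    intro ρ
    rcases hx with ⟨w, rfl⟩ | ⟨k, rfl⟩
    · simp only [mw_act hg hd]
      rw [Matrix.trace_mul_comm, ← Matrix.mul_assoc, hg, Matrix.one_mul]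
    · simp only [dS, sM_act, Matrix.det_mul, Matrix.det_transpose, hd]; ring
  | algebraMap r => intro ρ; rfl
  | add x y _ _ hx hy => intro ρ; simp only [Pi.add_apply, hx, hy]
  | mul x y _ _ hx hy => intro ρ; simp only [Pi.mul_apply, hx, hy]

lemma sM_pol (k : κ) (i j) : (fun ρ : IdxS κ ι → K => sM ρ k i j) ∈ Pol K (IdxS κ ι) := by
  fin_cases i <;> fin_cases j <;> exact Pol.coord _

lemma mS_pol (l : κ ⊕ ι) (i j) : (fun ρ : IdxS κ ι → K => mS l ρ i j) ∈ Pol K (IdxS κ ι) := by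
  rcases l with k | k
  · exact sM_pol k i j
  · fin_cases i <;> fin_cases j <;> first | exact Pol.const 0 | exact Pol.coord _ | exact Pol.neg (Pol.coord _)

lemma mw_pol (w : List (κ ⊕ ι)) (i j) : (fun ρ : IdxS κ ι → K => mw mS w ρ i j) ∈ Pol K (IdxS κ ι) := by
  induction w generalizing i j with
  | nil => simp only [mw_nil]; exact Pol.const _
  | cons l w ih =>
    simp only [mw_cons, Matrix.mul_apply]
    exact Pol.sum _ fun c => Pol.mul (mS_pol l i c) (ih c j)

lemma GS_pol {f} (hf : f ∈ GS K κ ι) : f ∈ Pol K (IdxS κ ι) := by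
  have : GS K κ ι ≤ Pol K (IdxS κ ι) := by
    apply Algebra.adjoin_le
    rintro _ (⟨w, rfl⟩ | ⟨k, rfl⟩)
    · exact Pol.sum _ fun c => mw_pol w c c
    · have : (dS k : (IdxS κ ι → K) → K) = fun ρ => sM ρ k 0 0 * sM ρ k 1 1 * sM ρ k 2 2 - sM ρ k 0 0 * sM ρ k 1 2 * sM ρ k 2 1
          - sM ρ k 0 1 * sM ρ k 1 0 * sM ρ k 2 2 + sM ρ k 0 1 * sM ρ k 1 2 * sM ρ k 2 0
          + sM ρ k 0 2 * sM ρ k 1 0 * sM ρ k 2 1 - sM ρ k 0 2 * sM ρ k 1 1 * sM ρ k 2 0 := by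
        ext ρ; exact Matrix.det_fin_three _
      rw [this]
      have h := fun i j => sM_pol (K := K) (ι := ι) k i j
      exact Pol.sub (Pol.add (Pol.add (Pol.sub (Pol.sub (Pol.mul (Pol.mul (h _ _) (h _ _)) (h _ _)) (Pol.mul (Pol.mul (h _ _) (h _ _)) (h _ _)))
        (Pol.mul (Pol.mul (h _ _) (h _ _)) (h _ _))) (Pol.mul (Pol.mul (h _ _) (h _ _)) (h _ _))) (Pol.mul (Pol.mul (h _ _) (h _ _)) (h _ _)))
        (Pol.mul (Pol.mul (h _ _) (h _ _)) (h _ _))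
  exact this hf

lemma actS_pol (g : M3 K) (x : IdxS κ ι) : (fun ρ => actS g ρ x) ∈ Pol K (IdxS κ ι) := by
  rcases x with ⟨k, c⟩ | ⟨i, c⟩
  · have key : ∀ x y, (fun ρ : IdxS κ ι → K => (g * sM ρ k * gᵀ) x y) ∈ Pol K (IdxS κ ι) := by
      intro x y
      simp only [Matrix.mul_apply]
      refine Pol.sum _ fun a => Pol.mul (Pol.sum _ fun b => Pol.mul (Pol.const _) ?_) (Pol.const _)
      exact sM_pol k _ _
    fin_cases c <;> exact key _ _
  · have e : (fun ρ : IdxS κ ι → K => actS g ρ (.inr (i, c))) =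
        fun ρ => ∑ b : Fin 3, g c b * ρ (.inr (i, b)) := rfl
    rw [e]
    exact Pol.sum _ fun b => Pol.mul (Pol.const _) (Pol.coord _)

noncomputable def GoodS (K : Type) [Field K] (κ ι : Type) : Submodule K ((IdxS κ ι → K) → K) :=
  (Pol K (IdxS κ ι)).toSubmodule ⊓ InvS K κ ι

lemma GS_good {f} (hf : f ∈ GS K κ ι) : f ∈ GoodS K κ ι := ⟨GS_pol hf, GS_inv hf⟩

def wS (wk : κ → ℕ) (wi : ι → ℕ) : IdxS κ ι → ℕ := Sum.elim (fun p => wk p.1) (fun p => wi p.1)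

lemma sM_sw (wk : κ → ℕ) (wi : ι → ℕ) (t : K) (ρ : IdxS κ ι → K) (k : κ) :
    sM (scal (wS wk wi) t ρ) k = t ^ wk k • sM ρ k := by
  ext a b
  fin_cases a <;> fin_cases b <;> simp [sM, s6, scal, wS]

lemma xV_sw (wk : κ → ℕ) (wi : ι → ℕ) (t : K) (ρ : IdxS κ ι → K) (a : ι) :
    xV (scal (wS wk wi) t ρ) a = t ^ wi a • xV ρ a := by
  ext c
  simp [xV, scal, wS]

lemma hat_smul (c : K) (x : Fin 3 → K) : hat (c • x) = c • hat x := by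
  ext i j; fin_cases i <;> fin_cases j <;> simp [hat]

lemma mS_sw (wk : κ → ℕ) (wi : ι → ℕ) (t : K) (ρ : IdxS κ ι → K) (l : κ ⊕ ι) :
    mS l (scal (wS wk wi) t ρ) = t ^ (Sum.elim wk wi l) • mS l ρ := by
  rcases l with k | i
  · exact sM_sw _ _ _ _ _
  · simp only [mS, xV_sw, hat_smul, Sum.elim_inr]

lemma GS_pull {θ : (IdxS κ' ι' → K) → (IdxS κ ι → K)} (c : κ ⊕ ι → K) (r : κ ⊕ ι → κ' ⊕ ι')
    (h : ∀ ρ i, mS i (θ ρ) = c i • mS (r i) ρ) (hd : ∀ k, pb θ (dS k) ∈ GS K κ' ι') {f} (hf : f ∈ GS K κ ι) :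
    pb θ f ∈ GS K κ' ι' := by
  have hw : ∀ w : List (κ ⊕ ι), ∃ c : K, ∀ ρ, mw mS w (θ ρ) = c • mw mS (w.map r) ρ := by
    intro w
    induction w with
    | nil => exact ⟨1, fun ρ => by simp [mw_nil]⟩
    | cons l w ih =>
      obtain ⟨c', hc⟩ := ih
      refine ⟨c l * c', fun ρ => ?_⟩
      rw [mw_cons, hc, h, List.map_cons, mw_cons, smul_mul_smul_comm]
  have : GS K κ ι ≤ (GS K κ' ι').comap (pb θ) := by
    apply Algebra.adjoin_le
    rintro _ (⟨w, rfl⟩ | ⟨k, rfl⟩)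
    · obtain ⟨c, hc⟩ := hw w
      have : (pb θ fun ρ => (mw mS w ρ).trace) = c • fun ρ => (mw mS (w.map r) ρ).trace := by
        ext ρ
        simp [hc]
      change (pb θ fun ρ => (mw mS w ρ).trace) ∈ GS K κ' ι'
      rw [this]
      exact Subalgebra.smul_mem _ (GS_tr _) _
    · exact hd k
  exact this hf

lemma dS_sw (wk : κ → ℕ) (wi : ι → ℕ) (t : K) (ρ : IdxS κ ι → K) (k : κ) :
    dS k (scal (wS wk wi) t ρ) = (t ^ wk k) ^ 3 * dS k ρ := by
  simp [dS, sM_sw, Matrix.det_smul]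

lemma GS_scal (wk : κ → ℕ) (wi : ι → ℕ) (t : K) {f} (hf : f ∈ GS K κ ι) :
    pb (scal (wS wk wi) t) f ∈ GS K κ ι := by
  refine GS_pull _ id (fun ρ l => mS_sw wk wi t ρ l) (fun k => ?_) hf
  have : pb (scal (wS wk wi) t) (dS k) = (t ^ wk k) ^ 3 • (dS k : (IdxS κ ι → K) → K) := by
    ext ρ; simp [dS_sw]
  rw [this]
  exact Subalgebra.smul_mem _ (GS_det k) _

lemma actS_scal (wk : κ → ℕ) (wi : ι → ℕ) (t : K) (h) (ρ : IdxS κ ι → K) :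
    actS h (scal (wS wk wi) t ρ) = scal (wS wk wi) t (actS h ρ) := by
  apply envS_ext
  · intro i; simp [sM_act, sM_sw]
  · intro a; simp [xV_act, xV_sw, Matrix.mulVec_smul]

lemma GoodS_scal (wk : κ → ℕ) (wi : ι → ℕ) (t : K) {f} (hf : f ∈ GoodS K κ ι) :
    pb (scal (wS wk wi) t) f ∈ GoodS K κ ι := by
  refine ⟨Pol.comp (Pol.scal _ t) hf.1, fun h hh hd ρ => ?_⟩
  simp only [pb_apply]
  rw [← actS_scal, hf.2 h hh hd]

lemma quot_invS [Infinite K] {q h f : (IdxS κ ι → K) → K} (hq : q ∈ Pol K (IdxS κ ι)) (hh : h ∈ Pol K (IdxS κ ι))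
    (hq0 : q ≠ 0) (H : ∀ ρ, f ρ = q ρ * h ρ) (hf : f ∈ InvS K κ ι) (hqi : q ∈ InvS K κ ι) : h ∈ InvS K κ ι :=
  fun g hg hd => quot_inv hq hh hq0 H (actS g) (actS_pol g) (hf g hg hd) (hqi g hg hd)
end envS

section monomaps
variable {K : Type} [Field K] {Ω L L' N N' : Type} [AddCommMonoid N] [AddCommMonoid N']
variable {mat : L → Ω → M3 K} {cnt : L → N} {D : Submonoid (Ω → K)}

lemma mw_map (r : L' → L) (w : List L') (ω : Ω) : mw (fun l => mat (r l)) w ω = mw mat (w.map r) ω := by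
  simp [mw]; rfl

lemma Mono.map {mat' : L' → Ω → M3 K} {cnt' : L' → N} (r : L → L') (h : ∀ l ω, mat l ω = mat' (r l) ω)
    (hc : ∀ l, cnt l = cnt' (r l)) {n f} (hf : Mono mat cnt D n f) : Mono mat' cnt' D n f := by
  induction hf with
  | base d hd => exact .base d hd
  | cons n f w _ ih =>
    have e1 : ∀ ω, mw mat w ω = mw mat' (w.map r) ω := by
      intro ω; rw [← mw_map]; simp [mw, h]
    have e2 : cw cnt w = cw cnt' (w.map r) := by
      rw [cw, cw, List.map_map]
      congr 1
      apply List.map_congr_left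
      intro l _; exact hc l
    simp only [e1, e2]
    exact .cons n f _ ih

lemma Mono.zero (hN : ∀ a b : N, a + b = 0 → a = 0 ∧ b = 0) (r : L' → L) (hr : ∀ l, cnt l = 0 → ∃ l', r l' = l)
    (cnt' : L' → N') {n f} (hf : Mono mat cnt D n f) (hn : n = 0) : ∃ n', Mono (fun l => mat (r l)) cnt' D n' f := by
  induction hf with
  | base d hd => exact ⟨0, .base d hd⟩
  | cons n f w _ ih =>
    obtain ⟨h1, h2⟩ := hN _ _ hn
    obtain ⟨n', h⟩ := ih h1
    have : ∃ w', w = List.map r w' := by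
      clear ih hn h h1
      induction w with
      | nil => exact ⟨[], rfl⟩
      | cons l w ih =>
        rw [cw_cons] at h2
        obtain ⟨h3, h4⟩ := hN _ _ h2
        obtain ⟨w', rfl⟩ := ih h4
        obtain ⟨l', rfl⟩ := hr l h3
        exact ⟨l' :: w', rfl⟩
    obtain ⟨w', rfl⟩ := this
    simp only [← mw_map]
    exact ⟨_, .cons n' f w' h⟩

lemma Mono.scal (pu : N →+ ℕ) (θ : Ω → Ω) (t : K) (h : ∀ l ω, mat l (θ ω) = t ^ pu (cnt l) • mat l ω)
    (hD : ∀ d ∈ D, ∀ ω, d (θ ω) = d ω) {n f} (hf : Mono mat cnt D n f) (ω) : f (θ ω) = t ^ pu n * f ω := by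
  induction hf with
  | base d hd => simp [hD d hd]
  | cons n f w _ ih =>
    have : ∀ w, mw mat w (θ ω) = t ^ pu (cw cnt w) • mw mat w ω := by
      intro w
      induction w with
      | nil => simp [mw_nil, cw_nil]
      | cons l w ih => rw [mw_cons, mw_cons, ih, h, cw_cons, smul_mul_smul_comm, _root_.map_add, pow_add]
    simp only [ih, this, Matrix.trace_smul, smul_eq_mul, _root_.map_add, pow_add]
    ring
end monomaps
end O3

open Matrix MvPolynomial
namespace O3

section fftS
variable {K : Type} [Field K] {κ ι : Type}

/-- symmetric product -/
def smul3 (y z : Fin 3 → K) : Fin 6 → K := ![y 0 * z 0, 2⁻¹ * (y 0 * z 1 + y 1 * z 0), 2⁻¹ * (y 0 * z 2 + y 2 * z 0),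
  y 1 * z 1, 2⁻¹ * (y 1 * z 2 + y 2 * z 1), y 2 * z 2]
def crs (y z : Fin 3 → K) : Fin 3 → K := ![y 1 * z 2 - y 2 * z 1, y 2 * z 0 - y 0 * z 2, y 0 * z 1 - y 1 * z 0]

lemma vmv_eq (h2 : (2:K) ≠ 0) (y z : Fin 3 → K) : vecMulVec z y = s6 (smul3 y z) + (2:K)⁻¹ • hat (crs y z) := by
  ext i j
  fin_cases i <;> fin_cases j <;> simp [s6, smul3, hat, crs, vecMulVec_apply] <;> field_simp <;> ring

lemma crs_eq (h2 : (2:K) ≠ 0) (y z : Fin 3 → K) : vecMulVec (crs y z) (crs y z) =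
    (-4 : K) • (s6 (smul3 y z) * s6 (smul3 y z) - (s6 (smul3 y z)).trace • s6 (smul3 y z)
      + (2⁻¹ * ((s6 (smul3 y z)).trace * (s6 (smul3 y z)).trace - (s6 (smul3 y z) * s6 (smul3 y z)).trace)) • 1) := by
  ext i j
  fin_cases i <;> fin_cases j <;>
    simp [s6, smul3, crs, vecMulVec_apply, Matrix.mul_apply, Fin.sum_univ_three, Matrix.trace_fin_three] <;> field_simp <;> ring

lemma smul3_act (h2 : (2:K) ≠ 0) (g : M3 K) (y z : Fin 3 → K) : s6 (smul3 (g *ᵥ y) (g *ᵥ z)) = g * s6 (smul3 y z) * gᵀ := by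
  ext i j
  fin_cases i <;> fin_cases j <;>
    simp [s6, smul3, Matrix.mul_apply, Fin.sum_univ_three, Matrix.mulVec, dotProduct] <;> field_simp <;> ring

noncomputable def th2 (ρ : IdxS κ (Option (Option ι)) → K) : IdxS (Option κ) (Option ι) → K
  | .inl (none, c) => smul3 (xV ρ none) (xV ρ (some none)) c
  | .inl (some k, c) => ρ (.inl (k, c))
  | .inr (none, c) => crs (xV ρ none) (xV ρ (some none)) c
  | .inr (some i, c) => ρ (.inr (some (some i), c))

noncomputable def th (ρ : IdxS κ (Option (Option ι)) → K) : IdxS (Option κ) ι → K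
  | .inl (none, c) => smul3 (xV ρ none) (xV ρ (some none)) c
  | .inl (some k, c) => ρ (.inl (k, c))
  | .inr (i, c) => ρ (.inr (some (some i), c))

lemma th_pol (x) : (fun ρ : IdxS κ (Option (Option ι)) → K => th ρ x) ∈ Pol K (IdxS κ (Option (Option ι))) := by
  rcases x with ⟨_ | k, c⟩ | ⟨i, c⟩
  · have h : ∀ o c, (fun ρ : IdxS κ (Option (Option ι)) → K => xV ρ o c) ∈ Pol K (IdxS κ (Option (Option ι))) :=
      fun o c => Pol.coord _
    fin_cases c <;> first
      | exact Pol.mul (h _ _) (h _ _)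
      | exact Pol.mul (Pol.const _) (Pol.add (Pol.mul (h _ _) (h _ _)) (Pol.mul (h _ _) (h _ _)))
  · exact Pol.coord _
  · exact Pol.coord _

lemma th_act (h2 : (2:K) ≠ 0) (g : M3 K) (ρ : IdxS κ (Option (Option ι)) → K) : th (actS g ρ) = actS g (th ρ) := by
  apply envS_ext
  · intro k
    rw [sM_act]
    rcases k with _ | k
    · exact smul3_act h2 g _ _
    · exact sM_act g ρ k
  · intro i
    rfl

/-- letters -/
noncomputable def mat1 : (Option κ ⊕ Option ι) ⊕ Bool → (IdxS κ (Option (Option ι)) → K) → M3 K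
  | .inl l, ρ => mS l (th2 ρ)
  | .inr false, ρ => hat (xV ρ none)
  | .inr true, ρ => hat (xV ρ (some none))
def cnt1 : (Option κ ⊕ Option ι) ⊕ Bool → ℕ × ℕ
  | .inl _ => 0
  | .inr false => (1, 0)
  | .inr true => (0, 1)
def cnt0 : κ ⊕ Option (Option ι) → ℕ × ℕ
  | .inl _ => 0
  | .inr none => (1, 0)
  | .inr (some none) => (0, 1)
  | .inr (some (some _)) => 0
def r1 : κ ⊕ Option (Option ι) → (Option κ ⊕ Option ι) ⊕ Bool
  | .inl k => .inl (.inl (some k))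
  | .inr none => .inr false
  | .inr (some none) => .inr true
  | .inr (some (some i)) => .inl (.inr (some i))
def cnt2 : Option κ ⊕ Option ι → ℕ
  | .inr none => 1
  | _ => 0
def r2 : Option κ ⊕ ι → Option κ ⊕ Option ι
  | .inl k => .inl k
  | .inr i => .inr (some i)

def Dd (K κ ι : Type) [Field K] : Submonoid ((IdxS κ ι → K) → K) := Submonoid.closure (Set.range dS)

lemma GS_span {N : Type} [AddCommMonoid N] (cnt : κ ⊕ ι → N) {f} (hf : f ∈ GS K κ ι) :
    f ∈ Submodule.span K {x | ∃ n, Mono mS cnt (Dd K κ ι) n x} := by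
  rw [← Subalgebra.mem_toSubmodule, GS, Algebra.adjoin_eq_span] at hf
  refine Submodule.span_mono ?_ hf
  intro x hx
  induction hx using Submonoid.closure_induction with
  | mem x hx =>
    rcases hx with ⟨w, rfl⟩ | h
    · exact ⟨_, Mono.tr w⟩
    · exact ⟨0, .base x (Submonoid.subset_closure h)⟩
  | one => exact ⟨0, .one⟩
  | mul x y _ _ hx hy =>
    obtain ⟨n, hn⟩ := hx
    obtain ⟨m, hm⟩ := hy
    exact ⟨_, hn.mul hm⟩

lemma mat1_tp (l) : ∃ ε : K, ∀ ρ : IdxS κ (Option (Option ι)) → K, (mat1 l ρ)ᵀ = ε • mat1 l ρ := by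
  rcases l with l | (_ | _)
  · obtain ⟨ε, h⟩ := mS_tp (K := K) l
    exact ⟨ε, fun ρ => h _⟩
  · exact ⟨-1, fun ρ => hat_tp _⟩
  · exact ⟨-1, fun ρ => hat_tp _⟩

lemma TM_let {Ω L N : Type} [AddCommMonoid N] {mat : L → Ω → M3 K} {cnt : L → N} {D : Submonoid (Ω → K)} (l : L)
    (h : cnt l = 0) : mat l ∈ TM mat cnt D 0 := by
  have := TM_word (mat := mat) (cnt := cnt) (D := D) [l]
  rw [cw_cons, cw_nil, h, add_zero] at this
  convert this using 1
  ext1 ω; simp [mw_cons, mw_nil]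

lemma TM_crs {Ω L N : Type} [AddCommMonoid N] {mat : L → Ω → M3 K} {cnt : L → N} {D : Submonoid (Ω → K)} (l : L)
    (h : cnt l = 0) (h2 : (2:K) ≠ 0) (y z : Ω → Fin 3 → K) (hl : ∀ ω, mat l ω = s6 (smul3 (y ω) (z ω))) :
    (fun ω => vecMulVec (crs (y ω) (z ω)) (crs (y ω) (z ω))) ∈ TM mat cnt D 0 := by
  have h1 : mat l ∈ TM mat cnt D 0 := TM_let l h
  have h3 := TM_tr h1
  have h4 := TM_mul h1 h1
  have h5 := TM_mul (TM_sc h3) h1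
  have h6 := TM_sc (GG_mul h3 h3)
  have h7 := TM_sc (TM_tr h4)
  have h8 := Submodule.smul_mem _ (-4:K) (add_mem (sub_mem h4 h5) (Submodule.smul_mem _ (2:K)⁻¹ (sub_mem h6 h7)))
  rw [add_zero] at h8
  convert h8 using 1
  ext1 ω
  rw [crs_eq h2]
  simp only [Pi.smul_apply, Pi.add_apply, Pi.sub_apply, Pi.mul_apply, scL, trL, LinearMap.coe_mk, AddHom.coe_mk, hl,
    smul_mul_assoc, one_mul, ← sub_smul, smul_smul]

lemma contr1 (h2 : (2:K) ≠ 0) (D) (m : ℕ) : GG (mat1 (K := K) (κ := κ) (ι := ι)) cnt1 D (m, m) ≤ GG mat1 cnt1 D 0 := by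
  have hZ : (fun ρ => vecMulVec (xV ρ (some none)) (xV ρ none)) ∈ TM (mat1 (K := K) (κ := κ) (ι := ι)) cnt1 D 0 := by
    have h4 := add_mem (TM_let (mat := mat1 (K := K) (κ := κ) (ι := ι)) (cnt := cnt1) (D := D) (.inl (.inl none)) rfl)
      (Submodule.smul_mem _ (2:K)⁻¹ (TM_let (mat := mat1) (cnt := cnt1) (D := D) (.inl (.inr none)) rfl))
    convert h4 using 1
    ext1 ρ
    rw [vmv_eq h2]
    rfl
  induction m with
  | zero => exact le_rfl
  | succ m ih =>
    refine le_trans ?_ ih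
    apply Submodule.span_le.2
    intro f hf
    have e : ((m + 1, m + 1) : ℕ × ℕ) = (m, m) + cnt1 (κ := κ) (ι := ι) (.inr false) + cnt1 (κ := κ) (ι := ι) (.inr true) := by
      simp [cnt1]
    have hf' : Mono mat1 cnt1 D _ f := hf
    rw [e] at hf'
    refine Mono.contract h2 mat1_tp (u := .inr false) (u' := .inr true) (AddMonoidHom.fst ℕ ℕ) (AddMonoidHom.snd ℕ ℕ) ?_ ?_
      (fun ρ => xV ρ none) (fun ρ => xV ρ (some none)) (fun _ => rfl) (fun _ => rfl) hZ hf' ?_ ?_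
    · rintro (l | _ | _) hl <;> first | rfl | exact absurd rfl hl
    · rintro (l | _ | _) hl <;> first | rfl | exact absurd rfl hl
    · simp [cnt1]
    · simp [cnt1]

noncomputable def mat2 (l : Option κ ⊕ Option ι) (ρ : IdxS κ (Option (Option ι)) → K) : M3 K := mS l (th2 ρ)

lemma contr2 (h2 : (2:K) ≠ 0) (D) (m : ℕ) : GG (mat2 (K := K) (κ := κ) (ι := ι)) cnt2 D (m + m) ≤ GG mat2 cnt2 D 0 := by
  have hZ := TM_crs (mat := mat2 (K := K) (κ := κ) (ι := ι)) (cnt := cnt2) (D := D) (.inl none) rfl h2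
    (fun ρ => xV ρ none) (fun ρ => xV ρ (some none)) (fun _ => rfl)
  induction m with
  | zero => exact le_rfl
  | succ m ih =>
    refine le_trans ?_ ih
    apply Submodule.span_le.2
    intro f hf
    have e : m + 1 + (m + 1) = (m + m) + cnt2 (κ := κ) (ι := ι) (.inr none) + cnt2 (κ := κ) (ι := ι) (.inr none) := by
      simp [cnt2]; omega
    have hf' : Mono mat2 cnt2 D _ f := hf
    rw [e] at hf'
    refine Mono.contract h2 (fun l => ?_) (u := .inr none) (u' := .inr none) (AddMonoidHom.id ℕ) (AddMonoidHom.id ℕ) ?_ ?_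
      (fun ρ => crs (xV ρ none) (xV ρ (some none))) (fun ρ => crs (xV ρ none) (xV ρ (some none))) (fun _ => rfl) (fun _ => rfl) hZ hf' ?_ ?_
    · obtain ⟨ε, h⟩ := mS_tp (K := K) l
      exact ⟨ε, fun ρ => h _⟩
    · rintro (l | _ | _) hl <;> first | rfl | exact absurd rfl hl
    · rintro (l | _ | _) hl <;> first | rfl | exact absurd rfl hl
    · simp [cnt2]
    · simp [cnt2]
end fftS
end O3

open Matrix MvPolynomial
namespace O3

section fftS2
variable {K : Type} [Field K] {κ ι : Type}

def wa : Option (Option ι) → ℕ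
  | none => 1
  | some _ => 0
def wb : Option (Option ι) → ℕ
  | some none => 1
  | _ => 0

lemma Dd_inv {θ : (IdxS κ ι → K) → (IdxS κ ι → K)} (hθ : ∀ k ρ, sM (θ ρ) k = sM ρ k) :
    ∀ d ∈ Dd K κ ι, ∀ ω, d (θ ω) = d ω := by
  intro d hd ω
  induction hd using Submonoid.closure_induction with
  | mem x hx => obtain ⟨k, rfl⟩ := hx; simp [dS, hθ]
  | one => rfl
  | mul x y _ _ hx hy => simp [hx, hy]

def swp (ρ : IdxS κ (Option (Option ι)) → K) : IdxS κ (Option (Option ι)) → K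
  | .inr (none, c) => ρ (.inr (some none, c))
  | .inr (some none, c) => ρ (.inr (none, c))
  | x => ρ x

lemma th2_swp (l : Option κ ⊕ Option ι) (ρ : IdxS κ (Option (Option ι)) → K) : mat2 l (swp ρ) = (-1 : K) ^ cnt2 l • mat2 l ρ := by
  rcases l with (_ | k) | (_ | i)
  · simp only [cnt2, pow_zero, one_smul]
    change s6 (smul3 (xV ρ (some none)) (xV ρ none)) = s6 (smul3 (xV ρ none) (xV ρ (some none)))
    congr 1
    simp [smul3, mul_comm, add_comm]
  · simp only [cnt2, pow_zero, one_smul]; rfl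
  · simp only [cnt2, pow_one]
    change hat (crs (xV ρ (some none)) (xV ρ none)) = (-1:K) • hat (crs (xV ρ none) (xV ρ (some none)))
    rw [← hat_smul]
    congr 1
    simp [crs]
    refine ⟨?_, ?_, ?_⟩ <;> ring
  · simp only [cnt2, pow_zero, one_smul]; rfl

lemma fS_desc [Infinite K] (h2 : (2:K) ≠ 0) {f' : (IdxS κ (Option (Option ι)) → K) → K}
    (hf : f' ∈ GS K κ (Option (Option ι))) {m : ℕ}
    (ha : f' ∈ Wt K (wS 0 wa) m) (hb : f' ∈ Wt K (wS 0 wb) m) (hs : ∀ ρ, f' (swp ρ) = f' ρ) :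
    ∃ g ∈ GS K (Option κ) ι, pb th g = f' := by
  set D := Dd K κ (Option (Option ι)) with hD
  let X := {p : (ℕ × ℕ) × ((IdxS κ (Option (Option ι)) → K) → K) // Mono mS cnt0 D p.1 p.2}
  have h1 : f' ∈ Submodule.span K ((fun x : X => x.1.2) '' Set.univ) := by
    refine Submodule.span_mono ?_ (GS_span cnt0 hf)
    rintro x ⟨n, hx⟩
    exact ⟨⟨(n, x), hx⟩, trivial, rfl⟩
  have hDw : ∀ (w : Option (Option ι) → ℕ) (t : K), ∀ d ∈ D, ∀ ω, d (scal (wS 0 w) t ω) = d ω := by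
    intro w t
    exact Dd_inv fun k ρ => by simp [sM_sw]
  have h3 := span_wt (wS 0 wa) (fun x : X => x.1.2) (fun x => x.1.1.1) (by
    rintro ⟨⟨n, x⟩, hx⟩ t _ ρ
    refine hx.scal (AddMonoidHom.fst ℕ ℕ) (scal (wS 0 wa) t) t (fun l ω => ?_) (hDw _ _) ρ
    rw [mS_sw]
    rcases l with _ | _ | _ | _ <;> rfl) _ h1 ha
  have h4 := span_wt (wS 0 wb) (fun x : X => x.1.2) (fun x => x.1.1.2) (by
    rintro ⟨⟨n, x⟩, hx⟩ t _ ρ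
    refine hx.scal (AddMonoidHom.snd ℕ ℕ) (scal (wS 0 wb) t) t (fun l ω => ?_) (hDw _ _) ρ
    rw [mS_sw]
    rcases l with _ | _ | _ | _ <;> rfl) _ h3 hb
  have h5 : f' ∈ GG (mat1 (K := K) (κ := κ) (ι := ι)) cnt1 D (m, m) := by
    refine Submodule.span_le.2 ?_ h4
    rintro _ ⟨⟨⟨⟨a, b⟩, x⟩, hx⟩, ⟨⟨_, ea⟩, eb⟩, rfl⟩
    apply Submodule.subset_span
    dsimp only at ea eb hx ⊢
    subst ea eb
    refine Mono.map r1 (fun l ω => ?_) (fun l => ?_) hx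
    · rcases l with _ | _ | _ | _ <;> rfl
    · rcases l with _ | _ | _ | _ <;> rfl
  have h6 := contr1 h2 D m h5
  have h7 : f' ∈ Submodule.span K {x | ∃ n, Mono (mat2 (K := K) (κ := κ) (ι := ι)) cnt2 D n x} := by
    refine Submodule.span_mono ?_ h6
    intro x hx
    refine Mono.zero (fun a b h => ?_) (L' := Option κ ⊕ Option ι) Sum.inl ?_ cnt2 hx rfl
    · rcases a with ⟨a, a'⟩; rcases b with ⟨b, b'⟩
      simp only [Prod.mk_add_mk, Prod.mk_eq_zero] at h ⊢
      omega
    · rintro (l | _ | _) hl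
      · exact ⟨l, rfl⟩
      · simp [cnt1] at hl
      · simp [cnt1] at hl
  have h8 : f' ∈ GG (mat2 (K := K) (κ := κ) (ι := ι)) cnt2 D 0 := by
    have e : (2:K)⁻¹ • (LinearMap.id + (pb swp).toLinearMap : _ →ₗ[K] _) f' = f' := by
      ext ρ
      simp only [Pi.smul_apply, LinearMap.add_apply, LinearMap.id_apply, AlgHom.toLinearMap_apply, Pi.add_apply, pb_apply, hs]
      simp; field_simp; ring
    rw [← e]
    apply Submodule.smul_mem
    refine span_lin _ ?_ h7
    rintro x ⟨n, hx⟩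
    have hsc := hx.scal (AddMonoidHom.id ℕ) swp (-1) th2_swp (Dd_inv fun k ρ => rfl)
    rcases Nat.even_or_odd n with hn | hn
    · have : (LinearMap.id + (pb swp).toLinearMap : _ →ₗ[K] _) x = (2:K) • x := by
        ext ρ
        simp [hsc, hn.neg_one_pow]; ring
      rw [this]
      obtain ⟨j, rfl⟩ := hn
      exact Submodule.smul_mem _ _ (contr2 h2 D j (Submodule.subset_span hx))
    · have : (LinearMap.id + (pb swp).toLinearMap : _ →ₗ[K] _) x = 0 := by
        ext ρ
        simp [hsc, hn.neg_one_pow]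
      rw [this]
      exact zero_mem _
  have h9 : f' ∈ ((GS K (Option κ) ι).map (pb th)).toSubmodule := by
    refine Submodule.span_le.2 ?_ h8
    intro x hx
    have hx' : Mono mat2 cnt2 D 0 x := hx
    obtain ⟨n', hn'⟩ := Mono.zero (fun a b h => by omega) (L' := Option κ ⊕ ι) r2 (by
      rintro (l | _ | l) hl
      · exact ⟨.inl l, rfl⟩
      · simp [cnt2] at hl
      · exact ⟨.inr l, rfl⟩) (fun _ => (0 : ℕ)) hx' rfl
    change x ∈ (GS K (Option κ) ι).map (pb th)
    clear hx hx'
    induction hn' with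
    | base d hd =>
      induction hd using Submonoid.closure_induction with
      | mem x hx => obtain ⟨k, rfl⟩ := hx; exact ⟨_, GS_det (some k), rfl⟩
      | one => exact one_mem _
      | mul x y _ _ hx hy => exact mul_mem hx hy
    | cons n f w _ ih =>
      refine mul_mem ih ⟨_, GS_tr w, ?_⟩
      ext ρ
      change (mw mS w (th ρ)).trace = _
      congr 1
      simp only [mw]
      congr 1
      apply List.map_congr_left
      rintro ((_ | _) | _) _ <;> rfl
  exact h9

lemma fftS_step [Infinite K] (h2 : (2:K) ≠ 0)
    (ih : ∀ f ∈ GoodS K κ (Option (Option ι)), f ∈ GS K κ (Option (Option ι))) :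
    ∀ f ∈ GoodS K (Option κ) ι, f ∈ GS K (Option κ) ι := by
  let w1 : Option κ → ℕ := fun o => o.elim 1 (fun _ => 0)
  let w2 : IdxS (Option κ) ι → ℕ := wS w1 0
  have hth : ∀ w : Option (Option ι) → ℕ, w none + w (some none) = 1 → (∀ i, w (some (some i)) = 0) → ∀ (t : K) ρ,
      th (scal (wS 0 w) t ρ) = scal w2 t (th ρ : IdxS (Option κ) ι → K) := by
    intro w hw hw' t ρ
    ext x
    rcases x with ⟨_ | k, c⟩ | ⟨i, c⟩
    · change smul3 (xV (scal (wS 0 w) t ρ) none) (xV (scal (wS 0 w) t ρ) (some none)) c = t ^ 1 * smul3 (xV ρ none) (xV ρ (some none)) c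
      rw [xV_sw, xV_sw, ← hw, pow_add]
      fin_cases c <;> simp [smul3] <;> ring
    · simp [th, scal, w2, w1, wS]
    · simp [th, scal, w2, w1, wS, hw']
  have main : ∀ m, ∀ f ∈ GoodS K (Option κ) ι, f ∈ Wt K w2 m → f ∈ (GS K (Option κ) ι).toSubmodule := by
    intro m
    induction m using Nat.strong_induction_on with
    | _ m ihm =>
    intro f hf hw
    have hf' : pb th f ∈ GS K κ (Option (Option ι)) := by
      refine ih _ ⟨Pol.comp th_pol hf.1, fun g hg hd ρ => ?_⟩
      simp only [pb_apply]
      rw [th_act h2, hf.2 g hg hd]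
    have hwt : ∀ w : Option (Option ι) → ℕ, w none + w (some none) = 1 → (∀ i, w (some (some i)) = 0) →
        pb th f ∈ Wt K (wS 0 w) m := by
      intro w h h' t ht ρ
      simp only [pb_apply]
      rw [hth w h h', hw t ht]
    obtain ⟨g0, hg0, e0⟩ := fS_desc h2 hf' (hwt wa rfl fun _ => rfl) (hwt wb rfl fun _ => rfl) (by
      intro ρ
      simp only [pb_apply]
      congr 1
      ext x
      rcases x with ⟨_ | k, c⟩ | ⟨i, c⟩
      · change smul3 (xV ρ (some none)) (xV ρ none) c = smul3 (xV ρ none) (xV ρ (some none)) c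
        refine congrFun ?_ c
        simp [smul3, mul_comm, add_comm]
      · rfl
      · rfl)
    have hg0w : pb th g0 ∈ Wt K (wS 0 wa) m := by rw [e0]; exact hwt wa rfl fun _ => rfl
    obtain ⟨g, g2, g3, g4⟩ := right_comp w2 (GS_pol hg0) (wS 0 wa) th (fun t _ => hth wa rfl (fun _ => rfl) t) m hg0w
    have g1 : g ∈ GS K (Option κ) ι := g4 (GS K (Option κ) ι).toSubmodule (fun t _ h hh => GS_scal _ _ t hh) hg0
    have hfg : f - g ∈ GoodS K (Option κ) ι := sub_mem hf (GS_good g1)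
    have hfgw : f - g ∈ Wt K w2 m := sub_mem hw g2
    let v : Fin 6 → IdxS (Option κ) ι := fun c => .inl (none, c)
    have hvi : Function.Injective v := fun a b h => by simpa [v] using h
    obtain ⟨h, h1, h3⟩ := fun_div (q := dS none)
      ((X (v 3) * X (v 5) - X (v 4) ^ 2) * X (v 0) - (X (v 1) ^ 2 * X (v 5) - 2 * X (v 1) * X (v 2) * X (v 4) + X (v 2) ^ 2 * X (v 3)))
      (by
        intro ρ
        rw [dS, Matrix.det_fin_three]
        simp [sM, s6, v]
        ring) hfg.1 (by
        intro P hP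
        apply div_det (a := v 0) (b := v 1) (c := v 2) (e := v 3) (f := v 4) (g := v 5) (by
          have : ([0,1,2,3,4,5] : List (Fin 6)).Nodup := by decide
          exact (List.nodup_map_iff hvi).2 this) h2
        intro ρ y1 y2 y3 z1 z2 z3 e1 e2 e3 e4 e5 e6
        let ρ0 : IdxS κ (Option (Option ι)) → K
          | .inl (k, c) => ρ (.inl (some k, c))
          | .inr (none, c) => ![y1, y2, y3] c
          | .inr (some none, c) => ![z1, z2, z3] c
          | .inr (some (some i), c) => ρ (.inr (i, c))
        have : ρ = th ρ0 := by
          ext x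
          rcases x with ⟨_ | k, c⟩ | ⟨i, c⟩
          · have hs : ∀ a b : K, 2 * a = b → a = 2⁻¹ * b := by intro a b h; rw [← h]; field_simp
            change ρ (v c) = smul3 ![y1, y2, y3] ![z1, z2, z3] c
            fin_cases c
            · exact e1
            · exact hs _ _ e2
            · exact hs _ _ e3
            · exact e4
            · exact hs _ _ e5
            · exact e6
          · rfl
          · rfl
        rw [hP, this]
        have := congrFun (g3.trans e0) ρ0
        simp only [pb_apply] at this
        simp [this])
    have hdg := GS_good (GS_det (K := K) (κ := Option κ) (ι := ι) none)
    have hq0 : (dS none : (IdxS (Option κ) ι → K) → K) ≠ 0 := by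
      intro h
      have := congrFun h (Sum.elim (fun p => ![1,0,0,1,0,1] p.2) 0)
      simp [dS, Matrix.det_fin_three, sM, s6] at this
    have hdw : (dS none : (IdxS (Option κ) ι → K) → K) ∈ Wt K w2 3 := by
      intro t _ ρ
      simp [w2, dS_sw, w1]
    have hinv := quot_invS hdg.1 h1 hq0 h3 hfg.2 hdg.2
    have hfin := quot_wt hdg.1 h1 hq0 h3 hfgw hdw
    have key : f - g ∈ GS K (Option κ) ι → f ∈ (GS K (Option κ) ι).toSubmodule := by
      intro h
      have := add_mem h g1
      simpa using this
    apply key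
    rcases hfin with h0 | ⟨hle, hw'⟩
    · rw [h0]; exact zero_mem _
    · have e : f - g = dS none * h := by ext ρ; exact h3 ρ
      rw [e]
      exact mul_mem (GS_det none) (ihm (m - 3) (by omega) h ⟨h1, hinv⟩ hw')
  intro f hf
  exact mem_of_comps w2 (GS K (Option κ) ι).toSubmodule (GoodS K (Option κ) ι) (fun _ h => h.1)
    (fun t _ h hh => GoodS_scal _ _ t hh) hf (fun n g hg hgn => main n g hg hgn)

lemma fftS_of_base [Infinite K] (h2 : (2:K) ≠ 0)
    (hb : ∀ (ι : Type) [Finite ι], ∀ f ∈ GoodS K PEmpty ι, f ∈ GS K PEmpty ι) (κ : Type) [Finite κ] :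
    ∀ (ι : Type) [Finite ι], ∀ f ∈ GoodS K κ ι, f ∈ GS K κ ι := by
  apply Finite.induction_empty_option (P := fun κ : Type => ∀ (ι : Type) [Finite ι], ∀ f ∈ GoodS K κ ι, f ∈ GS K κ ι)
  · intro α β e ih ν _ f hf
    let θ : (IdxS α ν → K) → (IdxS β ν → K) := fun ρ => Sum.elim (fun p => ρ (.inl (e.symm p.1, p.2))) (fun p => ρ (.inr p))
    let θ' : (IdxS β ν → K) → (IdxS α ν → K) := fun ρ => Sum.elim (fun p => ρ (.inl (e p.1, p.2))) (fun p => ρ (.inr p))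
    have h1 : pb θ f ∈ GoodS K α ν := by
      refine ⟨Pol.comp ?_ hf.1, fun h hh hd ρ => hf.2 h hh hd (θ ρ)⟩
      rintro (x | x) <;> exact Pol.coord _
    have h2 := ih ν _ h1
    have h3 : f = pb θ' (pb θ f) := by
      ext ρ
      simp only [pb_apply]
      congr 1
      ext x
      rcases x with x | x <;> simp [θ, θ']
    rw [h3]
    refine GS_pull (θ := θ') (fun _ => 1) (Sum.map e id) (fun ρ i => ?_) (fun k => GS_det (e k)) h2
    rw [one_smul]
    rcases i with _ | _ <;> rfl
  · exact hb
  · intro α _ ih ν _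
    exact fftS_step h2 (ih (Option (Option ν)))
end fftS2
end O3

open Matrix MvPolynomial
namespace O3

section base
variable {K : Type} [Field K] {ι : Type}

def tM (K : Type) [Field K] : M3 K := !![1,0,-1; 1,1,1; 1,-1,1]
def tI (K : Type) [Field K] : M3 K := !![-1,1,1; 0,-1,1; 1,1,1]
def fB (K : Type) [Field K] : M3 K := !![0,0,1; 0,2,0; 1,0,0]
def adM (h : Matrix (Fin 2) (Fin 2) K) : M3 K := !![h 0 0 ^ 2, -2 * h 0 0 * h 0 1, - h 0 1 ^ 2;
  - h 0 0 * h 1 0, h 0 0 * h 1 1 + h 0 1 * h 1 0, h 0 1 * h 1 1; - h 1 0 ^ 2, 2 * h 1 0 * h 1 1, h 1 1 ^ 2]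

lemma tMI (h3 : (3:K) = 0) : tM K * tI K = 1 := by
  ext i j
  fin_cases i <;> fin_cases j <;> simp [tM, tI, Matrix.mul_apply, Fin.sum_univ_three] <;>
    first | ring1 | linear_combination h3 | linear_combination -h3
lemma tMM (h3 : (3:K) = 0) : (tM K)ᵀ * tM K = fB K := by
  ext i j
  fin_cases i <;> fin_cases j <;> simp [tM, fB, Matrix.mul_apply, Fin.sum_univ_three] <;>
    first | ring1 | linear_combination h3 | linear_combination -h3
lemma adM_B (h : Matrix (Fin 2) (Fin 2) K) : (adM h)ᵀ * fB K * adM h = h.det ^ 2 • fB K := by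
  rw [Matrix.det_fin_two]
  ext i j
  fin_cases i <;> fin_cases j <;> simp [adM, fB, Matrix.mul_apply, Fin.sum_univ_three] <;> ring
lemma adM_det (h : Matrix (Fin 2) (Fin 2) K) : (adM h).det = h.det ^ 3 := by
  rw [Matrix.det_fin_two, Matrix.det_fin_three]
  simp [adM]; ring

lemma orth (h3 : (3:K) = 0) (h : Matrix (Fin 2) (Fin 2) K) (hd : h.det = 1) :
    (tM K * adM h * tI K)ᵀ * (tM K * adM h * tI K) = 1 ∧ (tM K * adM h * tI K).det = 1 := by
  constructor
  · calc _ = (tI K)ᵀ * ((adM h)ᵀ * ((tM K)ᵀ * tM K) * adM h) * tI K := by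
          simp only [Matrix.transpose_mul, Matrix.mul_assoc]
      _ = (tM K * tI K)ᵀ * (tM K * tI K) := by
          rw [tMM h3, adM_B, hd, one_pow, one_smul, ← tMM h3]
          simp only [Matrix.transpose_mul, Matrix.mul_assoc]
      _ = 1 := by rw [tMI h3]; simp
  · have := congrArg Matrix.det (tMI h3)
    rw [Matrix.det_mul, Matrix.det_one] at this
    rw [Matrix.det_mul, Matrix.det_mul, adM_det, hd]
    linear_combination this

def Phi (ρ : Idx2 ι PEmpty → K) : IdxS PEmpty ι → K :=
  Sum.elim (fun p => p.1.elim) (fun p => (tM K *ᵥ fun c => ρ (.inl (p.1, c))) p.2)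
def Psi (ρ : IdxS PEmpty ι → K) : Idx2 ι PEmpty → K :=
  Sum.elim (fun p => (tI K *ᵥ xV ρ p.1) p.2) (fun p => p.1.elim)

lemma act2_ad (h : Matrix (Fin 2) (Fin 2) K) (ρ : Idx2 ι PEmpty → K) (i : ι) :
    (fun c => act2 h ρ (.inl (i, c))) = adM h *ᵥ fun c => ρ (.inl (i, c)) := by
  ext c
  fin_cases c <;> simp [act2, adM, mV, Matrix.adjugate_fin_two, Matrix.mul_apply, Fin.sum_univ_two, Matrix.mulVec,
    dotProduct, Fin.sum_univ_three] <;> ring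

lemma Phi_act (h3 : (3:K) = 0) (h : Matrix (Fin 2) (Fin 2) K) (ρ : Idx2 ι PEmpty → K) :
    Phi (act2 h ρ) = actS (tM K * adM h * tI K) (Phi ρ) := by
  have h4 : tI K * tM K = 1 := mul_eq_one_comm.1 (tMI h3)
  apply envS_ext
  · rintro ⟨⟩
  · intro i
    rw [xV_act]
    change tM K *ᵥ (fun c => act2 h ρ (.inl (i, c))) = (tM K * adM h * tI K) *ᵥ (tM K *ᵥ fun c => ρ (.inl (i, c)))
    rw [act2_ad, Matrix.mulVec_mulVec, Matrix.mulVec_mulVec, Matrix.mul_assoc, h4, Matrix.mul_one]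

lemma Phi_Psi (h3 : (3:K) = 0) (ρ : IdxS PEmpty ι → K) : Phi (Psi ρ) = ρ := by
  apply envS_ext
  · rintro ⟨⟩
  · intro i
    change tM K *ᵥ (tI K *ᵥ xV ρ i) = xV ρ i
    rw [Matrix.mulVec_mulVec, tMI h3, Matrix.one_mulVec]

def mP (i : ι) (ρ : IdxS PEmpty ι → K) : Matrix (Fin 2) (Fin 2) K := mV (Psi ρ) i

lemma mP_eq (i : ι) (ρ : IdxS PEmpty ι → K) : mP i ρ = !![-xV ρ i 1 + xV ρ i 2, -xV ρ i 0 + xV ρ i 1 + xV ρ i 2;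
    xV ρ i 0 + xV ρ i 1 + xV ρ i 2, xV ρ i 1 - xV ρ i 2] := by
  ext a b
  fin_cases a <;> fin_cases b <;> simp [mP, mV, Psi, tI, Matrix.mulVec, dotProduct, Fin.sum_univ_three] <;> ring

lemma mP_tr (i : ι) (ρ : IdxS PEmpty ι → K) : (mP i ρ).trace = 0 := by
  rw [mP_eq, Matrix.trace_fin_two_of]; ring

lemma mP_tr2 (h3 : (3:K) = 0) (i j : ι) :
    (fun ρ => (mP i ρ * mP j ρ).trace) ∈ GS K PEmpty ι := by
  convert GS_tr (K := K) (κ := PEmpty) [.inr i, .inr j] using 1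
  ext ρ
  simp only [mw_cons, mw_nil, mS, mul_one, mP_eq]
  generalize xV ρ i = x; generalize xV ρ j = y
  simp [hat, Matrix.mul_apply, Fin.sum_univ_three, Fin.sum_univ_two, Matrix.trace_fin_three, Matrix.trace_fin_two]
  linear_combination (x 0 * y 1 * 0 + x 1 * y 1 * 2 + x 2 * y 2 * 2) * h3

lemma mP_tr3 (h3 : (3:K) = 0) (i j k : ι) :
    (fun ρ => (mP i ρ * mP j ρ * mP k ρ).trace) ∈ GS K PEmpty ι := by
  convert GS_tr (K := K) (κ := PEmpty) [.inr i, .inr j, .inr k] using 1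
  ext ρ
  simp only [mw_cons, mw_nil, mS, mul_one, mP_eq]
  generalize xV ρ i = x; generalize xV ρ j = y; generalize xV ρ k = z
  simp [hat, Matrix.mul_apply, Fin.sum_univ_three, Fin.sum_univ_two, Matrix.trace_fin_three, Matrix.trace_fin_two]
  linear_combination -(x 0 * (y 1 * z 2 - y 2 * z 1) - x 1 * (y 0 * z 2 - y 2 * z 0) + x 2 * (y 0 * z 1 - y 1 * z 0)) * h3

lemma mP_rel (h2 : (2:K) ≠ 0) (i j k : ι) (V : Matrix (Fin 2) (Fin 2) K) (ρ : IdxS PEmpty ι → K) :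
    (V * mP i ρ * mP j ρ * mP k ρ).trace = 2⁻¹ * ((mP i ρ * mP j ρ).trace * (V * mP k ρ).trace
      - (mP i ρ * mP k ρ).trace * (V * mP j ρ).trace + (mP j ρ * mP k ρ).trace * (V * mP i ρ).trace
      + (mP i ρ * mP j ρ * mP k ρ).trace * V.trace) := by
  simp only [mP_eq]
  generalize xV ρ i = x; generalize xV ρ j = y; generalize xV ρ k = z
  simp [Matrix.mul_apply, Fin.sum_univ_two, Matrix.trace_fin_two]
  field_simp
  ring

def PP (U : (IdxS PEmpty ι → K) → Matrix (Fin 2) (Fin 2) K) : Prop :=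
  (fun ρ => (U ρ).trace) ∈ GS K PEmpty ι ∧ (∀ k, (fun ρ => (U ρ * mP k ρ).trace) ∈ GS K PEmpty ι) ∧
    ∀ k l, (fun ρ => (U ρ * mP k ρ * mP l ρ).trace) ∈ GS K PEmpty ι

lemma PP_add {U V : (IdxS PEmpty ι → K) → Matrix (Fin 2) (Fin 2) K} (hU : PP U) (hV : PP V) : PP (U + V) := by
  refine ⟨?_, fun k => ?_, fun k l => ?_⟩
  · convert add_mem hU.1 hV.1 using 1; ext ρ; simp
  · convert add_mem (hU.2.1 k) (hV.2.1 k) using 1; ext ρ; simp [add_mul]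
  · convert add_mem (hU.2.2 k l) (hV.2.2 k l) using 1; ext ρ; simp [add_mul]

lemma PP_smul {U : (IdxS PEmpty ι → K) → Matrix (Fin 2) (Fin 2) K} (c : K) (hU : PP U) : PP (c • U) := by
  refine ⟨?_, fun k => ?_, fun k l => ?_⟩
  · convert Subalgebra.smul_mem _ hU.1 c using 1; ext ρ; simp
  · convert Subalgebra.smul_mem _ (hU.2.1 k) c using 1; ext ρ; simp
  · convert Subalgebra.smul_mem _ (hU.2.2 k l) c using 1; ext ρ; simp

lemma PP_mP (h2 : (2:K) ≠ 0) (h3 : (3:K) = 0) {V : (IdxS PEmpty ι → K) → Matrix (Fin 2) (Fin 2) K} (i) (hV : PP V) :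
    PP (fun ρ => V ρ * mP i ρ) := by
  refine ⟨hV.2.1 i, hV.2.2 i, fun k l => ?_⟩
  have := Subalgebra.smul_mem _ (add_mem (add_mem (sub_mem (mul_mem (mP_tr2 h3 i k) (hV.2.1 l)) (mul_mem (mP_tr2 h3 i l) (hV.2.1 k)))
    (mul_mem (mP_tr2 h3 k l) (hV.2.1 i))) (mul_mem (mP_tr3 h3 i k l) hV.1)) (2:K)⁻¹
  convert this using 1
  ext ρ
  rw [mP_rel h2]
  rfl

lemma fftS_base [Infinite K] (h2 : (2:K) ≠ 0) (h3 : (3:K) = 0) (ι : Type) [Finite ι] :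
    ∀ f ∈ GoodS K PEmpty ι, f ∈ GS K PEmpty ι := by
  intro f hf
  have h1 : pb Phi f ∈ Good2 K ι PEmpty := by
    refine ⟨Pol.comp ?_ hf.1, fun h hh ρ => ?_⟩
    · rintro (⟨⟨⟩, _⟩ | ⟨i, c⟩)
      change (fun ρ : Idx2 ι PEmpty → K => ∑ b, tM K c b * ρ (.inl (i, b))) ∈ _
      exact Pol.sum _ fun b => Pol.mul (Pol.const _) (Pol.coord _)
    · simp only [pb_apply]
      rw [Phi_act h3]
      exact hf.2 _ (orth h3 h hh).1 (orth h3 h hh).2 _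
  have h4 := fftV h2 ι PEmpty _ h1
  have h5 : G2 K ι PEmpty ≤ (GS K PEmpty ι).comap (pb Psi) := by
    apply Algebra.adjoin_le
    rintro _ (⟨U, hU, rfl⟩ | ⟨U, hU, a, _⟩)
    · have key : ∀ V : (IdxS PEmpty ι → K) → Matrix (Fin 2) (Fin 2) K, PP V → PP (fun ρ => V ρ * U (Psi ρ)) := by
        induction hU using Algebra.adjoin_induction with
        | mem x hx =>
          obtain ⟨i, rfl⟩ := hx
          intro V hV
          exact PP_mP h2 h3 i hV
        | algebraMap r =>
          intro V hV
          convert PP_smul r hV using 1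
          ext1 ρ
          simp [Algebra.algebraMap_eq_smul_one]
        | add x y _ _ hx hy =>
          intro V hV
          convert PP_add (hx V hV) (hy V hV) using 1
          ext1 ρ
          simp [mul_add]
        | mul x y _ _ hx hy =>
          intro V hV
          convert hy _ (hx V hV) using 1
          ext1 ρ
          simp [mul_assoc]
      have := (key (fun _ => 1) ⟨?_, fun k => ?_, fun k l => ?_⟩).1
      · simp only [one_mul] at this; exact this
      · exact algebraMap_mem (GS K PEmpty ι) (Matrix.trace (1 : Matrix (Fin 2) (Fin 2) K))
      · simp only [one_mul, mP_tr]; exact zero_mem _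
      · simp only [one_mul]; exact mP_tr2 h3 k l
    · exact a.elim
  have h6 := h5 h4
  rw [Subalgebra.mem_comap] at h6
  convert h6 using 1
  ext ρ
  simp [Phi_Psi h3]

theorem fftS [Infinite K] (h2 : (2:K) ≠ 0) (h3 : (3:K) = 0) (κ ι : Type) [Finite κ] [Finite ι] :
    ∀ f ∈ GoodS K κ ι, f ∈ GS K κ ι :=
  fftS_of_base h2 (fun ι _ => fftS_base h2 h3 ι) κ ι
end base
end O3

open Matrix MvPolynomial
namespace O3

section ids
variable {R : Type} [CommRing R]

def skm (x y z : R) : Matrix (Fin 3) (Fin 3) R := !![0, x, y; -x, 0, z; -y, -z, 0]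
def sym6 (a b c e f g : R) : Matrix (Fin 3) (Fin 3) R := !![a, b, c; b, e, f; c, f, g]

lemma id_R3 (x y z x' y' z' a b c e f g : R) : ∃ A B σ : Matrix (Fin 3) (Fin 3) R, A = skm x y z ∧ B = skm x' y' z' ∧ σ = sym6 a b c e f g ∧
    (2:R) • (A * σ * B + σ * A * B + A * B * σ) = (2 * σ.trace) • (A * B) + (A * B).trace • σ
      + (2 * (σ * A * B).trace - (A * B).trace * σ.trace) • (1 : Matrix (Fin 3) (Fin 3) R) := by
  refine ⟨_, _, _, rfl, rfl, rfl, ?_⟩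
  ext i j
  fin_cases i <;> fin_cases j <;>
    simp [skm, sym6, Matrix.mul_apply, Fin.sum_univ_three, Matrix.trace_fin_three] <;> ring

lemma id_4 (x y z x' y' z' a b c e f g : R) : ∃ A B C D : Matrix (Fin 3) (Fin 3) R, A = skm x y z ∧ B = skm x' y' z' ∧
    C = skm a b c ∧ D = skm e f g ∧
    (4:R) • (A * B * C * D) = (2:R) • (-(A * D).trace • (C * B) + (C * D).trace • (A * B) + (A * B).trace • (C * D))
      + ((A * D).trace * (B * C).trace - (A * B).trace * (C * D).trace) • (1 : Matrix (Fin 3) (Fin 3) R) := by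
  refine ⟨_, _, _, _, rfl, rfl, rfl, rfl, ?_⟩
  ext i j
  fin_cases i <;> fin_cases j <;>
    simp [skm, Matrix.mul_apply, Fin.sum_univ_three, Matrix.trace_fin_three] <;> ring

lemma id_CH (X : Matrix (Fin 3) (Fin 3) R) :
    (2:R) • (X * X * X) = (2 * X.trace) • (X * X) - (X.trace * X.trace - (X * X).trace) • X + (2 * X.det) • 1 := by
  rw [Matrix.det_fin_three]
  ext i j
  fin_cases i <;> fin_cases j <;>
    simp [Matrix.mul_apply, Fin.sum_univ_three, Matrix.trace_fin_three] <;> ring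

lemma id_CH3 (X Y Z : Matrix (Fin 3) (Fin 3) R) :
    X * Y * Z + X * Z * Y + Y * X * Z + Y * Z * X + Z * X * Y + Z * Y * X
    = X.trace • (Y * Z + Z * Y) + Y.trace • (X * Z + Z * X) + Z.trace • (X * Y + Y * X)
    - (X.trace * Y.trace - (X * Y).trace) • Z - (X.trace * Z.trace - (X * Z).trace) • Y - (Y.trace * Z.trace - (Y * Z).trace) • X
    + (X.trace * Y.trace * Z.trace - X.trace * (Y * Z).trace - Y.trace * (X * Z).trace - Z.trace * (X * Y).trace + (X * Y * Z).trace
      + (X * Z * Y).trace) • 1 := by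
  ext i j
  fin_cases i <;> fin_cases j <;>
    simp [Matrix.mul_apply, Fin.sum_univ_three, Matrix.trace_fin_three] <;> ring
end ids
end O3

open Matrix MvPolynomial
namespace O3

section p2
variable {K : Type} [Field K] {R : Type} [CommRing R] [Algebra K R] {d : ℕ}

structure P2 (W : Subalgebra K (Matrix (Fin 3) (Fin 3) R)) (Pl J : Submodule K R)
    (s : Fin d → Matrix (Fin 3) (Fin 3) R) : Prop where
  two : (2:K) ≠ 0
  tW : ∀ M ∈ W, Mᵀ ∈ W
  tr : ∀ M ∈ W, M.trace ∈ Pl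
  pp : ∀ p ∈ Pl, ∀ q ∈ Pl, p * q ∈ J
  jp : ∀ p ∈ J, ∀ q ∈ Pl, p * q ∈ J
  sm : ∀ k, s k ∈ W
  ss : ∀ k, (s k)ᵀ = s k
  sd : ∀ k, (s k).det ∈ Pl

def ta (J : Submodule K R) : Matrix (Fin 3) (Fin 3) R →ₗ[K] R ⧸ J :=
  J.mkQ ∘ₗ Matrix.traceLinearMap (Fin 3) K R

lemma ta_z {J : Submodule K R} {M : Matrix (Fin 3) (Fin 3) R} : ta J M = 0 ↔ M.trace ∈ J := by
  simp [ta]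

lemma ta_c {J : Submodule K R} (A B : Matrix (Fin 3) (Fin 3) R) : ta J (A * B) = ta J (B * A) := by
  simp [ta, Matrix.trace_mul_comm A B]

def Sk (W : Subalgebra K (Matrix (Fin 3) (Fin 3) R)) (M : Matrix (Fin 3) (Fin 3) R) : Prop := M ∈ W ∧ Mᵀ = -M

variable {W : Subalgebra K (Matrix (Fin 3) (Fin 3) R)} {Pl J : Submodule K R}
    {s : Fin d → Matrix (Fin 3) (Fin 3) R}

lemma two_cancel {V : Type} [AddCommGroup V] [Module K V] (h2 : (2:K) ≠ 0) {x : V} (h : x + x = 0) : x = 0 := by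
  have : (2:K) • x = 0 := by rw [two_smul]; exact h
  exact (smul_eq_zero.1 this).resolve_left h2

lemma sk_skm (h2 : (2:K) ≠ 0) {A : Matrix (Fin 3) (Fin 3) R} (h : Aᵀ = -A) : A = skm (A 0 1) (A 0 2) (A 1 2) := by
  have hh : ∀ i j, A j i = - A i j := fun i j => by
    have := congrFun (congrFun h i) j; simpa using this
  have hd : ∀ i, A i i = 0 := fun i => two_cancel h2 (by nth_rw 1 [hh i i]; simp)
  ext i j
  fin_cases i <;> fin_cases j <;> simp [skm, hd, hh 0 1, hh 0 2, hh 1 2]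

lemma sy_sym {A : Matrix (Fin 3) (Fin 3) R} (h : Aᵀ = A) :
    A = sym6 (A 0 0) (A 0 1) (A 0 2) (A 1 1) (A 1 2) (A 2 2) := by
  have hh : ∀ i j, A j i = A i j := fun i j => by
    have := congrFun (congrFun h i) j; simpa using this
  ext i j
  fin_cases i <;> fin_cases j <;> simp [sym6, hh 0 1, hh 0 2, hh 1 2]

namespace P2
variable (H : P2 W Pl J s)
include H

lemma dec {M : Matrix (Fin 3) (Fin 3) R} (h : M ∈ W) : ∃ S T, S ∈ W ∧ Sᵀ = S ∧ Sk W T ∧ M = S + T := by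
  refine ⟨(2:K)⁻¹ • (M + Mᵀ), (2:K)⁻¹ • (M - Mᵀ), W.smul_mem (W.add_mem h (H.tW _ h)) _, ?_,
    ⟨W.smul_mem (W.sub_mem h (H.tW _ h)) _, ?_⟩, ?_⟩
  · simp [add_comm]
  · simp [← smul_neg]
  · rw [← smul_add, show M + Mᵀ + (M - Mᵀ) = (2:K) • M by rw [two_smul]; abel, smul_smul,
      inv_mul_cancel₀ H.two, one_smul]

omit H in
lemma com {S c : Matrix (Fin 3) (Fin 3) R} (h : S ∈ W) (hS : Sᵀ = S) (hc : Sk W c) : Sk W (S * c + c * S) :=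
  ⟨W.add_mem (W.mul_mem h hc.1) (W.mul_mem hc.1 h), by
    rw [Matrix.transpose_add, Matrix.transpose_mul, Matrix.transpose_mul, hS, hc.2]; noncomm_ring⟩

lemma i4 {a b c e x : Matrix (Fin 3) (Fin 3) R} (ha : Sk W a) (hb : Sk W b) (hc : Sk W c) (he : Sk W e) (hx : x ∈ W) :
    ta J (a * b * c * e * x) = 0 := by
  obtain ⟨A, B, C, D, h1, h2, h3, h4, h⟩ := id_4 (a 0 1) (a 0 2) (a 1 2) (b 0 1) (b 0 2) (b 1 2)
    (c 0 1) (c 0 2) (c 1 2) (e 0 1) (e 0 2) (e 1 2)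
  rw [← sk_skm H.two ha.2] at h1
  rw [← sk_skm H.two hb.2] at h2
  rw [← sk_skm H.two hc.2] at h3
  rw [← sk_skm H.two he.2] at h4
  subst h1 h2 h3 h4
  have t := congrArg (fun M => (M * x).trace) h
  simp only [add_mul, smul_mul_assoc, Matrix.trace_smul, Matrix.trace_add, smul_eq_mul, one_mul] at t
  have w2 : ∀ {p q}, Sk W p → Sk W q → p * q ∈ W := fun hp hq => W.mul_mem hp.1 hq.1
  have key : (4:R) * (A * B * C * D * x).trace ∈ J := by
    rw [t]
    have e1 := H.pp _ (H.tr _ (w2 ha he)) _ (H.tr _ (W.mul_mem (w2 hc hb) hx))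
    have e2 := H.pp _ (H.tr _ (w2 hc he)) _ (H.tr _ (W.mul_mem (w2 ha hb) hx))
    have e3 := H.pp _ (H.tr _ (w2 ha hb)) _ (H.tr _ (W.mul_mem (w2 hc he) hx))
    have e4 := H.jp _ (H.pp _ (H.tr _ (w2 ha he)) _ (H.tr _ (w2 hb hc))) _ (H.tr _ hx)
    have e5 := H.jp _ (H.pp _ (H.tr _ (w2 ha hb)) _ (H.tr _ (w2 hc he))) _ (H.tr _ hx)
    have := J.add_mem (J.add_mem (J.add_mem (J.add_mem (J.neg_mem e1) e2) e3) (J.add_mem (J.add_mem (J.neg_mem e1) e2) e3))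
      (J.sub_mem e4 e5)
    convert this using 1; ring
  rw [ta_z]
  have : (4:K) • (A * B * C * D * x).trace ∈ J := by
    rw [Algebra.smul_def, map_ofNat]; exact key
  have h4 : (4:K) ≠ 0 := by rw [show (4:K) = 2 * 2 by norm_num]; exact mul_ne_zero H.two H.two
  exact (J.smul_mem_iff h4).1 this

lemma r3 {a b σ x : Matrix (Fin 3) (Fin 3) R} (ha : Sk W a) (hb : Sk W b) (hs : σ ∈ W) (hσ : σᵀ = σ) (hx : x ∈ W) :
    ta J ((a * σ * b + σ * a * b + a * b * σ) * x) = 0 := by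
  obtain ⟨A, B, C, h1, h2, h3, h⟩ := id_R3 (a 0 1) (a 0 2) (a 1 2) (b 0 1) (b 0 2) (b 1 2)
    (σ 0 0) (σ 0 1) (σ 0 2) (σ 1 1) (σ 1 2) (σ 2 2)
  rw [← sk_skm H.two ha.2] at h1
  rw [← sk_skm H.two hb.2] at h2
  rw [← sy_sym hσ] at h3
  subst h1 h2 h3
  have t := congrArg (fun M => (M * x).trace) h
  rw [ta_z]
  simp only [add_mul _ _ x, smul_mul_assoc, Matrix.trace_smul, Matrix.trace_add, smul_eq_mul, one_mul] at t
  have hab := W.mul_mem ha.1 hb.1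
  have key : (2:K) • ((A * C * B + C * A * B + A * B * C) * x).trace ∈ J := by
    rw [Algebra.smul_def, map_ofNat]
    simp only [add_mul _ _ x, Matrix.trace_add]
    rw [t]
    have e1 := H.pp _ (H.tr _ hs) _ (H.tr _ (W.mul_mem hab hx))
    have e2 := H.pp _ (H.tr _ hab) _ (H.tr _ (W.mul_mem hs hx))
    have e3 := H.pp _ (H.tr _ (W.mul_mem (W.mul_mem hs ha.1) hb.1)) _ (H.tr _ hx)
    have e4 := H.jp _ (H.pp _ (H.tr _ hab) _ (H.tr _ hs)) _ (H.tr _ hx)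
    have := J.add_mem (J.add_mem (J.add_mem (J.add_mem e1 e1) e2) (J.add_mem e3 e3)) (J.neg_mem e4)
    convert this using 1; ring
  exact (J.smul_mem_iff H.two).1 key

lemma ch3 {X Y Z x : Matrix (Fin 3) (Fin 3) R} (hX : X ∈ W) (hY : Y ∈ W) (hZ : Z ∈ W) (hx : x ∈ W) :
    ta J ((X * Y * Z + X * Z * Y + Y * X * Z + Y * Z * X + Z * X * Y + Z * Y * X) * x) = 0 := by
  rw [ta_z, id_CH3]
  simp only [add_mul _ _ x, sub_mul _ _ x, smul_mul_assoc, Matrix.trace_smul, Matrix.trace_add, Matrix.trace_sub, smul_eq_mul, one_mul]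
  have m := fun {p q} => W.mul_mem (x := p) (y := q)
  have tr := fun {p} => H.tr p
  have pp := fun {p q} (hp : p ∈ Pl) (hq : q ∈ Pl) => H.pp p hp q hq
  have jp := fun {p q} (hp : p ∈ J) (hq : q ∈ Pl) => H.jp p hp q hq
  have q2 : ∀ {P Q}, P ∈ W → Q ∈ W → (P.trace * Q.trace - (P * Q).trace) ∈ J → True := fun _ _ _ => trivial
  have two : ∀ {P Q Z}, P ∈ W → Q ∈ W → Z ∈ W → (P.trace * Q.trace - (P * Q).trace) * (Z * x).trace ∈ J :=
    fun {P Q Z} hP hQ hZ => by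
      rw [sub_mul]
      exact J.sub_mem (jp (pp (tr hP) (tr hQ)) (tr (m hZ hx))) (pp (tr (m hP hQ)) (tr (m hZ hx)))
  have one : ∀ {P Q Z}, P ∈ W → Q ∈ W → Z ∈ W → P.trace * ((Q * Z * x).trace + (Z * Q * x).trace) ∈ J :=
    fun {P Q Z} hP hQ hZ => by
      exact pp (tr hP) (Pl.add_mem (tr (m (m hQ hZ) hx)) (tr (m (m hZ hQ) hx)))
  refine J.add_mem (J.sub_mem (J.sub_mem (J.sub_mem (J.add_mem (J.add_mem (one hX hY hZ) (one hY hX hZ)) (one hZ hX hY))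
    (two hX hY hZ)) (two hX hZ hY)) (two hY hZ hX)) ?_
  simp only [add_mul, sub_mul]
  refine J.add_mem (J.add_mem (J.sub_mem (J.sub_mem (J.sub_mem ?_ ?_) ?_) ?_) ?_) ?_
  · exact jp (jp (pp (tr hX) (tr hY)) (tr hZ)) (tr hx)
  · exact jp (pp (tr hX) (tr (m hY hZ))) (tr hx)
  · exact jp (pp (tr hY) (tr (m hX hZ))) (tr hx)
  · exact jp (pp (tr hZ) (tr (m hX hY))) (tr hx)
  · exact pp (tr (m (m hX hY) hZ)) (tr hx)
  · exact pp (tr (m (m hX hZ) hY)) (tr hx)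

lemma i1 (k : Fin d) {x : Matrix (Fin 3) (Fin 3) R} (hx : x ∈ W) : ta J (s k * s k * s k * x) = 0 := by
  rw [ta_z]
  have hX := H.sm k
  have t := congrArg (fun M => (M * x).trace) (id_CH (s k))
  simp only [add_mul _ _ x, sub_mul _ _ x, smul_mul_assoc, Matrix.trace_smul, Matrix.trace_add, Matrix.trace_sub, smul_eq_mul, one_mul] at t
  have key : (2:K) • (s k * s k * s k * x).trace ∈ J := by
    rw [Algebra.smul_def, map_ofNat, t]
    have e1 := H.pp _ (H.tr _ hX) _ (H.tr _ (W.mul_mem (W.mul_mem hX hX) hx))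
    have e2 := H.jp _ (H.pp _ (H.tr _ hX) _ (H.tr _ hX)) _ (H.tr _ (W.mul_mem hX hx))
    have e3 := H.pp _ (H.tr _ (W.mul_mem hX hX)) _ (H.tr _ (W.mul_mem hX hx))
    have e4 := H.pp _ (H.sd k) _ (H.tr _ hx)
    have := J.add_mem (J.add_mem (J.add_mem e1 e1) (J.add_mem e4 e4)) (J.sub_mem e3 e2)
    convert this using 1; ring
  exact (J.smul_mem_iff H.two).1 key

lemma e41 {a b c e M x : Matrix (Fin 3) (Fin 3) R} (ha : Sk W a) (hb : Sk W b) (hc : Sk W c) (he : Sk W e) (hM : M ∈ W) (hx : x ∈ W) :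
    ta J (a * b * c * M * e * x) = 0 := by
  obtain ⟨S, T, hS, hS', hT, rfl⟩ := H.dec hM
  have e1 := H.i4 ha hb hc hT (W.mul_mem he.1 hx)
  have e2 := H.i4 ha hb hc (com hS hS' he) hx
  have e3 := H.i4 ha hb hc he (W.mul_mem hS hx)
  simp only [mul_add, add_mul, mul_assoc, _root_.map_add] at *
  rw [e3] at e2
  rw [e1]; simpa using e2

lemma e42 {a b c e M N x : Matrix (Fin 3) (Fin 3) R} (ha : Sk W a) (hb : Sk W b) (hc : Sk W c) (he : Sk W e) (hM : M ∈ W)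
    (hN : N ∈ W) (hx : x ∈ W) : ta J (a * b * M * c * N * e * x) = 0 := by
  obtain ⟨S, T, hS, hS', hT, rfl⟩ := H.dec hM
  have e1 := H.e41 ha hb hT he (W.mul_mem hc.1 hN) hx
  have e2 := H.e41 ha hb (com hS hS' hc) he hN hx
  have e3 := H.e41 ha hb hc he (W.mul_mem hS hN) hx
  simp only [mul_add, add_mul, mul_assoc, _root_.map_add] at *
  rw [e3] at e2
  rw [e1]; simpa using e2

lemma e4 {a b c e M N P x : Matrix (Fin 3) (Fin 3) R} (ha : Sk W a) (hb : Sk W b) (hc : Sk W c) (he : Sk W e) (hM : M ∈ W)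
    (hN : N ∈ W) (hP : P ∈ W) (hx : x ∈ W) : ta J (a * M * b * N * c * P * e * x) = 0 := by
  obtain ⟨S, T, hS, hS', hT, rfl⟩ := H.dec hM
  have e1 := H.e42 ha hT hb hc W.one_mem hN (W.mul_mem (W.mul_mem hP he.1) hx)
  have e2 := H.e42 ha (com hS hS' hb) hc he hN hP hx
  have e3 := H.e42 ha hb hc he (W.mul_mem hS hN) hP hx
  simp only [mul_add, add_mul, mul_assoc, _root_.map_add, one_mul] at *
  rw [e3] at e2
  rw [e1]; simpa using e2

end P2
end p2
end O3

open Matrix MvPolynomial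
namespace O3

section p3
variable {K : Type} [Field K] {R : Type} [CommRing R] [Algebra K R] {d : ℕ}

lemma perm_inv {Q : Type} (φ : List (Fin d) → Q) (N : ℕ)
    (h : ∀ u i j v, N ≤ (u ++ i :: j :: v).length → φ (u ++ i :: j :: v) = φ (u ++ j :: i :: v))
    {G G' : List (Fin d)} (hp : G.Perm G') : N ≤ G.length → φ G = φ G' := by
  have : ∀ u, N ≤ (u ++ G).length → φ (u ++ G) = φ (u ++ G') := by
    induction hp with
    | nil => intro u _; rfl
    | cons x hp ih => intro u hu; simpa using ih (u ++ [x]) (by simpa using hu)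
    | swap x y l => intro u hu; exact h u _ _ _ hu
    | trans h1 h2 ih1 ih2 =>
      intro u hu
      rw [ih1 u hu, ih2 u (by simpa [h1.length_eq] using hu)]
  simpa using this []

lemma cube_perm (G : List (Fin d)) (h : 2 * d + 1 ≤ G.length) : ∃ k G', G.Perm (k :: k :: k :: G') := by
  by_contra hc
  have hk : ∀ k, G.count k ≤ 2 := fun k => by
    by_contra h3
    have h3 : 3 ≤ G.count k := by omega
    obtain ⟨l, hl⟩ := (List.replicate_sublist_iff.2 h3).exists_perm_append
    exact hc ⟨k, l, by simpa [List.replicate] using hl⟩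
  have : G.length = ∑ k, G.count k := by
    have := Multiset.sum_count_eq_card (s := Finset.univ) (m := (G : Multiset (Fin d))) (by simp)
    simpa using this.symm
  have h2 : ∑ k, G.count k ≤ ∑ _k : Fin d, 2 := Finset.sum_le_sum fun k _ => hk k
  simp at h2
  omega

lemma perm_zero {Q : Type} [Zero Q] (φ : List (Fin d) → Q) (N : ℕ) (hN : 2 * d + 1 ≤ N)
    (h : ∀ u i j v, N ≤ (u ++ i :: j :: v).length → φ (u ++ i :: j :: v) = φ (u ++ j :: i :: v))
    (h3 : ∀ k G, φ (k :: k :: k :: G) = 0) (G : List (Fin d)) (hG : N ≤ G.length) : φ G = 0 := by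
  obtain ⟨k, G', hp⟩ := cube_perm G (by omega)
  rw [perm_inv φ N h hp hG, h3]

variable {W : Subalgebra K (Matrix (Fin 3) (Fin 3) R)} {Pl J : Submodule K R}
    {s : Fin d → Matrix (Fin 3) (Fin 3) R}

def SG (s : Fin d → Matrix (Fin 3) (Fin 3) R) (G : List (Fin d)) : Matrix (Fin 3) (Fin 3) R := (G.map s).prod

lemma SG_app (u v : List (Fin d)) : SG s (u ++ v) = SG s u * SG s v := by simp [SG]
lemma SG_cons (k) (v : List (Fin d)) : SG s (k :: v) = s k * SG s v := by simp [SG]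
lemma SG_nil : SG s [] = 1 := by simp [SG]

namespace P2
variable (H : P2 W Pl J s)
include H

lemma gm (G : List (Fin d)) : SG s G ∈ W :=
  Subalgebra.list_prod_mem _ (by simpa using fun k _ => H.sm k)

lemma gt (G : List (Fin d)) : (SG s G)ᵀ = SG s G.reverse := by
  induction G with
  | nil => simp [SG]
  | cons k G ih => rw [SG_cons, Matrix.transpose_mul, ih, H.ss, List.reverse_cons, SG_app, SG_cons, SG_nil, mul_one]

lemma ck (i j : Fin d) : Sk W (s i * s j - s j * s i) :=
  ⟨W.sub_mem (W.mul_mem (H.sm i) (H.sm j)) (W.mul_mem (H.sm j) (H.sm i)), by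
    rw [Matrix.transpose_sub, Matrix.transpose_mul, Matrix.transpose_mul, H.ss, H.ss]; noncomm_ring⟩

omit H in
lemma sw (u v : List (Fin d)) (i j : Fin d) {M N : Matrix (Fin 3) (Fin 3) R}
    (h : ta J (M * SG s u * (s i * s j - s j * s i) * SG s v * N) = 0) :
    ta J (M * SG s (u ++ i :: j :: v) * N) = ta J (M * SG s (u ++ j :: i :: v) * N) := by
  rw [← sub_eq_zero, ← _root_.map_sub, ← h]
  congr 1
  simp only [SG_app, SG_cons]
  noncomm_ring

lemma cb (k) (G : List (Fin d)) {M N : Matrix (Fin 3) (Fin 3) R} (hM : M ∈ W) (hN : N ∈ W) :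
    ta J (M * SG s (k :: k :: k :: G) * N) = 0 := by
  rw [mul_assoc, ta_c, ← H.i1 k (W.mul_mem (W.mul_mem (H.gm G) hN) hM)]
  simp only [SG_cons, mul_assoc]

lemma z3 {a b c M N : Matrix (Fin 3) (Fin 3) R} (ha : Sk W a) (hb : Sk W b) (hc : Sk W c) (hM : M ∈ W)
    (hN : N ∈ W) (G : List (Fin d)) (hG : 2 * d + 1 ≤ G.length) : ta J (a * M * b * N * c * SG s G) = 0 := by
  have hL := W.mul_mem (W.mul_mem (W.mul_mem (W.mul_mem ha.1 hM) hb.1) hN) hc.1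
  have := perm_zero (fun G => ta J (a * M * b * N * c * SG s G * 1)) (2 * d + 1) le_rfl
    (fun u i j v _ => sw u v i j ?_) (fun k G => H.cb k G hL W.one_mem) G hG
  · simpa using this
  · rw [mul_assoc _ (SG s v)]
    exact H.e4 ha hb hc (H.ck i j) hM hN (H.gm u) (W.mul_mem (H.gm v) W.one_mem)

lemma b3 {a b c : Matrix (Fin 3) (Fin 3) R} (ha : Sk W a) (hb : Sk W b) (hc : Sk W c) (n : ℕ) :
    ∀ G G' : List (Fin d), G.length = n → 2 * d + 2 ≤ G.length + G'.length →
      ta J (a * b * SG s G * c * SG s G') = 0 := by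
  induction n using Nat.strong_induction_on with
  | _ n ih =>
  intro G G' hn hG
  by_cases h1 : G.length ≤ 1
  · simpa using H.z3 ha hb hc W.one_mem (H.gm G) G' (by omega)
  · obtain ⟨L, p, q, rfl⟩ : ∃ L p q, G = L ++ [p, q] := by
      rcases List.eq_nil_or_concat G with rfl | ⟨L1, q, rfl⟩
      · simp at h1
      · rcases List.eq_nil_or_concat L1 with rfl | ⟨L, p, rfl⟩
        · simp at h1
        · exact ⟨L, p, q, by simp⟩
    simp at hn hG
    have e1 := H.ch3 (H.sm p) (H.sm q) hc.1 (W.mul_mem (W.mul_mem (W.mul_mem (H.gm G') ha.1) hb.1) (H.gm L))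
    have e2 := ih (L.length) (by omega) L (p :: q :: G') rfl (by simp; omega)
    have e3 := ih (L.length) (by omega) L (q :: p :: G') rfl (by simp; omega)
    have e4 := ih (L.length + 1) (by omega) (L ++ [p]) (q :: G') (by simp) (by simp; omega)
    have e5 := ih (L.length + 1) (by omega) (L ++ [q]) (p :: G') (by simp) (by simp; omega)
    have e6 := H.e4 ha hb (H.ck p q) hc W.one_mem (H.gm L) W.one_mem (H.gm G')
    have e7 : ∀ Z, ta J (Z * (SG s G' * a * b * SG s L)) = ta J (a * b * SG s L * Z * SG s G') := by
      intro Z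
      rw [show Z * (SG s G' * a * b * SG s L) = (Z * SG s G') * (a * b * SG s L) by simp only [mul_assoc], ta_c]
      simp only [mul_assoc]
    rw [e7] at e1
    apply two_cancel H.two
    simp only [SG_app, SG_cons, SG_nil, mul_add, add_mul, mul_sub, sub_mul, mul_assoc, _root_.map_add, _root_.map_sub, one_mul, mul_one] at *
    rw [e2, e3, e4, e5] at e1
    rw [sub_eq_zero] at e6
    rw [← e6] at e1
    simpa using e1

lemma e3 {a b c : Matrix (Fin 3) (Fin 3) R} (ha : Sk W a) (hb : Sk W b) (hc : Sk W c)
    (G1 G2 G3 : List (Fin d)) (hG : 2 * d + 2 ≤ G1.length + G2.length + G3.length) :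
    ta J (a * SG s G1 * b * SG s G2 * c * SG s G3) = 0 := by
  have hm := H.gm G1
  have e1 := H.r3 ha hb (σ := SG s G1 + (SG s G1)ᵀ) (W.add_mem hm (H.tW _ hm)) (by simp [add_comm])
    (W.mul_mem (W.mul_mem (H.gm G2) hc.1) (H.gm G3))
  have hsk : Sk W (SG s G1 - (SG s G1)ᵀ) := ⟨W.sub_mem hm (H.tW _ hm), by simp⟩
  have e2 := H.e4 ha hsk hb hc W.one_mem W.one_mem (H.gm G2) (H.gm G3)
  have b := fun G G' h => H.b3 ha hb hc _ G G' rfl h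
  have e3 := b G2 (G3 ++ G1) (by simp; omega)
  have e4 := b G2 (G3 ++ G1.reverse) (by simp; omega)
  have e5 := b (G1 ++ G2) G3 (by simp; omega)
  have e6 := b (G1.reverse ++ G2) G3 (by simp; omega)
  rw [SG_app, ← mul_assoc, ta_c] at e3 e4
  rw [H.gt] at e1 e2
  apply two_cancel H.two
  simp only [SG_app, mul_add, add_mul, mul_sub, sub_mul, mul_assoc, _root_.map_add, _root_.map_sub, one_mul] at *
  rw [e3, e4, e5, e6] at e1
  rw [sub_eq_zero] at e2
  rw [← e2] at e1
  simpa using e1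

lemma e20 {a b : Matrix (Fin 3) (Fin 3) R} (ha : Sk W a) (hb : Sk W b)
    (G : List (Fin d)) (hG : 2 * d + 4 ≤ G.length) : ta J (a * b * SG s G) = 0 := by
  have := perm_zero (fun G => ta J (a * b * SG s G * 1)) (2 * d + 4) (by omega)
    (fun u i j v h => sw u v i j ?_) (fun k G => H.cb k G (W.mul_mem ha.1 hb.1) W.one_mem) G hG
  · simpa using this
  · simpa [SG_nil] using H.e3 ha hb (H.ck i j) [] u v (by simp at h ⊢; omega)

lemma e2 {a b : Matrix (Fin 3) (Fin 3) R} (ha : Sk W a) (hb : Sk W b)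
    (G1 G2 : List (Fin d)) (hG : 2 * d + 4 ≤ G1.length + G2.length) : ta J (a * SG s G1 * b * SG s G2) = 0 := by
  have hp := perm_inv (fun G => ta J (a * SG s G * (b * SG s G2))) (2 * d + 4 - G2.length)
    (fun u i j v h => sw u v i j ?_) (List.reverse_perm G1).symm (by omega)
  · have hm := H.gm G1
    have e1 := H.r3 ha hb (σ := SG s G1 + (SG s G1)ᵀ) (W.add_mem hm (H.tW _ hm)) (by simp [add_comm]) (H.gm G2)
    have b := fun G h => H.e20 ha hb G h
    have e3 := b (G2 ++ G1) (by simp; omega)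
    have e4 := b (G2 ++ G1.reverse) (by simp; omega)
    have e5 := b (G1 ++ G2) (by simp; omega)
    have e6 := b (G1.reverse ++ G2) (by simp; omega)
    rw [SG_app, ← mul_assoc, ta_c] at e3 e4
    rw [H.gt] at e1
    apply two_cancel H.two
    simp only [SG_app, mul_add, add_mul, mul_sub, sub_mul, mul_assoc, _root_.map_add, _root_.map_sub, one_mul] at *
    rw [e3, e4, e5, e6, ← hp] at e1
    simpa using e1
  · have := H.e3 ha (H.ck i j) hb u v G2 (by simp at h ⊢; omega)
    simpa only [mul_assoc] using this

lemma e1 {a : Matrix (Fin 3) (Fin 3) R} (ha : Sk W a)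
    (G : List (Fin d)) (hG : 2 * d + 6 ≤ G.length) : ta J (a * SG s G) = 0 := by
  have := perm_zero (fun G => ta J (a * SG s G * 1)) (2 * d + 6) (by omega)
    (fun u i j v h => sw u v i j ?_) (fun k G => H.cb k G ha.1 W.one_mem) G hG
  · simpa using this
  · simpa using H.e2 ha (H.ck i j) u v (by simp at h ⊢; omega)

lemma e0 (G : List (Fin d)) (hG : 2 * d + 8 ≤ G.length) : ta J (SG s G) = 0 := by
  have := perm_zero (fun G => ta J (1 * SG s G * 1)) (2 * d + 8) (by omega)
    (fun u i j v h => sw u v i j ?_) (fun k G => H.cb k G W.one_mem W.one_mem) G hG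
  · simpa using this
  · rw [mul_one, one_mul, mul_assoc, ta_c, mul_assoc, ← SG_app]
    exact H.e1 (H.ck i j) _ (by simp at h ⊢; omega)

lemma word {α : Type} (l : Fin d ⊕ α → Matrix (Fin 3) (Fin 3) R) (hl : ∀ k, l (.inl k) = s k) (hr : ∀ k, Sk W (l (.inr k)))
    (w : List (Fin d ⊕ α)) (hw : 2 * d + 8 ≤ w.length) : ((w.map l).prod).trace ∈ J := by
  have hmem : ∀ w : List (Fin d ⊕ α), (w.map l).prod ∈ W := fun w => Subalgebra.list_prod_mem _ (by
    intro x hx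
    obtain ⟨y, -, rfl⟩ := List.mem_map.1 hx
    cases y with
    | inl k => rw [hl]; exact H.sm k
    | inr k => exact (hr k).1)
  have split : ∀ w : List (Fin d ⊕ α), ∃ G : List (Fin d), ((w.map l).prod = SG s G ∧ w.length = G.length) ∨
      ∃ e w', Sk W e ∧ (w.map l).prod = SG s G * (e * (List.map l w').prod) ∧ w.length = G.length + 1 + w'.length := by
    intro w
    induction w with
    | nil => exact ⟨[], .inl (by simp [SG])⟩
    | cons x w ih =>
      cases x with
      | inr k => exact ⟨[], .inr ⟨_, w, hr k, by simp [SG], by simp; omega⟩⟩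
      | inl k =>
        obtain ⟨G, ⟨h1, h2⟩ | ⟨e, w', h0, h1, h2⟩⟩ := ih
        · exact ⟨k :: G, .inl ⟨by simp [SG_cons, h1, hl], by simp [h2]⟩⟩
        · exact ⟨k :: G, .inr ⟨e, w', h0, by simp [SG_cons, h1, hl, mul_assoc], by simp [h2]; omega⟩⟩
  rw [← ta_z]
  obtain ⟨G0, ⟨h1, h2⟩ | ⟨e1, w1, hs1, h1, h2⟩⟩ := split w
  · rw [h1]; exact H.e0 _ (by omega)
  rw [h1, ta_c]
  obtain ⟨G1, ⟨k1, k2⟩ | ⟨e2, w2, hs2, k1, k2⟩⟩ := split w1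
  · rw [k1, mul_assoc, ← SG_app]; exact H.e1 hs1 _ (by simp; omega)
  obtain ⟨G2, ⟨l1, l2⟩ | ⟨e3, w3, hs3, l1, l2⟩⟩ := split w2
  · have := H.e2 hs1 hs2 G1 (G2 ++ G0) (by simp; omega)
    rw [k1, l1]; simpa only [SG_app, mul_assoc] using this
  obtain ⟨G3, ⟨m1, m2⟩ | ⟨e4, w4, hs4, m1, m2⟩⟩ := split w3
  · have := H.e3 hs1 hs2 hs3 G1 G2 (G3 ++ G0) (by simp; omega)
    rw [k1, l1, m1]; simpa only [SG_app, mul_assoc] using this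
  · have := H.e4 hs1 hs2 hs3 hs4 (H.gm G1) (H.gm G2) (H.gm G3) (W.mul_mem (hmem w4) (H.gm G0))
    rw [k1, l1, m1]; simpa only [mul_assoc] using this

end P2
end p3
end O3

open Matrix MvPolynomial
namespace O3

section tr
variable {K : Type} [Field K] {d : ℕ}

noncomputable def lR (K : Type) [Field K] (d : ℕ) : Fin d ⊕ Fin d → Matrix (Fin 3) (Fin 3) (Rpoly K d)
  | .inl k => (2:K)⁻¹ • (genMat K d k + (genMat K d k)ᵀ)
  | .inr k => (2:K)⁻¹ • (genMat K d k - (genMat K d k)ᵀ)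

def XM (σ : Fin 3 × Fin 3 × Fin d → K) (k : Fin d) : M3 K := Matrix.of fun i j => σ (i, j, k)

lemma eval_act (g : M3 K) (σ : Fin 3 × Fin 3 × Fin d → K) (f : Rpoly K d) :
    eval σ (actHom K d g f) = eval (fun p => (gᵀ * XM σ p.2.2 * g) p.1 p.2.1) f := by
  have : (eval σ).comp (actHom K d g).toRingHom = eval (fun p => (gᵀ * XM σ p.2.2 * g) p.1 p.2.1) := by
    apply MvPolynomial.ringHom_ext
    · intro r; simp [actHom]
    · rintro ⟨i, j, k⟩
      simp [actHom, Matrix.mul_apply, genMat, XM]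
  exact congrArg (fun φ : Rpoly K d →+* K => φ f) this

noncomputable def thS (σ : Fin 3 × Fin 3 × Fin d → K) : IdxS (Fin d) (Fin d) → K :=
  Sum.elim (fun p => c6 ((2:K)⁻¹ • (XM σ p.1 + (XM σ p.1)ᵀ)) p.2)
    (fun p => ![((2:K)⁻¹ • (XM σ p.1 - (XM σ p.1)ᵀ)) 2 1, ((2:K)⁻¹ • (XM σ p.1 - (XM σ p.1)ᵀ)) 0 2,
      ((2:K)⁻¹ • (XM σ p.1 - (XM σ p.1)ᵀ)) 1 0] p.2)

lemma sM_th (σ : Fin 3 × Fin 3 × Fin d → K) (k) : sM (thS σ) k = (2:K)⁻¹ • (XM σ k + (XM σ k)ᵀ) := by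
  have := s6_c6 ((2:K)⁻¹ • (XM σ k + (XM σ k)ᵀ)) (by simp [add_comm])
  rw [← this]; rfl

lemma xV_th (σ : Fin 3 × Fin 3 × Fin d → K) (k) :
    hat (xV (thS σ) k) = (2:K)⁻¹ • (XM σ k - (XM σ k)ᵀ) := by
  ext i j
  fin_cases i <;> fin_cases j <;> simp [hat, xV, thS] <;> ring

lemma mS_th (σ : Fin 3 × Fin 3 × Fin d → K) (l) : mS l (thS σ) = (lR K d l).map (eval σ) := by
  rcases l with k | k
  · change sM (thS σ) k = _
    rw [sM_th]; ext i j; simp [lR, XM, genMat, mul_add]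
  · change hat (xV (thS σ) k) = _
    rw [xV_th]; ext i j; simp [lR, XM, genMat, mul_sub]

def gens (K : Type) [Field K] (d : ℕ) : Set (Rpoly K d) :=
  {f | ∃ w : List (Fin d ⊕ Fin d), f = ((w.map (lR K d)).prod).trace} ∪ Set.range fun k => (lR K d (.inl k)).det

lemma GS_pullR {h} (hh : h ∈ GS K (Fin d) (Fin d)) :
    ∃ q ∈ Algebra.adjoin K (gens K d), ∀ σ, eval σ q = h (thS σ) := by
  induction hh using Algebra.adjoin_induction with
  | mem x hx =>
    rcases hx with ⟨w, rfl⟩ | ⟨k, rfl⟩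
    · refine ⟨_, Algebra.subset_adjoin (Or.inl ⟨w, rfl⟩), fun σ => ?_⟩
      have : mw mS w (thS σ) = ((w.map (lR K d)).prod).map (eval σ) := by
        change _ = (eval σ).mapMatrix _
        rw [_root_.map_list_prod, List.map_map]
        unfold mw
        simp only [mS_th]; rfl
      simp only [this]
      simp [Matrix.trace_fin_three]
    · refine ⟨_, Algebra.subset_adjoin (Or.inr ⟨k, rfl⟩), fun σ => ?_⟩
      change eval σ (lR K d (.inl k)).det = (mS (.inl k) (thS σ)).det
      rw [mS_th, RingHom.map_det]; rfl
  | algebraMap r => exact ⟨_, Subalgebra.algebraMap_mem _ r, fun σ => by simp⟩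
  | add x y _ _ hx hy =>
    obtain ⟨p, hp, hp'⟩ := hx
    obtain ⟨q, hq, hq'⟩ := hy
    exact ⟨p + q, add_mem hp hq, fun σ => by simp [hp', hq']⟩
  | mul x y _ _ hx hy =>
    obtain ⟨p, hp, hp'⟩ := hx
    obtain ⟨q, hq, hq'⟩ := hy
    exact ⟨p * q, mul_mem hp hq, fun σ => by simp [hp', hq']⟩

theorem inv_adjoin [Infinite K] (h2 : (2:K) ≠ 0) (h3 : (3:K) = 0) {f : Rpoly K d} (hf : f ∈ invAlg K d) :
    f ∈ Algebra.adjoin K (gens K d) := by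
  have hg : (fun ρ : IdxS (Fin d) (Fin d) → K => eval (fun p : Fin 3 × Fin 3 × Fin d =>
      (sM ρ p.2.2 + hat (xV ρ p.2.2)) p.1 p.2.1) f) ∈ GoodS K (Fin d) (Fin d) := by
    constructor
    · have : evH K _ f ∈ Pol K (Fin 3 × Fin 3 × Fin d) := ⟨f, rfl⟩
      have := Pol.comp (θ := fun ρ : IdxS (Fin d) (Fin d) → K => fun p : Fin 3 × Fin 3 × Fin d =>
        (sM ρ p.2.2 + hat (xV ρ p.2.2)) p.1 p.2.1) (fun p => Pol.add (mS_pol (.inl p.2.2) p.1 p.2.1) (mS_pol (.inr p.2.2) p.1 p.2.1)) this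
      have e : (fun ρ : IdxS (Fin d) (Fin d) → K => eval (fun p : Fin 3 × Fin 3 × Fin d =>
        (sM ρ p.2.2 + hat (xV ρ p.2.2)) p.1 p.2.1) f) = pb (fun ρ : IdxS (Fin d) (Fin d) → K => fun p : Fin 3 × Fin 3 × Fin d =>
        (sM ρ p.2.2 + hat (xV ρ p.2.2)) p.1 p.2.1) (evH K _ f) := by
        funext ρ; exact (evH_apply f _).symm
      rw [e]; exact this
    · intro g hg hd ρ
      have h1 := hf gᵀ (by rw [Matrix.transpose_transpose]; exact mul_eq_one_comm.1 hg)
      have h2 := eval_act gᵀ (fun p : Fin 3 × Fin 3 × Fin d => (sM ρ p.2.2 + hat (xV ρ p.2.2)) p.1 p.2.1) f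
      rw [h1] at h2
      refine Eq.trans ?_ h2.symm
      change eval _ f = _
      congr 2
      funext p
      rw [sM_act, xV_act, hat_act hg hd, Matrix.transpose_transpose]
      rw [show g * sM ρ p.2.2 * gᵀ + g * hat (xV ρ p.2.2) * gᵀ = g * (sM ρ p.2.2 + hat (xV ρ p.2.2)) * gᵀ by noncomm_ring]
      rfl
  obtain ⟨q, hq, hq'⟩ := GS_pullR (fftS h2 h3 _ _ _ hg)
  have : f = q := by
    apply MvPolynomial.funext
    intro σ
    rw [hq']
    congr 2
    ext ⟨i, j, k⟩
    rw [sM_th, xV_th, ← smul_add, show XM σ k + (XM σ k)ᵀ + (XM σ k - (XM σ k)ᵀ) = (2:K) • XM σ k by rw [two_smul]; abel,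
      smul_smul, inv_mul_cancel₀ h2, one_smul]
    rfl
  rw [this]; exact hq
end tr

section asm
variable {K : Type} [Field K] {d : ℕ}

noncomputable def PlS (K : Type) [Field K] (d : ℕ) : Submodule K (Rpoly K d) :=
  ((plusIdeal K d).restrictScalars K).map (invAlg K d).val.toLinearMap
noncomputable def JS (K : Type) [Field K] (d : ℕ) : Submodule K (Rpoly K d) :=
  ((plusIdeal K d ^ 2).restrictScalars K).map (invAlg K d).val.toLinearMap

lemma pl_of {f : Rpoly K d} (hf : f ∈ invAlg K d) {n : ℕ} (hn : 0 < n) (h : f.IsHomogeneous n) : f ∈ PlS K d :=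
  ⟨⟨f, hf⟩, Ideal.subset_span ⟨n, hn, h⟩, rfl⟩

lemma pl_pl {p q : Rpoly K d} (hp : p ∈ PlS K d) (hq : q ∈ PlS K d) : p * q ∈ JS K d := by
  obtain ⟨p, hp, rfl⟩ := hp
  obtain ⟨q, hq, rfl⟩ := hq
  refine ⟨p * q, ?_, rfl⟩
  change p * q ∈ plusIdeal K d ^ 2
  rw [pow_two]; exact Ideal.mul_mem_mul hp hq

lemma j_inv {p q : Rpoly K d} (hp : p ∈ JS K d) (hq : q ∈ invAlg K d) : p * q ∈ JS K d := by
  obtain ⟨p, hp, rfl⟩ := hp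
  exact ⟨p * ⟨q, hq⟩, Ideal.mul_mem_right _ _ hp, rfl⟩

lemma pl_inv {p : Rpoly K d} (hp : p ∈ PlS K d) : p ∈ invAlg K d := by
  obtain ⟨p, hp, rfl⟩ := hp
  exact p.2

def Eqv (M : Matrix (Fin 3) (Fin 3) (Rpoly K d)) : Prop := ∀ g : M3 K, gᵀ * g = 1 →
  (actHom K d g).mapMatrix M = (g.map (algebraMap K (Rpoly K d)))ᵀ * M * g.map (algebraMap K (Rpoly K d))

lemma map_orth {g : M3 K} (hg : gᵀ * g = 1) :
    g.map (algebraMap K (Rpoly K d)) * (g.map (algebraMap K (Rpoly K d)))ᵀ = 1 := by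
  have h := congrArg (algebraMap K (Rpoly K d)).mapMatrix (mul_eq_one_comm.1 hg)
  rw [_root_.map_mul, map_one] at h
  exact h

lemma Eqv.mul {M N : Matrix (Fin 3) (Fin 3) (Rpoly K d)} (hM : Eqv M) (hN : Eqv N) : Eqv (M * N) := by
  intro g hg
  rw [_root_.map_mul, hM g hg, hN g hg]
  have h := map_orth (d := d) hg
  set G := g.map (algebraMap K (Rpoly K d))
  calc _ = Gᵀ * M * (G * Gᵀ) * N * G := by noncomm_ring
    _ = _ := by rw [h]; noncomm_ring

lemma Eqv.one : Eqv (1 : Matrix (Fin 3) (Fin 3) (Rpoly K d)) := by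
  intro g hg
  rw [map_one, Matrix.mul_one]
  exact (mul_eq_one_comm.1 (map_orth hg)).symm

lemma Eqv.add {M N : Matrix (Fin 3) (Fin 3) (Rpoly K d)} (hM : Eqv M) (hN : Eqv N) : Eqv (M + N) := by
  intro g hg
  rw [_root_.map_add, hM g hg, hN g hg]; noncomm_ring

lemma Eqv.smul {M : Matrix (Fin 3) (Fin 3) (Rpoly K d)} (hM : Eqv M) (c : K) : Eqv (c • M) := by
  intro g hg
  rw [_root_.map_smul, hM g hg]; simp

lemma Eqv.tp {M : Matrix (Fin 3) (Fin 3) (Rpoly K d)} (hM : Eqv M) : Eqv Mᵀ := by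
  intro g hg
  have := congrArg Matrix.transpose (hM g hg)
  rw [Matrix.transpose_mul, Matrix.transpose_mul, Matrix.transpose_transpose, ← Matrix.mul_assoc] at this
  rw [← this]; rfl

lemma Eqv.gen (k) : Eqv (genMat K d k) := by
  intro g hg
  ext i j
  simp only [AlgHom.mapMatrix_apply, Matrix.map_apply]
  conv_lhs => rw [genMat, Matrix.of_apply, actHom, aeval_X]

lemma Eqv.tr {M : Matrix (Fin 3) (Fin 3) (Rpoly K d)} (hM : Eqv M) : M.trace ∈ invAlg K d := by
  intro g hg
  have : actHom K d g M.trace = ((actHom K d g).mapMatrix M).trace := by simp [Matrix.trace_fin_three]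
  rw [this, hM g hg, Matrix.trace_mul_comm, ← Matrix.mul_assoc, map_orth hg, Matrix.one_mul]

lemma Eqv.det {M : Matrix (Fin 3) (Fin 3) (Rpoly K d)} (hM : Eqv M) : M.det ∈ invAlg K d := by
  intro g hg
  rw [AlgHom.map_det, hM g hg, Matrix.det_mul, mul_comm, ← Matrix.det_mul, ← Matrix.mul_assoc, map_orth hg, Matrix.one_mul]

lemma Eqv.l (l) : Eqv (lR K d l) := by
  rcases l with k | k
  · exact ((Eqv.gen k).add (Eqv.gen k).tp).smul _
  · have := ((Eqv.gen k).add ((Eqv.gen k).tp.smul (-1))).smul (2:K)⁻¹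
    simpa [sub_eq_add_neg, lR] using this

lemma Eqv.w (w : List (Fin d ⊕ Fin d)) : Eqv (w.map (lR K d)).prod := by
  induction w with
  | nil => exact Eqv.one
  | cons l w ih => simpa using (Eqv.l l).mul ih

lemma hom_l (l) (i j) : (lR K d l i j).IsHomogeneous 1 := by
  rcases l with k | k
  · simp only [lR, genMat, Matrix.smul_apply, Matrix.add_apply, Matrix.transpose_apply, Matrix.of_apply, smul_eq_C_mul]
    simpa using (isHomogeneous_C _ _).mul ((isHomogeneous_X K _).add (isHomogeneous_X K _))
  · simp only [lR, genMat, Matrix.smul_apply, Matrix.sub_apply, Matrix.transpose_apply, Matrix.of_apply, smul_eq_C_mul]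
    simpa using (isHomogeneous_C _ _).mul ((isHomogeneous_X K _).sub (isHomogeneous_X K _))

lemma hom_mul {M N : Matrix (Fin 3) (Fin 3) (Rpoly K d)} {m n : ℕ} (hM : ∀ i j, (M i j).IsHomogeneous m)
    (hN : ∀ i j, (N i j).IsHomogeneous n) (i j) : ((M * N) i j).IsHomogeneous (m + n) := by
  rw [Matrix.mul_apply]
  exact IsHomogeneous.sum _ _ _ fun c _ => (hM _ _).mul (hN _ _)

lemma hom_w (w : List (Fin d ⊕ Fin d)) (i j) : ((w.map (lR K d)).prod i j).IsHomogeneous w.length := by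
  induction w generalizing i j with
  | nil =>
    simp only [List.map_nil, List.prod_nil, List.length_nil, Matrix.one_apply]
    split
    · exact isHomogeneous_one _ _
    · exact isHomogeneous_zero _ _ _
  | cons l w ih =>
    rw [List.map_cons, List.prod_cons, List.length_cons, add_comm]
    exact hom_mul (hom_l l) ih i j

lemma hom_tr {M : Matrix (Fin 3) (Fin 3) (Rpoly K d)} {m : ℕ} (hM : ∀ i j, (M i j).IsHomogeneous m) :
    M.trace.IsHomogeneous m := IsHomogeneous.sum _ _ _ fun c _ => hM _ _

lemma hom_det {M : Matrix (Fin 3) (Fin 3) (Rpoly K d)} (hM : ∀ i j, (M i j).IsHomogeneous 1) :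
    M.det.IsHomogeneous 3 := by
  rw [Matrix.det_fin_three]
  have h := fun i j k l m n => ((hM i j).mul (hM k l)).mul (hM m n)
  exact ((((((h _ _ _ _ _ _).sub (h _ _ _ _ _ _)).sub (h _ _ _ _ _ _)).add (h _ _ _ _ _ _)).add (h _ _ _ _ _ _)).sub (h _ _ _ _ _ _))

theorem p2_inst (h2 : (2:K) ≠ 0) (h3 : (3:K) = 0) :
    P2 (Algebra.adjoin K (Set.range (lR K d))) (PlS K d) (JS K d) fun k => lR K d (.inl k) where
  two := h2
  tW := by
    intro M hM
    induction hM using Algebra.adjoin_induction with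
    | mem x hx =>
      obtain ⟨l, rfl⟩ := hx
      rcases l with k | k
      · rw [show (lR K d (.inl k))ᵀ = lR K d (.inl k) by simp [lR, add_comm]]
        exact Algebra.subset_adjoin ⟨_, rfl⟩
      · rw [show (lR K d (.inr k))ᵀ = -lR K d (.inr k) by simp [lR, ← smul_neg]]
        exact neg_mem (Algebra.subset_adjoin ⟨_, rfl⟩)
    | algebraMap r =>
      rw [Algebra.algebraMap_eq_smul_one, Matrix.transpose_smul, Matrix.transpose_one]
      exact Subalgebra.smul_mem _ (one_mem _) _
    | add x y _ _ hx hy => rw [Matrix.transpose_add]; exact add_mem hx hy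
    | mul x y _ _ hx hy => rw [Matrix.transpose_mul]; exact mul_mem hy hx
  tr := by
    intro M hM
    rw [← Subalgebra.mem_toSubmodule, Algebra.adjoin_eq_span] at hM
    induction hM using Submodule.span_induction with
    | mem x hx =>
      obtain ⟨w, rfl⟩ : ∃ w : List (Fin d ⊕ Fin d), (w.map (lR K d)).prod = x := by
        induction hx using Submonoid.closure_induction with
        | mem x hx => obtain ⟨l, rfl⟩ := hx; exact ⟨[l], by simp⟩
        | one => exact ⟨[], rfl⟩
        | mul x y _ _ hx hy =>
          obtain ⟨u, rfl⟩ := hx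
          obtain ⟨v, rfl⟩ := hy
          exact ⟨u ++ v, by simp⟩
      rcases w with _ | ⟨l, w⟩
      · have : ((1 : Matrix (Fin 3) (Fin 3) (Rpoly K d))).trace = 0 := by
          rw [Matrix.trace_one, Fintype.card_fin]
          have := congrArg (C (σ := Fin 3 × Fin 3 × Fin d)) h3
          rw [map_ofNat, map_zero] at this
          exact_mod_cast this
        simp only [List.map_nil, List.prod_nil, this]
        exact zero_mem _
      · exact pl_of (Eqv.w _).tr (n := (l :: w).length) (by simp) (hom_tr (hom_w _))
    | zero => simp
    | add x y _ _ hx hy => rw [Matrix.trace_add]; exact add_mem hx hy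
    | smul c x _ hx => rw [Matrix.trace_smul]; exact Submodule.smul_mem _ _ hx
  pp := fun p hp q hq => pl_pl hp hq
  jp := fun p hp q hq => j_inv hp (pl_inv hq)
  sm := fun k => Algebra.subset_adjoin ⟨_, rfl⟩
  ss := fun k => by simp [lR, add_comm]
  sd := fun k => pl_of (Eqv.l _).det (n := 3) (by norm_num) (hom_det (hom_l _))

theorem upper [Infinite K] (h2 : (2:K) ≠ 0) (h3 : (3:K) = 0) {f : Rpoly K d} (hf : f ∈ invAlg K d) {n : ℕ}
    (hn : f.IsHomogeneous n) (h : 2 * d + 8 ≤ n) : f ∈ JS K d := by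
  have h1 := inv_adjoin h2 h3 hf
  rw [← Subalgebra.mem_toSubmodule, Algebra.adjoin_eq_span] at h1
  have key : homogeneousComponent n f ∈ JS K d := by
    clear hf hn
    induction h1 using Submodule.span_induction with
    | mem x hx =>
      obtain ⟨m, h1, -, h2⟩ : ∃ m, x.IsHomogeneous m ∧ x ∈ invAlg K d ∧ (2 * d + 8 ≤ m → x ∈ JS K d) := by
        induction hx using Submonoid.closure_induction with
        | mem x hx =>
          rcases hx with ⟨w, rfl⟩ | ⟨k, rfl⟩
          · refine ⟨_, hom_tr (hom_w w), (Eqv.w w).tr, fun hw => ?_⟩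
            exact (p2_inst h2 h3).word (lR K d) (fun _ => rfl) (fun k => ⟨Algebra.subset_adjoin ⟨_, rfl⟩, by simp [lR, ← smul_neg]⟩) w hw
          · exact ⟨3, hom_det (hom_l _), (Eqv.l _).det, fun h => by omega⟩
        | one => exact ⟨0, isHomogeneous_one _ _, one_mem _, fun h => by omega⟩
        | mul x y _ _ hx hy =>
          obtain ⟨m, a1, a2, a3⟩ := hx
          obtain ⟨m', b1, b2, b3⟩ := hy
          refine ⟨m + m', a1.mul b1, mul_mem a2 b2, fun hm => ?_⟩
          rcases Nat.eq_zero_or_pos m with h0 | h0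
          · rw [mul_comm]; exact j_inv (b3 (by omega)) a2
          rcases Nat.eq_zero_or_pos m' with h0' | h0'
          · exact j_inv (a3 (by omega)) b2
          exact pl_pl (pl_of a2 h0 a1) (pl_of b2 h0' b1)
      rw [homogeneousComponent_of_mem h1]
      split
      · exact h2 (by omega)
      · exact zero_mem _
    | zero => simp
    | add x y _ _ hx hy => rw [_root_.map_add]; exact add_mem hx hy
    | smul c x _ hx => rw [_root_.map_smul]; exact Submodule.smul_mem _ _ hx
  rw [homogeneousComponent_of_mem hn, if_pos rfl] at key
  exact key
end asm
end O3

open Matrix MvPolynomial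
namespace O3

section low
variable {K : Type} [Field K] {e : ℕ}

abbrev TT (e : ℕ) := Fin 3 ⊕ (Fin 3 ⊕ Fin e)

noncomputable def mp {T : Type} (c : T → K) (π : T ≃ T) : MvPolynomial T K →ₐ[K] MvPolynomial T K :=
  aeval fun t => C (c t) * X (π t)

lemma coeff_mp {T : Type} [Fintype T] (c : T → K) (π : T ≃ T) (p : MvPolynomial T K) (m : T →₀ ℕ) :
    coeff (m.mapDomain π) (mp c π p) = (∏ t, c t ^ m t) * coeff m p := by
  classical
  induction p using MvPolynomial.induction_on' with
  | add p q hp hq => rw [_root_.map_add, coeff_add, coeff_add, hp, hq, mul_add]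
  | monomial u r =>
    have : mp c π (monomial u r) = C (∏ t, c t ^ u t) * rename π (monomial u r) := by
      rw [mp, aeval_monomial, rename_monomial, monomial_eq, Finsupp.prod_mapDomain_index (by simp) (by simp [pow_add])]
      simp only [mul_pow]
      rw [Finsupp.prod_mul, algebraMap_eq, ← Finsupp.prod_fintype u (fun t n => c t ^ n) (by simp)]
      rw [Finsupp.prod, Finsupp.prod, Finsupp.prod, map_prod]
      simp only [_root_.map_pow]; ring
    rw [this, coeff_C_mul, coeff_rename_mapDomain _ π.injective, coeff_monomial]
    split
    · next h => rw [h]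
    · simp

noncomputable def gX (K : Type) [Field K] (e : ℕ) : Matrix (Fin 3) (Fin 3) (MvPolynomial (TT e) K) :=
  !![X (.inl 0), -X (.inr (.inl 2)), X (.inr (.inl 1)); X (.inr (.inl 2)), X (.inl 1), -X (.inr (.inl 0));
    -X (.inr (.inl 1)), X (.inr (.inl 0)), X (.inl 2)]

noncomputable def gY (K : Type) [Field K] (e : ℕ) : Fin (e + 1) → Matrix (Fin 3) (Fin 3) (MvPolynomial (TT e) K) :=
  Fin.cons (gX K e) fun k => (X (.inr (.inr k)) : MvPolynomial (TT e) K) • 1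

noncomputable def thL (K : Type) [Field K] (e : ℕ) : Rpoly K (e + 1) →ₐ[K] MvPolynomial (TT e) K :=
  aeval fun p => gY K e p.2.2 p.1 p.2.1

lemma thL_X (i j k) : thL K e (X (i, j, k)) = gY K e k i j := by simp [thL]

def cS (c : Fin 3 → K) : TT e → K := Sum.elim (fun _ => 1) (Sum.elim c fun _ => 1)

lemma thL_sign (ε : Fin 3 → K) (c : Fin 3 → K) (h : ∀ i, ε i * ε i = 1) (h0 : c 0 = ε 1 * ε 2) (h1 : c 1 = ε 0 * ε 2)
    (h2 : c 2 = ε 0 * ε 1) {f : Rpoly K (e + 1)} (hf : f ∈ invAlg K (e + 1)) :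
    mp (cS c) (Equiv.refl _) (thL K e f) = thL K e f := by
  have h3 := hf (Matrix.diagonal ε) (by
    rw [Matrix.diagonal_transpose, Matrix.diagonal_mul_diagonal, ← Matrix.diagonal_one]
    congr 1; funext i; exact h i)
  have : (mp (cS c) (Equiv.refl _)).comp (thL K e) = (thL K e).comp (actHom K (e + 1) (Matrix.diagonal ε)) := by
    apply MvPolynomial.algHom_ext
    rintro ⟨i, j, k⟩
    have hh : ∀ i, (C (ε i) : MvPolynomial (TT e) K) * C (ε i) = 1 := fun i => by rw [← C_mul, h, C_1]
    have ha : actHom K (e + 1) (Matrix.diagonal ε) (X (i, j, k)) = C (ε i) * X (i, j, k) * C (ε j) := by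
      simp [actHom, genMat, Matrix.diagonal_map, Matrix.diagonal_transpose, Matrix.mul_diagonal, Matrix.diagonal_mul, algebraMap_eq]
    rw [AlgHom.comp_apply, AlgHom.comp_apply, ha, _root_.map_mul, _root_.map_mul, thL_X, algHom_C, algHom_C, algebraMap_eq]
    refine Fin.cases ?_ (fun k => ?_) k
    · have := hh 0; have := hh 1; have := hh 2
      fin_cases i <;> fin_cases j <;> simp [gY, gX, mp, cS, h0, h1, h2] <;> grind
    · by_cases hij : i = j
      · subst hij
        have := hh i
        simp [gY, mp, cS]; grind
      · simp [gY, hij]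
  have t := congrArg (fun φ : Rpoly K (e + 1) →ₐ[K] MvPolynomial (TT e) K => φ f) this
  simp only [AlgHom.comp_apply] at t
  rw [t, h3]

def eP (τ : Fin 3 ≃ Fin 3) : TT e ≃ TT e := Equiv.sumCongr τ (Equiv.sumCongr τ (Equiv.refl _))
def rP (τ : Fin 3 ≃ Fin 3) (d : ℕ) (p : Fin 3 × Fin 3 × Fin d) : Fin 3 × Fin 3 × Fin d := (τ p.1, τ p.2.1, p.2.2)

lemma rP_inj (τ : Fin 3 ≃ Fin 3) (d : ℕ) : Function.Injective (rP τ d) := by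
  rintro ⟨a, b, c⟩ ⟨a', b', c'⟩ h
  simpa [rP] using h

lemma act_perm (τ : Fin 3 ≃ Fin 3) {d : ℕ} {f : Rpoly K d} (hf : f ∈ invAlg K d) : rename (rP τ d) f = f := by
  have h := hf (Matrix.of fun i j => if i = τ j then 1 else 0) (by
    ext i j
    simp [Matrix.mul_apply, Matrix.one_apply, eq_comm])
  rw [← h]
  conv_lhs => rw [h]
  have : rename (rP τ d) = actHom K d (Matrix.of fun i j => if i = τ j then 1 else 0) := by
    apply MvPolynomial.algHom_ext
    rintro ⟨i, j, k⟩
    simp [actHom, rP, genMat, Matrix.mul_apply, apply_ite]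
  rw [this]

lemma thL_perm (p q : Fin 3) (hpq : p ≠ q) (f : Rpoly K (e + 1)) :
    thL K e (rename (rP (Equiv.swap p q) (e + 1)) f) = mp (cS fun _ => -1) (eP (Equiv.swap p q)) (thL K e f) := by
  have : (thL K e).comp (rename (rP (Equiv.swap p q) (e + 1))) = (mp (cS fun _ => -1) (eP (Equiv.swap p q))).comp (thL K e) := by
    apply MvPolynomial.algHom_ext
    rintro ⟨i, j, k⟩
    rw [AlgHom.comp_apply, AlgHom.comp_apply, rename_X, rP, thL_X, thL_X]
    refine Fin.cases ?_ (fun k => ?_) k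
    · fin_cases p <;> fin_cases q <;> first | exact absurd rfl hpq | skip
      all_goals fin_cases i <;> fin_cases j <;> simp [gY, gX, mp, cS, eP, Equiv.swap_apply_def]
    · by_cases hij : i = j
      · subst hij
        simp [gY, mp, cS]; rfl
      · simp [gY, hij]
  exact congrArg (fun φ : Rpoly K (e + 1) →ₐ[K] MvPolynomial (TT e) K => φ f) this

lemma co_parity (h2 : (2:K) ≠ 0) {f : Rpoly K (e + 1)} (hf : f ∈ invAlg K (e + 1)) (m : TT e →₀ ℕ) (hm : coeff m (thL K e f) ≠ 0) :
    Even (m (.inr (.inl 1)) + m (.inr (.inl 2))) ∧ Even (m (.inr (.inl 0)) + m (.inr (.inl 2))) := by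
  have hne : (-1 : K) ≠ 1 := fun h => h2 (by linear_combination -h)
  constructor
  · have h := coeff_mp (cS ![1, -1, -1]) (Equiv.refl _) (thL K e f) m
    rw [thL_sign ![-1, 1, 1] _ (by intro i; fin_cases i <;> simp) (by simp) (by simp) (by simp) hf] at h
    rw [show m.mapDomain (Equiv.refl (TT e)) = m from Finsupp.mapDomain_id] at h
    simp [Fintype.prod_sum_type, Fin.prod_univ_three, cS, hm, ← pow_add] at h
    by_contra hc
    rw [Nat.not_even_iff_odd] at hc
    rw [hc.neg_one_pow] at h; exact hne h
  · have h := coeff_mp (cS ![-1, 1, -1]) (Equiv.refl _) (thL K e f) m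
    rw [thL_sign ![1, -1, 1] _ (by intro i; fin_cases i <;> simp) (by simp) (by simp) (by simp) hf] at h
    rw [show m.mapDomain (Equiv.refl (TT e)) = m from Finsupp.mapDomain_id] at h
    simp [Fintype.prod_sum_type, Fin.prod_univ_three, cS, hm, ← pow_add] at h
    by_contra hc
    rw [Nat.not_even_iff_odd] at hc
    rw [hc.neg_one_pow] at h; exact hne h

lemma map_fix (τ : Fin 3 ≃ Fin 3) (m : TT e →₀ ℕ) (ha : ∀ i, m (.inl (τ i)) = m (.inl i)) (hv : ∀ i, m (.inr (.inl (τ i))) = m (.inr (.inl i))) :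
    m.mapDomain (eP τ) = m := by
  have : ∀ t, m ((eP τ) t) = m t := by
    rintro (i | i | i)
    · exact ha i
    · exact hv i
    · rfl
  ext t
  obtain ⟨t, rfl⟩ := (eP τ).surjective t
  rw [Finsupp.mapDomain_apply (eP τ).injective, this]

lemma co_alt (h2 : (2:K) ≠ 0) {f : Rpoly K (e + 1)} (hf : f ∈ invAlg K (e + 1)) (m : TT e →₀ ℕ) (hm : coeff m (thL K e f) ≠ 0)
    (hv : ∀ i, m (.inr (.inl i)) = 1) (p q : Fin 3) (hpq : p ≠ q) : m (.inl p) ≠ m (.inl q) := by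
  intro h
  have h1 := coeff_mp (cS fun _ => -1) (eP (Equiv.swap p q)) (thL K e f) m
  rw [← thL_perm p q hpq, act_perm _ hf, map_fix _ m (fun i => ?_) (fun i => by rw [hv, hv])] at h1
  · simp [Fintype.prod_sum_type, Fin.prod_univ_three, cS, hv] at h1
    have h4 : (2:K) * coeff m (thL K e f) = 0 := by linear_combination h1
    exact hm ((mul_eq_zero.1 h4).resolve_left h2)
  · rw [Equiv.swap_apply_def]
    split
    · next hh => rw [hh, h]
    · split
      · next hh => rw [hh, h]
      · rfl

lemma thL_pd (k : Fin e) (f : Rpoly K (e + 1)) :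
    pderiv (.inr (.inr k)) (thL K e f) = thL K e (∑ i, pderiv (i, i, k.succ) f) := by
  induction f using MvPolynomial.induction_on with
  | C a => simp [algHom_C]
  | add p q hp hq => simp only [_root_.map_add, hp, hq, Finset.sum_add_distrib]
  | mul_X p t hp =>
    rw [_root_.map_mul, Derivation.leibniz, hp]
    simp only [Derivation.leibniz, Finset.sum_add_distrib, _root_.map_add, smul_eq_mul, ← Finset.mul_sum, _root_.map_mul]
    congr 2
    obtain ⟨i, j, l⟩ := t
    rw [thL_X]
    refine Fin.cases ?_ (fun l => ?_) l
    · simp only [pderiv_X, Fin.sum_univ_three]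
      fin_cases i <;> fin_cases j <;> simp [gY, gX, pderiv_X, Pi.single_apply]
    · simp only [pderiv_X, Fin.sum_univ_three]
      by_cases hkl : k = l
      · subst hkl
        fin_cases i <;> fin_cases j <;> simp [gY, Pi.single_apply]
      · fin_cases i <;> fin_cases j <;> simp [gY, pderiv_X, Pi.single_apply, hkl, Ne.symm hkl]

lemma co_s (h3 : (3:K) = 0) (h2 : (2:K) ≠ 0) {f : Rpoly K (e + 1)} (hf : f ∈ invAlg K (e + 1)) (m : TT e →₀ ℕ)
    (ha : ∀ i, m (.inl i) = 0) (hv : ∀ i, m (.inr (.inl i)) = 0) (k : Fin e) (hk : m (.inr (.inr k)) = 1 ∨ m (.inr (.inr k)) = 2) :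
    coeff m (thL K e f) = 0 := by
  obtain ⟨γ, rfl⟩ : ∃ γ, m = γ + Finsupp.single (.inr (.inr k)) 1 :=
    ⟨m - Finsupp.single (.inr (.inr k)) 1, (tsub_add_cancel_of_le (by
      rw [Finsupp.single_le_iff]; omega)).symm⟩
  have h := coeff_pderiv (i := .inr (.inr k)) (thL K e f) γ
  rw [thL_pd] at h
  have ha' : ∀ i, γ (.inl i) = 0 := fun i => by have := ha i; simp at this; exact this
  have hv' : ∀ i, γ (.inr (.inl i)) = 0 := fun i => by have := hv i; simp at this; exact this
  have key : ∀ p q : Fin 3, p ≠ q → coeff γ (thL K e (pderiv (q, q, k.succ) f)) = coeff γ (thL K e (pderiv (p, p, k.succ) f)) := by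
    intro p q hpq
    have e1 := pderiv_rename (rP_inj (Equiv.swap p q) (e + 1)) (p, p, k.succ) f
    rw [act_perm _ hf] at e1
    have e2 : rP (Equiv.swap p q) (e + 1) (p, p, k.succ) = (q, q, k.succ) := by simp [rP]
    rw [e2] at e1
    rw [e1, thL_perm p q hpq]
    have := coeff_mp (cS fun _ => -1) (eP (Equiv.swap p q)) (thL K e (pderiv (p, p, k.succ) f)) γ
    rw [map_fix _ γ (fun i => by simp [ha']) (fun i => by simp [hv'])] at this
    rw [this]
    simp [Fintype.prod_sum_type, cS, hv']
  rw [Fin.sum_univ_three, _root_.map_add, _root_.map_add, coeff_add, coeff_add, key 0 1 (by decide), key 0 2 (by decide)] at h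
  have h0 : coeff (γ + Finsupp.single (Sum.inr (Sum.inr k)) 1) (thL K e f) * ((γ (.inr (.inr k)) : K) + 1) = 0 := by
    rw [← h]; linear_combination (coeff γ (thL K e (pderiv (0, 0, k.succ) f))) * h3
  refine (mul_eq_zero.1 h0).resolve_right ?_
  simp at hk
  rcases hk with hk | hk
  · simp [hk]
  · rw [hk]; intro hc; exact h2 (by rw [← hc]; norm_num)

end low
end O3

open Matrix MvPolynomial
namespace O3

section low2
variable {K : Type} [Field K] {e : ℕ}

noncomputable def muU (e : ℕ) : TT e →₀ ℕ := (Finsupp.single (.inr (.inl 0)) 1 + Finsupp.single (.inr (.inl 1)) 1 +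
  Finsupp.single (.inr (.inl 2)) 1) + ∑ j : Fin e, Finsupp.single (.inr (.inr j)) 2
noncomputable def mu (e : ℕ) (i j : Fin 3) : TT e →₀ ℕ := (Finsupp.single (.inl i) 2 + Finsupp.single (.inl j) 1) + muU e

lemma mu_a (i j t) : mu e i j (.inl t) = (if i = t then 2 else 0) + (if j = t then 1 else 0) := by
  simp [mu, muU, Finsupp.single_apply]
lemma mu_v (i j t) : mu e i j (.inr (.inl t)) = 1 := by
  fin_cases t <;> simp [mu, muU, Finsupp.single_apply]
lemma mu_s (i j t) : mu e i j (.inr (.inr t)) = 2 := by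
  simp [mu, muU, Finsupp.single_apply]

lemma thL_c0 (p : Rpoly K (e + 1)) : coeff 0 (thL K e p) = coeff 0 p := by
  have : (constantCoeff).comp (thL K e).toRingHom = constantCoeff := by
    apply MvPolynomial.ringHom_ext
    · intro r; simp [algHom_C]
    · rintro ⟨i, j, k⟩
      change constantCoeff (thL K e (X (i, j, k))) = _
      rw [thL_X]
      refine Fin.cases ?_ (fun k => ?_) k
      · fin_cases i <;> fin_cases j <;> simp [gY, gX]
      · simp [gY]
  exact congrArg (fun φ : Rpoly K (e + 1) →+* K => φ p) this

lemma co_half (h2 : (2:K) ≠ 0) (h3 : (3:K) = 0) {p q : Rpoly K (e + 1)} (hp : p ∈ invAlg K (e + 1)) (hq : q ∈ invAlg K (e + 1))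
    (hq0 : coeff 0 q = 0) (m n : TT e →₀ ℕ) (hmn : m + n = mu e 0 1) (hm : ∀ i, m (.inr (.inl i)) = 1)
    (h : coeff m (thL K e p) ≠ 0) : coeff n (thL K e q) = 0 := by
  have hs : ∀ t, m t + n t = mu e 0 1 t := fun t => by rw [← hmn]; rfl
  have hv : ∀ i, n (.inr (.inl i)) = 0 := fun i => by
    have := hs (.inr (.inl i)); rw [mu_v, hm] at this; omega
  have a0 := hs (.inl 0)
  have a1 := hs (.inl 1)
  have a2 := hs (.inl 2)
  simp [mu_a] at a0 a1 a2
  have d1 := co_alt h2 hp m h hm 0 1 (by decide)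
  have d2 := co_alt h2 hp m h hm 0 2 (by decide)
  have d3 := co_alt h2 hp m h hm 1 2 (by decide)
  have ha : ∀ i, n (.inl i) = 0 := fun i => by fin_cases i <;> simp <;> omega
  by_cases hk : ∃ k, n (.inr (.inr k)) ≠ 0
  · obtain ⟨k, hk⟩ := hk
    have := hs (.inr (.inr k)); rw [mu_s] at this
    exact co_s h3 h2 hq n ha hv k (by omega)
  · push Not at hk
    have : n = 0 := by
      ext t
      rcases t with i | i | i
      · exact ha i
      · exact hv i
      · exact hk i
    rw [this, thL_c0, hq0]

lemma co_prod (h2 : (2:K) ≠ 0) (h3 : (3:K) = 0) {p q : Rpoly K (e + 1)} (hp : p ∈ invAlg K (e + 1)) (hq : q ∈ invAlg K (e + 1))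
    (hp0 : coeff 0 p = 0) (hq0 : coeff 0 q = 0) : coeff (mu e 0 1) (thL K e (p * q)) = 0 := by
  classical
  rw [_root_.map_mul, coeff_mul]
  refine Finset.sum_eq_zero fun x hx => ?_
  obtain ⟨m, n⟩ := x
  rw [Finset.HasAntidiagonal.mem_antidiagonal] at hx
  simp only at hx ⊢
  by_contra hc
  have h1 := left_ne_zero_of_mul hc
  have h1' := right_ne_zero_of_mul hc
  obtain ⟨e1, e2⟩ := co_parity h2 hp m h1
  have hs : ∀ i, m (.inr (.inl i)) + n (.inr (.inl i)) = 1 := fun i => by rw [← mu_v (e := e) 0 1 i, ← hx]; rfl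
  have s0 := hs 0
  have s1 := hs 1
  have s2 := hs 2
  rw [Nat.even_iff] at e1 e2
  by_cases h0 : m (.inr (.inl 0)) = 1
  · exact h1' (co_half h2 h3 hp hq hq0 m n hx (fun i => by fin_cases i <;> simp <;> omega) h1)
  · exact h1 (co_half h2 h3 hq hp hp0 n m (by rw [add_comm]; exact hx) (fun i => by fin_cases i <;> simp <;> omega) h1')

lemma co_J (h2 : (2:K) ≠ 0) (h3 : (3:K) = 0) {f : Rpoly K (e + 1)} (hf : f ∈ JS K (e + 1)) :
    coeff (mu e 0 1) (thL K e f) = 0 := by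
  obtain ⟨x, hx, rfl⟩ := hf
  change x ∈ plusIdeal K (e + 1) ^ 2 at hx
  change coeff _ (thL K e (x : Rpoly K (e + 1))) = 0
  have hpl : ∀ p ∈ plusIdeal K (e + 1), coeff 0 (p : Rpoly K (e + 1)) = 0 := by
    have : plusIdeal K (e + 1) ≤ RingHom.ker ((constantCoeff (R := K) (σ := Fin 3 × Fin 3 × Fin (e + 1))).comp (invAlg K (e + 1)).val.toRingHom) := by
      refine Ideal.span_le.2 ?_
      rintro p ⟨n, hn, hp⟩
      change coeff 0 (p : Rpoly K (e + 1)) = 0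
      exact hp.coeff_eq_zero (by simpa using hn.ne)
    exact fun p hp => this hp
  rw [pow_two] at hx
  induction hx using Submodule.mul_induction_on' with
  | mem_mul_mem p hp q hq => exact co_prod h2 h3 p.2 q.2 (hpl p hp) (hpl q hq)
  | add x _ y _ hx hy =>
    change coeff _ (thL K e ((x : Rpoly K (e + 1)) + y)) = 0
    rw [_root_.map_add, coeff_add, hx, hy, add_zero]

noncomputable def pr (K : Type) [Field K] (e : ℕ) : Matrix (Fin 3) (Fin 3) (Rpoly K (e + 1)) :=
  ((List.finRange e).map fun k => genMat K (e + 1) k.succ * genMat K (e + 1) k.succ).prod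

noncomputable def fM (K : Type) [Field K] (e : ℕ) : Matrix (Fin 3) (Fin 3) (Rpoly K (e + 1)) :=
  lR K (e + 1) (.inl 0) * lR K (e + 1) (.inl 0) * (lR K (e + 1) (.inr 0) * lR K (e + 1) (.inr 0)) *
    (lR K (e + 1) (.inl 0) * lR K (e + 1) (.inr 0)) * pr K e

lemma fM_eqv : Eqv (fM K e) := by
  have hp : Eqv (pr K e) := by
    unfold pr
    induction List.finRange e with
    | nil => exact Eqv.one
    | cons k l ih => rw [List.map_cons, List.prod_cons]; exact ((Eqv.gen _).mul (Eqv.gen _)).mul ih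
  exact ((((Eqv.l _).mul (Eqv.l _)).mul ((Eqv.l _).mul (Eqv.l _))).mul ((Eqv.l _).mul (Eqv.l _))).mul hp

lemma fM_hom : (fM K e).trace.IsHomogeneous (2 * (e + 1) + 4) := by
  have hg : ∀ k i j, (genMat K (e + 1) k i j).IsHomogeneous 1 := fun k i j => isHomogeneous_X _ _
  have hp : ∀ i j, (pr K e i j).IsHomogeneous (2 * e) := by
    unfold pr
    have : ∀ l : List (Fin e), ∀ i j, ((l.map fun k => genMat K (e + 1) k.succ * genMat K (e + 1) k.succ).prod i j).IsHomogeneous (2 * l.length) := by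
      intro l
      induction l with
      | nil => exact hom_w (d := e + 1) []
      | cons k l ih =>
        intro i j
        rw [List.map_cons, List.prod_cons, List.length_cons, show 2 * (l.length + 1) = (1 + 1) + 2 * l.length by ring]
        exact hom_mul (hom_mul (hg _) (hg _)) ih i j
    simpa using this (List.finRange e)
  have := hom_tr (hom_mul (hom_mul (hom_mul (hom_mul (hom_l (K := K) (d := e + 1) (.inl 0)) (hom_l (.inl 0))) (hom_mul (hom_l (.inr 0)) (hom_l (.inr 0))))
    (hom_mul (hom_l (.inl 0)) (hom_l (.inr 0)))) hp)
  rw [show 2 * (e + 1) + 4 = 1 + 1 + (1 + 1) + (1 + 1) + 2 * e by ring]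
  exact this

lemma mon_mu (i j : Fin 3) : (monomial (mu e i j) 1 : MvPolynomial (TT e) K) =
    X (.inl i) ^ 2 * X (.inl j) * (X (.inr (.inl 0)) * X (.inr (.inl 1)) * X (.inr (.inl 2)) * ∏ k : Fin e, X (.inr (.inr k)) ^ 2) := by
  have hm : ∀ a b : TT e →₀ ℕ, (monomial (a + b) 1 : MvPolynomial (TT e) K) = monomial a 1 * monomial b 1 := by
    intro a b; rw [monomial_mul, one_mul]
  rw [mu, muU, hm, hm, hm, hm, hm, monomial_sum_one]
  simp only [X_pow_eq_monomial]
  rfl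

lemma th_f (h2 : (2:K) ≠ 0) : thL K e (fM K e).trace = monomial (mu e 0 1) 1 - monomial (mu e 1 0) 1 + monomial (mu e 1 2) 1
    - monomial (mu e 2 1) 1 + monomial (mu e 2 0) 1 - monomial (mu e 0 2) 1 := by
  have hX : ∀ k, (thL K e).mapMatrix (genMat K (e + 1) k) = gY K e k := by
    intro k; ext i j : 2
    exact congrArg _ (thL_X i j k)
  have hp : (thL K e).mapMatrix (pr K e) = (∏ k : Fin e, (X (.inr (.inr k)) : MvPolynomial (TT e) K) ^ 2) • 1 := by
    rw [pr, _root_.map_list_prod, List.map_map, ← List.prod_ofFn]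
    have : ∀ l : List (Fin e), (List.map ((thL K e).mapMatrix ∘ fun k : Fin e => genMat K (e + 1) k.succ * genMat K (e + 1) k.succ) l).prod
      = (List.map (fun k : Fin e => (X (.inr (.inr k)) : MvPolynomial (TT e) K) ^ 2) l).prod • 1 := by
      intro l
      induction l with
      | nil => simp
      | cons k l ih =>
        rw [List.map_cons, List.prod_cons, ih, List.map_cons, List.prod_cons, Function.comp, _root_.map_mul, hX]
        simp [gY, smul_smul, pow_two, mul_assoc, mul_comm]
    rw [this, List.ofFn_eq_map]
  have hC : (C (2:K)⁻¹ : MvPolynomial (TT e) K) * 2 = 1 := by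
    rw [show (2 : MvPolynomial (TT e) K) = C 2 from (map_ofNat C 2).symm, ← C_mul, inv_mul_cancel₀ h2, C_1]
  have hs : (thL K e).mapMatrix (lR K (e + 1) (.inl 0)) = Matrix.diagonal fun i => X (.inl i) := by
    rw [lR, _root_.map_smul, _root_.map_add, hX, show (thL K e).mapMatrix (genMat K (e + 1) 0)ᵀ = (gY K e 0)ᵀ by rw [← hX]; rfl]
    ext i j : 2
    fin_cases i <;> fin_cases j <;> simp [gY, gX, smul_eq_C_mul, ← two_mul, ← mul_assoc, hC]
  have hk : (thL K e).mapMatrix (lR K (e + 1) (.inr 0)) = !![0, -X (.inr (.inl 2)), X (.inr (.inl 1)); X (.inr (.inl 2)), 0, -X (.inr (.inl 0));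
    -X (.inr (.inl 1)), X (.inr (.inl 0)), 0] := by
    rw [lR, _root_.map_smul, _root_.map_sub, hX, show (thL K e).mapMatrix (genMat K (e + 1) 0)ᵀ = (gY K e 0)ᵀ by rw [← hX]; rfl]
    ext i j : 2
    fin_cases i <;> fin_cases j <;> simp [gY, gX, smul_eq_C_mul] <;>
      (field_simp; ring)
  have ht : thL K e (fM K e).trace = ((thL K e).mapMatrix (fM K e)).trace := by simp [Matrix.trace_fin_three]
  rw [ht, fM, _root_.map_mul, _root_.map_mul, _root_.map_mul, _root_.map_mul, _root_.map_mul, _root_.map_mul, hs, hk, hp,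
    mul_smul_comm, mul_one, Matrix.trace_smul]
  simp only [mon_mu]
  simp [Matrix.mul_apply, Fin.sum_univ_three, Matrix.trace_fin_three, Matrix.diagonal_apply]
  ring

theorem lower (h2 : (2:K) ≠ 0) (h3 : (3:K) = 0) : (fM K e).trace ∉ JS K (e + 1) := by
  classical
  intro h
  have := co_J h2 h3 h
  have hne : ∀ i j, (i ≠ 0 ∨ j ≠ 1) → i ≠ j → mu e i j ≠ mu e 0 1 := by
    intro i j h hij hc
    have c0 := DFunLike.congr_fun hc (.inl 0)
    have c1 := DFunLike.congr_fun hc (.inl 1)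
    rw [mu_a, mu_a] at c0 c1
    fin_cases i <;> fin_cases j <;> simp_all
  rw [th_f h2] at this
  simp only [coeff_add, coeff_sub, coeff_monomial] at this
  rw [if_pos trivial, if_neg (hne 1 0 (by decide) (by decide)), if_neg (hne 1 2 (by decide) (by decide)),
    if_neg (hne 2 1 (by decide) (by decide)), if_neg (hne 2 0 (by decide) (by decide)), if_neg (hne 0 2 (by decide) (by decide))] at this
  simp at this
end low2
end O3

theorem stmt0 (F : Type) [Field F] [Infinite F] [CharP F 3] (d : ℕ) (hd : 1 ≤ d) :
    (∃ n : ℕ, 2 * d + 4 ≤ n ∧ ∃ f : Rpoly F d, f ∈ invAlg F d ∧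
        MvPolynomial.IsHomogeneous f n ∧ f ∉ decompSet F d) ∧
    (∀ n : ℕ, ∀ f : Rpoly F d, f ∈ invAlg F d → MvPolynomial.IsHomogeneous f n →
        f ∉ decompSet F d → n ≤ 2 * d + 7) := by
  have h3 : (3:F) = 0 := by exact_mod_cast CharP.cast_eq_zero F 3
  have h2 : (2:F) ≠ 0 := by
    intro h
    exact one_ne_zero (α := F) (by linear_combination h3 - h)
  constructor
  · obtain ⟨e, rfl⟩ : ∃ e, d = e + 1 := ⟨d - 1, by omega⟩
    exact ⟨_, le_rfl, _, O3.fM_eqv.tr, O3.fM_hom, fun h => O3.lower h2 h3 h⟩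
  · intro n f hf hn hd
    by_contra hc
    exact hd (O3.upper h2 h3 hf hn (by omega))
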